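/- arXiv:math-ph/0311024 — 3 statements merged into one kernel-verified Lean document; each statement's English description precedes it below -/
import Mathlib

section
/- Fix an integer d' ≥ 1 and a real s > 1. Let A ⊆ ℝ^{d'} be a compact subset of a 1-rectifiable manifold in ℝ^{d'}. Then, with the limit taken in [0,∞], lim_{N→∞} ℰ_s(A,N)/N^{1+s} = 2ζ(s)/H_1(A)^s, where ζ is the Riemann zeta function (so the limit is +∞ when H_1(A) = 0). -/
open scoped ENNReal NNReal BigOperators Classical
open MeasureTheory Filter Metric Set Topology

/-- The Riesz `s`-energy of a finite configuration `ω`, valued in `[0,∞]`. -/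
noncomputable def rieszEnergy {E : Type*} [PseudoEMetricSpace E] (s : ℝ) (ω : Finset E) : ℝ≥0∞ :=
  ∑ x ∈ ω, ∑ y ∈ ω, if x = y then 0 else edist x y ^ (-s)

/-- The `N`-point minimal Riesz `s`-energy over a set `A` (infimum over all `N`-point
subsets of `A`; `∞` if there is none). -/
noncomputable def minRieszEnergy {E : Type*} [PseudoEMetricSpace E] (s : ℝ) (A : Set E)
    (N : ℕ) : ℝ≥0∞ :=
  ⨅ (ω : Finset E) (_ : ↑ω ⊆ A) (_ : ω.card = N), rieszEnergy s ω

/-- `A ⊆ ℝ^{d'}` is a `d`-rectifiable manifold: a finite union of images of compact subsets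
of `ℝ^d` under maps that are bi-Lipschitz on open neighborhoods of those compact sets. -/
def IsRectifiableManifold (d d' : ℕ) (A : Set (EuclideanSpace ℝ (Fin d'))) : Prop :=
  ∃ (n : ℕ) (K : Fin n → Set (EuclideanSpace ℝ (Fin d)))
    (φ : Fin n → EuclideanSpace ℝ (Fin d) → EuclideanSpace ℝ (Fin d')),
    (∀ k, IsCompact (K k)) ∧
    (∀ k, ∃ (G : Set (EuclideanSpace ℝ (Fin d))) (L : ℝ), IsOpen G ∧ K k ⊆ G ∧ 1 ≤ L ∧
      ∀ x ∈ G, ∀ y ∈ G,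
        (1 / L) * dist x y ≤ dist (φ k x) (φ k y) ∧ dist (φ k x) (φ k y) ≤ L * dist x y) ∧
    A = ⋃ k, φ k '' K k

/-- The unit cube `[0,1]^d` in `ℝ^d`. -/
def unitCube (d : ℕ) : Set (EuclideanSpace ℝ (Fin d)) := {x | ∀ i, x i ∈ Set.Icc (0 : ℝ) 1}

/-- `d`-dimensional Hausdorff measure on `ℝ^{d'}`, normalized so that the unit cube of `ℝ^d`
has measure `1`. -/
noncomputable def normHausdorff (d d' : ℕ) : Measure (EuclideanSpace ℝ (Fin d')) :=
  (μH[(d : ℝ)] (unitCube d))⁻¹ • μH[(d : ℝ)]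


/-! ### The real-valued energy -/

section RealEnergy

variable {X Y : Type*} [MetricSpace X] [MetricSpace Y]

/-- The real-valued Riesz energy. The diagonal does not contribute for `s ≠ 0`,
because `0 ^ (-s) = 0`. -/
noncomputable def realEnergy (s : ℝ) (ω : Finset X) : ℝ :=
  ∑ x ∈ ω, ∑ y ∈ ω, dist x y ^ (-s)

lemma dist_rpow_nonneg (s : ℝ) (x y : X) : 0 ≤ dist x y ^ (-s) :=
  Real.rpow_nonneg dist_nonneg _

lemma rieszEnergy_eq_ofReal {s : ℝ} (hs : s ≠ 0) (ω : Finset X) :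
    rieszEnergy s ω = ENNReal.ofReal (realEnergy s ω) := by
  unfold rieszEnergy realEnergy
  rw [ENNReal.ofReal_sum_of_nonneg
    (fun x _ => Finset.sum_nonneg fun y _ => dist_rpow_nonneg s x y)]
  refine Finset.sum_congr rfl fun x _ => ?_
  rw [ENNReal.ofReal_sum_of_nonneg (fun y _ => dist_rpow_nonneg s x y)]
  refine Finset.sum_congr rfl fun y _ => ?_
  split_ifs with h
  · simp [h, Real.zero_rpow (neg_ne_zero.2 hs)]
  · rw [edist_dist, ENNReal.ofReal_rpow_of_pos (dist_pos.2 h)]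

lemma realEnergy_mono {s : ℝ} {ω₁ ω₂ : Finset X} (h : ω₁ ⊆ ω₂) :
    realEnergy s ω₁ ≤ realEnergy s ω₂ :=
  (Finset.sum_le_sum fun x _ => Finset.sum_le_sum_of_subset_of_nonneg h
    fun y _ _ => dist_rpow_nonneg s x y).trans
  (Finset.sum_le_sum_of_subset_of_nonneg h
    fun x _ _ => Finset.sum_nonneg fun y _ => dist_rpow_nonneg s x y)

lemma realEnergy_union {s : ℝ} {ω₁ ω₂ : Finset X} (h : Disjoint ω₁ ω₂) :
    realEnergy s (ω₁ ∪ ω₂) = realEnergy s ω₁ + realEnergy s ω₂ +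
      2 * ∑ x ∈ ω₁, ∑ y ∈ ω₂, dist x y ^ (-s) := by
  have hc : ∑ x ∈ ω₂, ∑ y ∈ ω₁, dist x y ^ (-s) = ∑ x ∈ ω₁, ∑ y ∈ ω₂, dist x y ^ (-s) := by
    rw [Finset.sum_comm]
    simp only [dist_comm]
  simp only [realEnergy, Finset.sum_union h, Finset.sum_add_distrib]
  rw [hc]
  ring

lemma realEnergy_union_ge {s : ℝ} {ω₁ ω₂ : Finset X} (h : Disjoint ω₁ ω₂) :
    realEnergy s ω₁ + realEnergy s ω₂ ≤ realEnergy s (ω₁ ∪ ω₂) := by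
  rw [realEnergy_union h]
  have : 0 ≤ ∑ x ∈ ω₁, ∑ y ∈ ω₂, dist x y ^ (-s) :=
    Finset.sum_nonneg fun x _ => Finset.sum_nonneg fun y _ => dist_rpow_nonneg s x y
  linarith

lemma rpow_neg_le_of_le_mul {s K a b : ℝ} (hs : 0 < s) (hK : 0 < K) (ha : 0 ≤ a) (hb : 0 ≤ b)
    (hba : b ≠ 0 → 0 < a) (h : a ≤ K * b) : b ^ (-s) ≤ K ^ s * a ^ (-s) := by
  rcases hb.eq_or_lt with rfl | hb
  · rw [Real.zero_rpow (by linarith)]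
    positivity
  · have ha := hba hb.ne'
    have h1 : a ^ s ≤ K ^ s * b ^ s := by
      rw [← Real.mul_rpow hK.le hb.le]
      exact Real.rpow_le_rpow ha.le h hs.le
    have h2 : 0 < a ^ s := Real.rpow_pos_of_pos ha s
    have h3 : 0 < b ^ s := Real.rpow_pos_of_pos hb s
    rw [Real.rpow_neg hb.le, Real.rpow_neg ha.le, ← div_eq_mul_inv, le_div_iff₀ h2,
      inv_mul_le_iff₀ h3]
    linarith

/-- A map that contracts distances by at most a factor `K` raises the energy by at most `K ^ s`. -/
lemma realEnergy_image_le {s K : ℝ} (hs : 0 < s) (hK : 0 < K) {ω : Finset X} {f : X → Y}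
    (hf : ∀ x ∈ ω, ∀ y ∈ ω, dist x y ≤ K * dist (f x) (f y)) :
    (ω.image f).card = ω.card ∧ realEnergy s (ω.image f) ≤ K ^ s * realEnergy s ω := by
  have hinj : Set.InjOn f ω := fun x hx y hy hxy => by
    have := hf x hx y hy
    rw [hxy, dist_self, mul_zero] at this
    exact dist_le_zero.1 this
  refine ⟨Finset.card_image_of_injOn hinj, ?_⟩
  unfold realEnergy
  rw [Finset.sum_image hinj, Finset.mul_sum]
  refine Finset.sum_le_sum fun x hx => ?_
  rw [Finset.sum_image hinj, Finset.mul_sum]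
  refine Finset.sum_le_sum fun y hy => ?_
  refine rpow_neg_le_of_le_mul hs hK dist_nonneg dist_nonneg (fun h => ?_) (hf x hx y hy)
  exact dist_pos.2 fun h' => h (by rw [h', dist_self])

end RealEnergy

/-! ### Hölder-type inequalities -/

lemma rpow_sum_div_rpow_sum_le {ι : Type*} {s : ℝ} (hs : 0 < s) (T : Finset ι) {a b : ι → ℝ}
    (ha : ∀ i ∈ T, 0 ≤ a i) (hb : ∀ i ∈ T, 0 < b i) :
    (∑ i ∈ T, a i) ^ (1 + s) / (∑ i ∈ T, b i) ^ s ≤ ∑ i ∈ T, a i ^ (1 + s) / b i ^ s := by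
  rcases T.eq_empty_or_nonempty with rfl | hT
  · simp [Real.zero_rpow (by linarith : 1 + s ≠ 0)]
  set B := ∑ i ∈ T, b i with hB
  have hBpos : 0 < B := Finset.sum_pos hb hT
  have key := Real.rpow_arith_mean_le_arith_mean_rpow T (fun i => b i / B) (fun i => a i / b i)
    (fun i hi => (div_pos (hb i hi) hBpos).le)
    (by rw [← Finset.sum_div, div_self hBpos.ne'])
    (fun i hi => div_nonneg (ha i hi) (hb i hi).le) (by linarith : (1 : ℝ) ≤ 1 + s)
  have e1 : ∑ i ∈ T, b i / B * (a i / b i) = (∑ i ∈ T, a i) / B := by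
    rw [Finset.sum_div]
    refine Finset.sum_congr rfl fun i hi => ?_
    have := (hb i hi).ne'
    field_simp
  have e2 : ∑ i ∈ T, b i / B * (a i / b i) ^ (1 + s) = (∑ i ∈ T, a i ^ (1 + s) / b i ^ s) / B := by
    rw [Finset.sum_div]
    refine Finset.sum_congr rfl fun i hi => ?_
    have hbi := hb i hi
    rw [Real.div_rpow (ha i hi) hbi.le, Real.rpow_add hbi, Real.rpow_one]
    have := (Real.rpow_pos_of_pos hbi s).ne'
    field_simp
  rw [e1, e2, Real.div_rpow (Finset.sum_nonneg ha) hBpos.le, Real.rpow_add hBpos,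
    Real.rpow_one] at key
  have hBs := Real.rpow_pos_of_pos hBpos s
  rw [div_le_iff₀ (by positivity)] at key
  rw [div_le_iff₀ hBs]
  calc _ ≤ _ := key
    _ = _ := by field_simp

lemma card_rpow_div_rpow_sum_le {ι : Type*} {s : ℝ} (hs : 0 < s) (T : Finset ι) {d : ι → ℝ}
    (hd : ∀ i ∈ T, 0 < d i) :
    (T.card : ℝ) ^ (1 + s) / (∑ i ∈ T, d i) ^ s ≤ ∑ i ∈ T, d i ^ (-s) := by
  have := rpow_sum_div_rpow_sum_le hs T (a := fun _ => 1) (fun _ _ => zero_le_one) hd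
  simp only [Finset.sum_const, nsmul_eq_mul, mul_one, Real.one_rpow] at this
  refine this.trans (Finset.sum_le_sum fun i hi => ?_)
  rw [Real.rpow_neg (hd i hi).le, one_div]

/-! ### Lower energy bounds -/

/-- `D` satisfies the asymptotic lower energy bound of a segment of length `ℓ`, up to bounded
errors in the number of points and truncation of the zeta series. -/
def EnergyLowerBound {X : Type*} [MetricSpace X] (s : ℝ) (D : Set X) (ℓ : ℝ) : Prop :=
  ∀ M : ℕ, ∃ q : ℝ, ∀ ω : Finset X, ↑ω ⊆ D →
    2 * (∑ m ∈ Finset.range M, (m : ℝ) ^ (-s)) * (max (ω.card - q) 0) ^ (1 + s) / ℓ ^ s ≤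
      realEnergy s ω

lemma sum_range_rpow_nonneg (s : ℝ) (M : ℕ) : 0 ≤ ∑ m ∈ Finset.range M, (m : ℝ) ^ (-s) :=
  Finset.sum_nonneg fun _ _ => by positivity

namespace EnergyLowerBound

variable {X Y : Type*} [MetricSpace X] [MetricSpace Y] {s : ℝ}

lemma empty (hs : 0 < s) (ℓ : ℝ) : EnergyLowerBound s (∅ : Set X) ℓ := fun M => ⟨0, fun ω hω => by
  have : ω = ∅ := by simpa using hω
  subst this
  simp [realEnergy, Real.zero_rpow (by linarith : 1 + s ≠ 0)]⟩

lemma mono_length (hs : 0 < s) {D : Set X} {ℓ₁ ℓ₂ : ℝ} (h₁ : 0 < ℓ₁) (h : ℓ₁ ≤ ℓ₂)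
    (H : EnergyLowerBound s D ℓ₁) : EnergyLowerBound s D ℓ₂ := fun M => by
  obtain ⟨q, hq⟩ := H M
  refine ⟨q, fun ω hω => le_trans ?_ (hq ω hω)⟩
  have := sum_range_rpow_nonneg s M
  gcongr

lemma of_image (hs : 0 < s) {D : Set X} {ℓ K : ℝ} (hK : 0 < K) (hℓ : 0 < ℓ) {u : X → Y}
    (hu : ∀ x ∈ D, ∀ y ∈ D, dist x y ≤ K * dist (u x) (u y) ∧ dist (u x) (u y) ≤ K * dist x y)
    (H : EnergyLowerBound s (u '' D) ℓ) : EnergyLowerBound s D (K * ℓ) := fun M => by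
  obtain ⟨q, hq⟩ := H M
  refine ⟨q, fun ω hω => ?_⟩
  obtain ⟨hc, hE⟩ := realEnergy_image_le hs hK (ω := ω) (f := u)
    fun x hx y hy => (hu x (hω hx) y (hω hy)).1
  have h1 := hq (ω.image u) (by rw [Finset.coe_image]; exact Set.image_mono hω)
  rw [hc] at h1
  have hKs : 0 < K ^ s := Real.rpow_pos_of_pos hK s
  have hℓs : 0 < ℓ ^ s := Real.rpow_pos_of_pos hℓ s
  have h2 := h1.trans hE
  rw [Real.mul_rpow hK.le hℓ.le, div_le_iff₀ (by positivity)]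
  rw [div_le_iff₀ hℓs] at h2
  linarith

lemma union (hs : 0 < s) {D₁ D₂ : Set X} {ℓ₁ ℓ₂ : ℝ} (h₁ : 0 < ℓ₁) (h₂ : 0 < ℓ₂)
    (H₁ : EnergyLowerBound s D₁ ℓ₁) (H₂ : EnergyLowerBound s D₂ ℓ₂) :
    EnergyLowerBound s (D₁ ∪ D₂) (ℓ₁ + ℓ₂) := fun M => by
  obtain ⟨q₁, hq₁⟩ := H₁ M
  obtain ⟨q₂, hq₂⟩ := H₂ M
  refine ⟨q₁ + q₂, fun ω hω => ?_⟩
  set ω₁ := ω.filter (· ∈ D₁)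
  set ω₂ := ω.filter (· ∉ D₁)
  have hd : Disjoint ω₁ ω₂ := Finset.disjoint_filter_filter_not _ _ _
  have hu : ω₁ ∪ ω₂ = ω := Finset.filter_union_filter_not_eq _ _
  have e₁ := hq₁ ω₁ fun x hx => (Finset.mem_filter.1 hx).2
  have e₂ := hq₂ ω₂ fun x hx =>
    (hω (Finset.mem_filter.1 hx).1).resolve_left (Finset.mem_filter.1 hx).2
  have hE := realEnergy_union_ge (s := s) hd
  have hcard : (ω.card : ℝ) = ω₁.card + ω₂.card := by
    rw [← hu, Finset.card_union_of_disjoint hd, Nat.cast_add]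
  rw [hu] at hE
  set a₁ := max ((ω₁.card : ℝ) - q₁) 0
  set a₂ := max ((ω₂.card : ℝ) - q₂) 0
  have ha₁ : 0 ≤ a₁ := le_max_right _ _
  have ha₂ : 0 ≤ a₂ := le_max_right _ _
  have ha : max ((ω.card : ℝ) - (q₁ + q₂)) 0 ≤ a₁ + a₂ := by
    refine max_le ?_ (by positivity)
    have := le_max_left ((ω₁.card : ℝ) - q₁) 0
    have := le_max_left ((ω₂.card : ℝ) - q₂) 0
    linarith
  have key := rpow_sum_div_rpow_sum_le hs (Finset.univ : Finset (Fin 2)) (a := ![a₁, a₂])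
    (b := ![ℓ₁, ℓ₂]) (by intro i _; fin_cases i <;> simpa) (by intro i _; fin_cases i <;> simpa)
  simp only [Fin.sum_univ_two, Matrix.cons_val_zero, Matrix.cons_val_one] at key
  have hZ := sum_range_rpow_nonneg s M
  set Z := ∑ m ∈ Finset.range M, (m : ℝ) ^ (-s)
  have h0 : 0 ≤ max ((ω.card : ℝ) - (q₁ + q₂)) 0 := le_max_right _ _
  have hm : (max ((ω.card : ℝ) - (q₁ + q₂)) 0) ^ (1 + s) ≤ (a₁ + a₂) ^ (1 + s) :=
    Real.rpow_le_rpow h0 ha (by linarith)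
  calc _ ≤ 2 * Z * (a₁ + a₂) ^ (1 + s) / (ℓ₁ + ℓ₂) ^ s := by gcongr
    _ = 2 * Z * ((a₁ + a₂) ^ (1 + s) / (ℓ₁ + ℓ₂) ^ s) := by ring
    _ ≤ 2 * Z * (a₁ ^ (1 + s) / ℓ₁ ^ s + a₂ ^ (1 + s) / ℓ₂ ^ s) := by gcongr
    _ = 2 * Z * a₁ ^ (1 + s) / ℓ₁ ^ s + 2 * Z * a₂ ^ (1 + s) / ℓ₂ ^ s := by ring
    _ ≤ _ := by linarith

lemma biUnion (hs : 0 < s) {D : ℕ → Set X} {ℓ : ℕ → ℝ} {n : ℕ} (hℓ : ∀ i < n, 0 < ℓ i)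
    (H : ∀ i < n, EnergyLowerBound s (D i) (ℓ i)) {c : ℝ} (hc : 0 < c) :
    EnergyLowerBound s (⋃ i < n, D i) (c + ∑ i ∈ Finset.range n, ℓ i) := by
  induction n with
  | zero => simpa using empty hs c
  | succ n ih =>
    rw [Set.biUnion_lt_succ, Finset.sum_range_succ, ← add_assoc]
    refine union hs ?_ (hℓ n (by omega)) (ih (fun i hi => hℓ i (by omega))
      fun i hi => H i (by omega)) (H n (by omega))
    exact add_pos_of_pos_of_nonneg hc (Finset.sum_nonneg fun i hi =>
      (hℓ i (by have := Finset.mem_range.1 hi; omega)).le)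

end EnergyLowerBound

lemma rpow_div_rpow_le_sum {ι : Type*} {s a B : ℝ} (hs : 0 < s) (T : Finset ι) {d : ι → ℝ}
    (hd : ∀ i ∈ T, 0 < d i) (ha : 0 ≤ a) (haT : a ≤ T.card) (hB : ∑ i ∈ T, d i ≤ B) :
    a ^ (1 + s) / B ^ s ≤ ∑ i ∈ T, d i ^ (-s) := by
  rcases T.eq_empty_or_nonempty with rfl | hT
  · have : a = 0 := le_antisymm (by simpa using haT) ha
    simp [this, Real.zero_rpow (by linarith : 1 + s ≠ 0)]
  · have hpos : 0 < ∑ i ∈ T, d i := Finset.sum_pos hd hT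
    refine le_trans ?_ (card_rpow_div_rpow_sum_le hs T hd)
    gcongr

/-! ### Lower bound on the line -/

lemma sum_sum_shift_le {g : ℕ → ℝ} {n m : ℕ} (hg : ∀ j < n - 1, 0 ≤ g j) {T : Finset ℕ}
    (hT : T ⊆ Finset.range (n - m)) :
    ∑ i ∈ T, ∑ k ∈ Finset.range m, g (i + k) ≤ m * ∑ j ∈ Finset.range (n - 1), g j := by
  rw [Finset.sum_comm]
  calc _ ≤ ∑ k ∈ Finset.range m, ∑ j ∈ Finset.range (n - 1), g j := by
        refine Finset.sum_le_sum fun k hk => ?_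
        rw [← Finset.sum_image (s := T) (g := fun i => i + k) (f := g)
          (fun a _ b _ h => by simpa using h)]
        refine Finset.sum_le_sum_of_subset_of_nonneg (fun j hj => ?_)
          fun j hj _ => hg j (Finset.mem_range.1 hj)
        obtain ⟨i, hi, rfl⟩ := Finset.mem_image.1 hj
        have := Finset.mem_range.1 (hT hi)
        have := Finset.mem_range.1 hk
        simp only [Finset.mem_range]
        omega
    _ = _ := by simp

lemma exists_strictMonoOn_enum (ω : Finset ℝ) :
    ∃ x : ℕ → ℝ, StrictMonoOn x (Set.Iio ω.card) ∧ (Finset.range ω.card).image x = ω := by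
  set e := ω.orderEmbOfFin rfl
  refine ⟨fun i => if h : i < ω.card then e ⟨i, h⟩ else 0, ?_, ?_⟩
  · intro i hi j hj hij
    rw [Set.mem_Iio] at hi hj
    simp only [hi, hj, dif_pos]
    exact e.strictMono hij
  · ext y
    constructor
    · intro hy
      obtain ⟨i, hi, rfl⟩ := Finset.mem_image.1 hy
      rw [dif_pos (Finset.mem_range.1 hi)]
      exact ω.orderEmbOfFin_mem rfl _
    · intro hy
      have : y ∈ Set.range e := by rw [Finset.range_orderEmbOfFin]; exact hy
      obtain ⟨i, rfl⟩ := this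
      exact Finset.mem_image.2 ⟨i, Finset.mem_range.2 i.2, by simp⟩

lemma two_mul_sum_shift_le_realEnergy {s : ℝ} {x : ℕ → ℝ} {n : ℕ}
    (hx : StrictMonoOn x (Set.Iio n)) (M : ℕ) :
    2 * ∑ m ∈ Finset.Ico 1 M, ∑ i ∈ Finset.range (n - m), (x (i + m) - x i) ^ (-s) ≤
      realEnergy s ((Finset.range n).image x) := by
  have hinj : Set.InjOn x (Finset.range n) := by
    intro i hi j hj h
    exact hx.injOn (by simpa using hi) (by simpa using hj) h
  set G : ℕ × ℕ → ℝ := fun p => dist (x p.1) (x p.2) ^ (-s) with hG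
  have hG0 : ∀ p, 0 ≤ G p := fun p => dist_rpow_nonneg s _ _
  set S := (Finset.range n ×ˢ Finset.range n).filter fun p => p.1 < p.2
  set S' := (Finset.range n ×ˢ Finset.range n).filter fun p => p.2 < p.1
  have hE : realEnergy s ((Finset.range n).image x) =
      ∑ p ∈ Finset.range n ×ˢ Finset.range n, G p := by
    unfold realEnergy
    rw [Finset.sum_image hinj, Finset.sum_product]
    exact Finset.sum_congr rfl fun i _ => Finset.sum_image hinj
  have hSS' : ∑ p ∈ S', G p = ∑ p ∈ S, G p := by
    refine Finset.sum_nbij' Prod.swap Prod.swap ?_ ?_ ?_ ?_ ?_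
    · intro p hp
      simp only [S', S, Finset.mem_filter, Finset.mem_product] at hp ⊢
      exact ⟨⟨hp.1.2, hp.1.1⟩, hp.2⟩
    · intro p hp
      simp only [S', S, Finset.mem_filter, Finset.mem_product] at hp ⊢
      exact ⟨⟨hp.1.2, hp.1.1⟩, hp.2⟩
    · simp
    · simp
    · intro p _
      simp [hG, dist_comm]
  have hdisj : Disjoint S S' := by
    rw [Finset.disjoint_left]
    intro p hp hp'
    have h1 := (Finset.mem_filter.1 hp).2
    have h2 := (Finset.mem_filter.1 hp').2
    omega
  have hle : 2 * ∑ p ∈ S, G p ≤ realEnergy s ((Finset.range n).image x) := by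
    rw [hE, two_mul]
    nth_rewrite 2 [← hSS']
    rw [← Finset.sum_union hdisj]
    refine Finset.sum_le_sum_of_subset_of_nonneg ?_ fun p _ _ => hG0 p
    exact Finset.union_subset (Finset.filter_subset _ _) (Finset.filter_subset _ _)
  refine le_trans ?_ hle
  refine mul_le_mul_of_nonneg_left ?_ zero_le_two
  rw [Finset.sum_sigma']
  set f : (Σ _ : ℕ, ℕ) → ℕ × ℕ := fun a => (a.2, a.2 + a.1)
  have hf : Set.InjOn f ((Finset.Ico 1 M).sigma fun m => Finset.range (n - m)) := by
    rintro ⟨a, b⟩ _ ⟨c, d⟩ _ h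
    simp only [f, Prod.mk.injEq] at h
    obtain ⟨rfl, h⟩ := h
    obtain rfl : a = c := by omega
    rfl
  calc _ = ∑ a ∈ (Finset.Ico 1 M).sigma fun m => Finset.range (n - m), G (f a) := by
        refine Finset.sum_congr rfl fun a ha => ?_
        simp only [Finset.mem_sigma, Finset.mem_Ico, Finset.mem_range] at ha
        have := hx (a := a.2) (b := a.2 + a.1) (by rw [Set.mem_Iio]; omega)
          (by rw [Set.mem_Iio]; omega) (by omega)
        simp only [hG, f]
        rw [dist_comm, Real.dist_eq, abs_of_pos (by linarith)]
    _ = ∑ p ∈ ((Finset.Ico 1 M).sigma fun m => Finset.range (n - m)).image f, G p :=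
        (Finset.sum_image hf).symm
    _ ≤ _ := by
        refine Finset.sum_le_sum_of_subset_of_nonneg (fun p hp => ?_) fun p _ _ => hG0 p
        obtain ⟨a, ha, rfl⟩ := Finset.mem_image.1 hp
        simp only [Finset.mem_sigma, Finset.mem_Ico, Finset.mem_range] at ha
        simp only [S, f, Finset.mem_filter, Finset.mem_product, Finset.mem_range]
        omega

/-- The short gaps of an increasing sequence in `C` have total length at most the measure of a
thickening of `C`. -/
lemma sum_short_gaps_le {C : Set ℝ} {ρ V : ℝ} (hV0 : 0 ≤ V)
    (hV : volume (cthickening ρ C) ≤ ENNReal.ofReal V) {x : ℕ → ℝ} {n : ℕ}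
    (hx : StrictMonoOn x (Set.Iio n)) (hxC : ∀ i < n, x i ∈ C) :
    ∑ j ∈ Finset.range (n - 1), (if x (j + 1) - x j ≤ ρ then x (j + 1) - x j else 0) ≤ V := by
  rw [← Finset.sum_filter]
  set T := (Finset.range (n - 1)).filter fun j => x (j + 1) - x j ≤ ρ
  have hT : ∀ j ∈ T, j + 1 < n ∧ x (j + 1) - x j ≤ ρ := fun j hj => by
    have := Finset.mem_filter.1 hj
    have h2 := Finset.mem_range.1 this.1
    exact ⟨by omega, this.2⟩
  have hlt : ∀ j ∈ T, x j < x (j + 1) := fun j hj =>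
    hx (by have := (hT j hj).1; rw [Set.mem_Iio]; omega) (hT j hj).1 (by omega)
  have hdisj : Set.PairwiseDisjoint (T : Set ℕ) fun j => Set.Ico (x j) (x (j + 1)) := by
    have aux : ∀ i ∈ T, ∀ j ∈ T, i < j →
        Disjoint (Set.Ico (x i) (x (i + 1))) (Set.Ico (x j) (x (j + 1))) := by
      intro i hi j hj hij
      have h : x (i + 1) ≤ x j := hx.monotoneOn (hT i hi).1
        (by have := (hT j hj).1; rw [Set.mem_Iio]; omega) hij
      rw [Set.disjoint_left]
      intro z hz hz'
      linarith [hz.2, hz'.1]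
    intro i hi j hj hij
    rcases lt_or_gt_of_ne hij with h | h
    · exact aux i hi j hj h
    · exact (aux j hj i hi h).symm
  have hsub : (⋃ j ∈ T, Set.Ico (x j) (x (j + 1))) ⊆ cthickening ρ C := by
    refine Set.iUnion₂_subset fun j hj z hz => ?_
    refine mem_cthickening_of_dist_le z (x j) ρ C (hxC j (by have := (hT j hj).1; omega)) ?_
    rw [Real.dist_eq, abs_of_nonneg (by linarith [hz.1])]
    linarith [hz.2, (hT j hj).2]
  have hm := (measure_mono hsub).trans hV
  rw [measure_biUnion_finset hdisj fun j _ => measurableSet_Ico] at hm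
  simp only [Real.volume_Ico] at hm
  rw [← ENNReal.ofReal_sum_of_nonneg fun j hj => by linarith [hlt j hj]] at hm
  exact (ENNReal.ofReal_le_ofReal_iff hV0).1 hm

lemma exists_pos_volume_cthickening_le {C : Set ℝ} (hC : IsCompact C) {θ : ℝ} (hθ : 0 < θ) :
    ∃ ρ > 0, volume (cthickening ρ C) ≤ ENNReal.ofReal ((volume C).toReal + θ) := by
  have ht := tendsto_measure_cthickening_of_isCompact (μ := (volume : Measure ℝ)) hC
  have hlt : volume C < ENNReal.ofReal ((volume C).toReal + θ) := by
    rw [ENNReal.lt_ofReal_iff_toReal_lt hC.measure_lt_top.ne]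
    linarith
  have h1 := (ht.eventually (gt_mem_nhds hlt)).filter_mono
    (nhdsWithin_le_nhds (s := Set.Ioi (0 : ℝ)))
  obtain ⟨ρ, h, hρ⟩ := (h1.and self_mem_nhdsWithin).exists
  exact ⟨ρ, hρ, h.le⟩

lemma sum_sub_le_of_subset {x : ℕ → ℝ} {n m : ℕ} {g : ℕ → ℝ} (hg : ∀ j < n - 1, 0 ≤ g j)
    {T : Finset ℕ} (hT : T ⊆ Finset.range (n - m))
    (hgT : ∀ i ∈ T, ∀ k < m, g (i + k) = x (i + k + 1) - x (i + k)) :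
    ∑ i ∈ T, (x (i + m) - x i) ≤ m * ∑ j ∈ Finset.range (n - 1), g j := by
  refine le_trans (le_of_eq ?_) (sum_sum_shift_le hg hT)
  refine Finset.sum_congr rfl fun i hi => ?_
  rw [Finset.sum_congr rfl fun k hk => hgT i hi k (Finset.mem_range.1 hk)]
  have := Finset.sum_range_sub (fun k => x (i + k)) m
  simpa [add_assoc] using this.symm

lemma EnergyLowerBound.of_isCompact_real {s : ℝ} (hs : 0 < s) {C : Set ℝ} (hC : IsCompact C)
    {θ : ℝ} (hθ : 0 < θ) : EnergyLowerBound s C ((volume C).toReal + θ) := by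
  intro M
  obtain ⟨ρ, hρ, hV⟩ := exists_pos_volume_cthickening_le hC hθ
  obtain ⟨R, hR⟩ := hC.isBounded.exists_norm_le
  set V := (volume C).toReal + θ
  have hV0 : 0 < V := add_pos_of_nonneg_of_pos ENNReal.toReal_nonneg hθ
  have hRabs : 0 ≤ |R| := abs_nonneg R
  refine ⟨M * (1 + 2 * |R| / ρ), fun ω hω => ?_⟩
  obtain ⟨x, hx, hxω⟩ := exists_strictMonoOn_enum ω
  set n := ω.card
  have hxC : ∀ i < n, x i ∈ C := fun i hi => hω <| by
    rw [← hxω]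
    exact Finset.mem_coe.2 (Finset.mem_image_of_mem x (Finset.mem_range.2 hi))
  set a := max ((n : ℝ) - M * (1 + 2 * |R| / ρ)) 0
  have ha0 : 0 ≤ a := le_max_right _ _
  have hgap : ∀ j < n - 1, 0 ≤ x (j + 1) - x j := fun j hj =>
    sub_nonneg.2 (hx.monotoneOn (by rw [Set.mem_Iio]; omega) (by rw [Set.mem_Iio]; omega)
      (by omega))
  have hmain : ∀ m ∈ Finset.Ico 1 M,
      a ^ (1 + s) / (m * V) ^ s ≤ ∑ i ∈ Finset.range (n - m), (x (i + m) - x i) ^ (-s) := by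
    intro m hm
    rw [Finset.mem_Ico] at hm
    have hd : ∀ i ∈ Finset.range (n - m), 0 < x (i + m) - x i := fun i hi => by
      rw [Finset.mem_range] at hi
      exact sub_pos.2 (hx (by rw [Set.mem_Iio]; omega) (by rw [Set.mem_Iio]; omega) (by omega))
    set T := (Finset.range (n - m)).filter fun i => x (i + m) - x i ≤ ρ
    set T' := (Finset.range (n - m)).filter fun i => ¬ x (i + m) - x i ≤ ρ
    have hcard : T.card + T'.card = n - m := by
      rw [Finset.card_filter_add_card_filter_not, Finset.card_range]
    have hT' : (T'.card : ℝ) * ρ ≤ m * (2 * |R|) := by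
      rcases Nat.eq_zero_or_pos n with hn | hn
      · have : T'.card = 0 := by omega
        rw [this, Nat.cast_zero, zero_mul]
        positivity
      calc (T'.card : ℝ) * ρ = ∑ i ∈ T', ρ := by simp
        _ ≤ ∑ i ∈ T', (x (i + m) - x i) :=
            Finset.sum_le_sum fun i hi => (not_le.1 (Finset.mem_filter.1 hi).2).le
        _ ≤ m * ∑ j ∈ Finset.range (n - 1), (x (j + 1) - x j) :=
            sum_sub_le_of_subset (g := fun j => x (j + 1) - x j) hgap
              (Finset.filter_subset _ _) (fun i _ k _ => rfl)
        _ ≤ m * (2 * |R|) := by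
            rw [Finset.sum_range_sub]
            have h1 := abs_le.1 ((hR _ (hxC (n - 1) (by omega))).trans (le_abs_self R))
            have h2 := abs_le.1 ((hR _ (hxC 0 hn)).trans (le_abs_self R))
            gcongr
            linarith [h1.2, h2.1]
    have hTcard : a ≤ T.card := by
      refine max_le ?_ (by positivity)
      have h1 : (T'.card : ℝ) ≤ m * (2 * |R| / ρ) := by
        rw [← mul_div_assoc, le_div_iff₀ hρ]
        exact hT'
      have h2 : (n : ℝ) ≤ T.card + T'.card + m := by
        have : n ≤ T.card + T'.card + m := by omega
        exact_mod_cast this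
      have h3 : (m : ℝ) * (1 + 2 * |R| / ρ) ≤ M * (1 + 2 * |R| / ρ) := by
        have : (m : ℝ) ≤ M := by exact_mod_cast hm.2.le
        gcongr
      linarith
    have hsum : ∑ i ∈ T, (x (i + m) - x i) ≤ m * V := by
      refine (sum_sub_le_of_subset
        (g := fun j => if x (j + 1) - x j ≤ ρ then x (j + 1) - x j else 0) ?_
        (Finset.filter_subset _ _) ?_).trans
        (mul_le_mul_of_nonneg_left (sum_short_gaps_le hV0.le hV hx hxC) (Nat.cast_nonneg m))
      · intro j hj
        split_ifs
        exacts [hgap j hj, le_rfl]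
      · intro i hi k hk
        have hi' := Finset.mem_filter.1 hi
        have hi'' := Finset.mem_range.1 hi'.1
        refine if_pos (le_trans ?_ hi'.2)
        have h1 : x (i + k + 1) ≤ x (i + m) :=
          hx.monotoneOn (by rw [Set.mem_Iio]; omega) (by rw [Set.mem_Iio]; omega) (by omega)
        have h2 : x i ≤ x (i + k) :=
          hx.monotoneOn (by rw [Set.mem_Iio]; omega) (by rw [Set.mem_Iio]; omega) (by omega)
        linarith
    refine (rpow_div_rpow_le_sum hs T (fun i hi => hd i (Finset.mem_filter.1 hi).1) ha0 hTcard
      hsum).trans ?_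
    exact Finset.sum_le_sum_of_subset_of_nonneg (Finset.filter_subset _ _)
      fun i hi _ => Real.rpow_nonneg (hd i hi).le _
  have hE := two_mul_sum_shift_le_realEnergy (s := s) hx M
  rw [hxω] at hE
  refine le_trans ?_ hE
  rw [mul_assoc, mul_div_assoc]
  refine mul_le_mul_of_nonneg_left ?_ zero_le_two
  refine le_trans ?_ (Finset.sum_le_sum hmain)
  have hz : ∑ m ∈ Finset.range M, (m : ℝ) ^ (-s) = ∑ m ∈ Finset.Ico 1 M, (m : ℝ) ^ (-s) := by
    symm
    refine Finset.sum_subset (fun m hm => ?_) fun m hm hm' => ?_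
    · exact Finset.mem_range.2 (Finset.mem_Ico.1 hm).2
    · have : m = 0 := by
        simp only [Finset.mem_range, Finset.mem_Ico] at hm hm'
        omega
      rw [this, Nat.cast_zero, Real.zero_rpow (by linarith)]
  rw [hz, Finset.sum_mul, Finset.sum_div]
  refine le_of_eq (Finset.sum_congr rfl fun m _ => ?_)
  rw [Real.mul_rpow (Nat.cast_nonneg m) hV0.le, Real.rpow_neg (Nat.cast_nonneg m)]
  rw [div_mul_eq_div_div, inv_mul_eq_div]

/-! ### Upper energy bounds -/

/-- For each spacing `h` there is a configuration in `D` of about `c / h` points, with energy at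
most that of an `h`-spaced configuration with constant `a`, up to a quadratic error. -/
def EnergyUpperBound {X : Type*} [MetricSpace X] (s : ℝ) (D : Set X) (c a : ℝ) : Prop :=
  ∃ B : ℝ, 0 ≤ B ∧ ∀ h : ℝ, 0 < h → ∃ ω : Finset X, ↑ω ⊆ D ∧ c / h ≤ ω.card ∧
    (ω.card : ℝ) ≤ c / h + B ∧ realEnergy s ω ≤ ω.card * (a / h ^ s) + B * (ω.card : ℝ) ^ 2

lemma summable_rpow_neg {s : ℝ} (hs : 1 < s) : Summable fun n : ℕ => (n : ℝ) ^ (-s) :=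
  Real.summable_nat_rpow.2 (by linarith)

lemma sum_tsub_rpow_neg_le {s : ℝ} (hs : 1 < s) (T : Finset ℕ) {f : ℕ → ℕ}
    (hf : ∀ i ∈ T, ∀ j ∈ T, f i = f j → f i ≠ 0 → i = j) :
    ∑ j ∈ T, (f j : ℝ) ^ (-s) ≤ ∑' n : ℕ, (n : ℝ) ^ (-s) := by
  have h0 : ∑ j ∈ T, (f j : ℝ) ^ (-s) = ∑ j ∈ T.filter fun j => f j ≠ 0, (f j : ℝ) ^ (-s) := by
    symm
    refine Finset.sum_filter_of_ne fun j _ hne h => hne ?_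
    rw [h, Nat.cast_zero, Real.zero_rpow (by linarith)]
  rw [h0, ← Finset.sum_image (f := fun n : ℕ => (n : ℝ) ^ (-s)) (g := f)]
  · exact (summable_rpow_neg hs).sum_le_tsum _ fun n _ => by positivity
  · intro i hi j hj hij
    have hi := Finset.mem_filter.1 hi
    exact hf i hi.1 j (Finset.mem_filter.1 hj).1 hij hi.2

lemma realEnergy_image_range_le {X : Type*} [MetricSpace X] {s g : ℝ} (hs : 1 < s) (hg : 0 < g)
    {k : ℕ} {y : ℕ → X} (hy : ∀ i < k, ∀ j < k, |(i : ℝ) - j| * g ≤ dist (y i) (y j)) :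
    ((Finset.range k).image y).card = k ∧
      realEnergy s ((Finset.range k).image y) ≤ k * (2 * (∑' n : ℕ, (n : ℝ) ^ (-s)) / g ^ s) := by
  have hinj : Set.InjOn y (Finset.range k) := fun i hi j hj hij => by
    have h := hy i (by simpa using hi) j (by simpa using hj)
    rw [hij, dist_self] at h
    have h0 : |(i : ℝ) - j| = 0 :=
      le_antisymm (nonpos_of_mul_nonpos_left h hg) (abs_nonneg _)
    exact_mod_cast sub_eq_zero.1 (abs_eq_zero.1 h0)
  refine ⟨by rw [Finset.card_image_of_injOn hinj, Finset.card_range], ?_⟩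
  unfold realEnergy
  rw [Finset.sum_image hinj]
  set Z := ∑' n : ℕ, (n : ℝ) ^ (-s)
  have hrow : ∀ i ∈ Finset.range k,
      ∑ z ∈ (Finset.range k).image y, dist (y i) z ^ (-s) ≤ 2 * Z / g ^ s := by
    intro i hi
    rw [Finset.sum_image hinj]
    have hgs : 0 < g ^ s := Real.rpow_pos_of_pos hg s
    calc ∑ j ∈ Finset.range k, dist (y i) (y j) ^ (-s)
        ≤ ∑ j ∈ Finset.range k,
            (((i - j : ℕ) : ℝ) ^ (-s) + ((j - i : ℕ) : ℝ) ^ (-s)) / g ^ s := by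
          refine Finset.sum_le_sum fun j hj => ?_
          have hd := hy i (Finset.mem_range.1 hi) j (Finset.mem_range.1 hj)
          have aux : ∀ m : ℕ, 0 < m → (m : ℝ) * g ≤ dist (y i) (y j) →
              dist (y i) (y j) ^ (-s) ≤ (m : ℝ) ^ (-s) / g ^ s := by
            intro m hm hmd
            have hm' : (0 : ℝ) < m := by exact_mod_cast hm
            calc _ ≤ ((m : ℝ) * g) ^ (-s) :=
                  Real.rpow_le_rpow_of_nonpos (by positivity) hmd (by linarith)
              _ = _ := by
                  rw [Real.mul_rpow hm'.le hg.le, Real.rpow_neg hg.le, div_eq_mul_inv]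
          rcases lt_trichotomy i j with h | rfl | h
          · refine (aux (j - i) (by omega) ?_).trans ?_
            · rwa [Nat.cast_sub h.le, ← abs_of_pos (sub_pos.2 (Nat.cast_lt (α := ℝ).2 h)),
                abs_sub_comm]
            · gcongr
              exact le_add_of_nonneg_left (by positivity)
          · rw [dist_self, Real.zero_rpow (by linarith)]
            positivity
          · refine (aux (i - j) (by omega) ?_).trans ?_
            · rwa [Nat.cast_sub h.le, ← abs_of_pos (sub_pos.2 (Nat.cast_lt (α := ℝ).2 h))]
            · gcongr
              exact le_add_of_nonneg_right (by positivity)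
      _ ≤ 2 * Z / g ^ s := by
          rw [← Finset.sum_div, Finset.sum_add_distrib]
          have h1 := sum_tsub_rpow_neg_le hs (Finset.range k) (f := fun j => i - j)
            fun a _ b _ h h' => by omega
          have h2 := sum_tsub_rpow_neg_le hs (Finset.range k) (f := fun j => j - i)
            fun a _ b _ h h' => by omega
          gcongr
          linarith
  refine (Finset.sum_le_sum hrow).trans (le_of_eq ?_)
  simp

lemma measure_inter_Iic_sub_le {C : Set ℝ} (hC : IsCompact C) (a b : ℝ) :
    (volume (C ∩ Set.Iic b)).toReal - (volume (C ∩ Set.Iic a)).toReal ≤ |a - b| := by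
  have hfin : ∀ t, volume (C ∩ Set.Iic t) ≠ ⊤ := fun t =>
    ((measure_mono Set.inter_subset_left).trans_lt hC.measure_lt_top).ne
  have hsub : C ∩ Set.Iic b ⊆ (C ∩ Set.Iic a) ∪ Set.Ioc a b := by
    rintro x ⟨hx, hxb⟩
    rcases le_or_gt x a with hxa | hxa
    · exact Or.inl ⟨hx, hxa⟩
    · exact Or.inr ⟨hxa, hxb⟩
  have hm := (measure_mono hsub).trans (measure_union_le (μ := volume) _ _)
  rw [Real.volume_Ioc] at hm
  have hm' : volume (C ∩ Set.Iic b) ≤ volume (C ∩ Set.Iic a) + ENNReal.ofReal |a - b| :=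
    hm.trans (by gcongr; rw [abs_sub_comm]; exact le_abs_self _)
  have := ENNReal.toReal_mono (ENNReal.add_ne_top.2 ⟨hfin a, ENNReal.ofReal_ne_top⟩) hm'
  rw [ENNReal.toReal_add (hfin a) ENNReal.ofReal_ne_top,
    ENNReal.toReal_ofReal (abs_nonneg _)] at this
  linarith

/-- A compact subset of the line contains points cutting it into pieces of prescribed measure. -/
lemma exists_equidistributed_points {C : Set ℝ} (hC : IsCompact C) (hne : C.Nonempty) {h : ℝ} :
    ∃ t : ℕ → ℝ, ∀ i : ℕ, (i : ℝ) * h ≤ (volume C).toReal → 0 ≤ h →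
      t i ∈ C ∧ (volume (C ∩ Set.Iic (t i))).toReal = i * h := by
  set F : ℝ → ℝ := fun t => (volume (C ∩ Set.Iic t)).toReal with hF
  have hFcont : Continuous F := by
    refine LipschitzWith.continuous (K := 1) (LipschitzWith.of_le_add fun a b => ?_)
    have := measure_inter_Iic_sub_le hC b a
    rw [dist_comm, Real.dist_eq]
    linarith
  obtain ⟨p, hp⟩ := hC.exists_isLeast hne
  obtain ⟨P, hP⟩ := hC.exists_isGreatest hne
  have hFp : F p = 0 := by
    have : C ∩ Set.Iic p ⊆ {p} := fun x hx => le_antisymm hx.2 (hp.2 hx.1)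
    simp only [hF]
    rw [measure_mono_null this (by simp), ENNReal.toReal_zero]
  have hFP : F P = (volume C).toReal := by
    simp only [hF]
    rw [Set.inter_eq_left.2 (show C ⊆ Set.Iic P from fun x hx => hP.2 hx)]
  have key : ∀ i : ℕ, ∃ t : ℝ, (i : ℝ) * h ≤ (volume C).toReal → 0 ≤ h →
      t ∈ C ∧ (volume (C ∩ Set.Iic t)).toReal = i * h := by
    intro i
    by_cases hi : (i : ℝ) * h ≤ (volume C).toReal ∧ 0 ≤ h
    · have hmem : (i : ℝ) * h ∈ Set.Icc (F p) (F P) := by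
        rw [hFp, hFP]
        exact ⟨mul_nonneg (Nat.cast_nonneg i) hi.2, hi.1⟩
      obtain ⟨t, ht, hFt⟩ := intermediate_value_Icc (hp.2 hP.1) hFcont.continuousOn hmem
      obtain ⟨τ, hτ⟩ := (hC.inter_right isClosed_Iic).exists_isGreatest
        (⟨p, hp.1, ht.1⟩ : (C ∩ Set.Iic t).Nonempty)
      refine ⟨τ, fun _ _ => ⟨hτ.1.1, ?_⟩⟩
      rw [← hFt]
      congr 2
      ext x
      exact ⟨fun hx => ⟨hx.1, (Set.mem_Iic.1 hx.2).trans hτ.1.2⟩, fun hx => ⟨hx.1, hτ.2 hx⟩⟩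
    · exact ⟨0, fun h1 h2 => absurd ⟨h1, h2⟩ hi⟩
  choose t ht using key
  exact ⟨t, ht⟩

namespace EnergyUpperBound

variable {X : Type*} [MetricSpace X] {s : ℝ}

lemma empty (a : ℝ) : EnergyUpperBound s (∅ : Set X) 0 a :=
  ⟨0, le_rfl, fun h _ => ⟨∅, by simp [realEnergy]⟩⟩

/-- A set inherits the upper bound of its compact image `u '' Q ⊆ ℝ` when the coordinate `u` expands
distances by at most a factor `K`. -/
lemma of_image (hs : 1 < s) {Q : Set X} {u : X → ℝ} (hu : IsCompact (u '' Q)) {K : ℝ} (hK : 0 < K)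
    (hK' : ∀ x ∈ Q, ∀ y ∈ Q, dist (u x) (u y) ≤ K * dist x y) :
    EnergyUpperBound s Q (volume (u '' Q)).toReal (2 * (∑' n : ℕ, (n : ℝ) ^ (-s)) * K ^ s) := by
  refine ⟨1, zero_le_one, fun h hh => ?_⟩
  set c := (volume (u '' Q)).toReal
  have hc : 0 ≤ c := ENNReal.toReal_nonneg
  rcases Q.eq_empty_or_nonempty with rfl | hne
  · refine ⟨∅, ?_⟩
    simp [realEnergy, c]
  obtain ⟨t, ht⟩ := exists_equidistributed_points hu (hne.image u) (h := h)
  set k := ⌊c / h⌋₊ + 1 with hk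
  have hkt : ∀ i < k, (i : ℝ) * h ≤ c := fun i hi => by
    rw [← le_div_iff₀ hh]
    exact (Nat.le_floor_iff (by positivity)).1 (by omega)
  have hy : ∀ i, ∃ z, i < k → z ∈ Q ∧ u z = t i := fun i => by
    by_cases hi : i < k
    · obtain ⟨z, hz, hz'⟩ := (ht i (hkt i hi) hh.le).1
      exact ⟨z, fun _ => ⟨hz, hz'⟩⟩
    · exact ⟨hne.some, fun h => absurd h hi⟩
  choose y hy using hy
  have hdist : ∀ i < k, ∀ j < k, |(i : ℝ) - j| * (h / K) ≤ dist (y i) (y j) := by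
    intro i hi j hj
    have h1 := hK' _ (hy i hi).1 _ (hy j hj).1
    rw [(hy i hi).2, (hy j hj).2, Real.dist_eq] at h1
    have h2 := measure_inter_Iic_sub_le hu (t i) (t j)
    have h3 := measure_inter_Iic_sub_le hu (t j) (t i)
    rw [(ht i (hkt i hi) hh.le).2, (ht j (hkt j hj) hh.le).2] at h2 h3
    rw [abs_sub_comm] at h3
    rw [← mul_div_assoc, div_le_iff₀ hK, mul_comm (dist _ _)]
    refine le_trans ?_ h1
    calc |(i : ℝ) - j| * h = |((i : ℝ) - j) * h| := by rw [abs_mul, abs_of_pos hh]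
      _ ≤ |t i - t j| := abs_le.2 ⟨by linarith, by linarith⟩
  obtain ⟨hcard, hE⟩ := realEnergy_image_range_le hs (div_pos hh hK) hdist
  refine ⟨(Finset.range k).image y, ?_, ?_, ?_, ?_⟩
  · intro z hz
    obtain ⟨i, hi, rfl⟩ := Finset.mem_image.1 (Finset.mem_coe.1 hz)
    exact (hy i (Finset.mem_range.1 hi)).1
  · rw [hcard, hk, Nat.cast_add, Nat.cast_one]
    exact (Nat.lt_floor_add_one _).le
  · rw [hcard, hk, Nat.cast_add, Nat.cast_one]
    have := Nat.floor_le (show 0 ≤ c / h by positivity)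
    linarith
  · rw [hcard]
    refine hE.trans ?_
    rw [Real.div_rpow hh.le hK.le, div_div_eq_mul_div]
    exact le_add_of_nonneg_right (by positivity)

lemma union (hs : 0 < s) {D₁ D₂ : Set X} (h₁ : IsCompact D₁) (h₂ : IsCompact D₂)
    (hd : Disjoint D₁ D₂) {c₁ c₂ a : ℝ} (H₁ : EnergyUpperBound s D₁ c₁ a)
    (H₂ : EnergyUpperBound s D₂ c₂ a) : EnergyUpperBound s (D₁ ∪ D₂) (c₁ + c₂) a := by
  obtain ⟨B₁, hB₁, H₁⟩ := H₁
  obtain ⟨B₂, hB₂, H₂⟩ := H₂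
  obtain ⟨κ, hκ, hsep⟩ := h₁.exists_thickening_subset_open h₂.isClosed.isOpen_compl
    (Set.disjoint_left.1 hd)
  have hsep : ∀ x ∈ D₁, ∀ y ∈ D₂, κ ≤ dist x y := fun x hx y hy => by
    by_contra! hlt
    exact hsep (mem_thickening_iff.2 ⟨x, hx, by rwa [dist_comm]⟩) hy
  have hκs : 0 ≤ κ ^ (-s) := by positivity
  refine ⟨B₁ + B₂ + κ ^ (-s), by positivity, fun h hh => ?_⟩
  obtain ⟨ω₁, hω₁, hl₁, hu₁, hE₁⟩ := H₁ h hh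
  obtain ⟨ω₂, hω₂, hl₂, hu₂, hE₂⟩ := H₂ h hh
  have hdω : Disjoint ω₁ ω₂ := by
    rw [Finset.disjoint_left]
    exact fun x hx hx' => Set.disjoint_left.1 hd (hω₁ hx) (hω₂ hx')
  have hcard : ((ω₁ ∪ ω₂).card : ℝ) = ω₁.card + ω₂.card := by
    rw [Finset.card_union_of_disjoint hdω, Nat.cast_add]
  refine ⟨ω₁ ∪ ω₂, ?_, ?_, ?_, ?_⟩
  · rw [Finset.coe_union]
    exact Set.union_subset_union hω₁ hω₂
  · rw [hcard, add_div]
    linarith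
  · rw [hcard, add_div]
    linarith
  · have hcross : ∑ x ∈ ω₁, ∑ y ∈ ω₂, dist x y ^ (-s) ≤ ω₁.card * (ω₂.card * κ ^ (-s)) := by
      calc _ ≤ ∑ x ∈ ω₁, ∑ y ∈ ω₂, κ ^ (-s) := by
            refine Finset.sum_le_sum fun x hx => Finset.sum_le_sum fun y hy => ?_
            exact Real.rpow_le_rpow_of_nonpos hκ (hsep x (hω₁ hx) y (hω₂ hy)) (by linarith)
        _ = _ := by simp
    rw [realEnergy_union hdω, hcard]
    have hn₁ : (0 : ℝ) ≤ ω₁.card := Nat.cast_nonneg _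
    have hn₂ : (0 : ℝ) ≤ ω₂.card := Nat.cast_nonneg _
    generalize (ω₁.card : ℝ) = n₁ at *
    generalize (ω₂.card : ℝ) = n₂ at *
    have e1 : B₁ * n₁ ^ 2 ≤ B₁ * (n₁ + n₂) ^ 2 := by
      gcongr
      linarith
    have e2 : B₂ * n₂ ^ 2 ≤ B₂ * (n₁ + n₂) ^ 2 := by
      gcongr
      linarith
    have e3 : 2 * (n₁ * (n₂ * κ ^ (-s))) ≤ κ ^ (-s) * (n₁ + n₂) ^ 2 := by
      nlinarith [mul_nonneg hκs (sq_nonneg n₁), mul_nonneg hκs (sq_nonneg n₂)]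
    linarith

lemma biUnion (hs : 0 < s) {D : ℕ → Set X} {c : ℕ → ℝ} {a : ℝ} {n : ℕ}
    (hD : ∀ i < n, IsCompact (D i)) (hd : ∀ i < n, ∀ j < n, i ≠ j → Disjoint (D i) (D j))
    (H : ∀ i < n, EnergyUpperBound s (D i) (c i) a) :
    EnergyUpperBound s (⋃ i < n, D i) (∑ i ∈ Finset.range n, c i) a := by
  induction n with
  | zero => simpa using empty a
  | succ n ih =>
    rw [Set.biUnion_lt_succ, Finset.sum_range_succ]
    refine union hs ?_ (hD n (by omega)) ?_ (ih (fun i hi => hD i (by omega))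
      (fun i hi j hj => hd i (by omega) j (by omega)) fun i hi => H i (by omega)) (H n (by omega))
    · exact (Set.finite_lt_nat n).isCompact_biUnion fun i hi =>
        hD i (Nat.lt_succ_of_lt hi)
    · rw [Set.disjoint_iUnion₂_left]
      exact fun i hi => hd i (by omega) n (by omega) (by omega)

end EnergyUpperBound

/-! ### Hausdorff measure under bi-Lipschitz maps -/

section Lipschitz

variable {X Y : Type*} [MetricSpace X] [MetricSpace Y]

lemma injOn_of_dist_le {f : X → Y} {Q : Set X} {K : ℝ}
    (h : ∀ x ∈ Q, ∀ y ∈ Q, dist x y ≤ K * dist (f x) (f y)) : Set.InjOn f Q :=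
  fun x hx y hy hxy => by
    have := h x hx y hy
    rw [hxy, dist_self, mul_zero] at this
    exact dist_le_zero.1 this

lemma continuousOn_of_dist_le {f : X → Y} {Q : Set X} {K : ℝ} (hK : 0 ≤ K)
    (h : ∀ x ∈ Q, ∀ y ∈ Q, dist (f x) (f y) ≤ K * dist x y) : ContinuousOn f Q :=
  (LipschitzOnWith.of_dist_le_mul (K := K.toNNReal) fun x hx y hy => by
    rw [Real.coe_toNNReal K hK]
    exact h x hx y hy).continuousOn

end Lipschitz

section Hausdorff

variable {X Y : Type*} [MetricSpace X] [MeasurableSpace X] [BorelSpace X]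
  [MetricSpace Y] [MeasurableSpace Y] [BorelSpace Y]

lemma hausdorffMeasure_image_le_of_dist_le {f : X → Y} {Q : Set X} {K : ℝ} (hK : 0 ≤ K)
    (h : ∀ x ∈ Q, ∀ y ∈ Q, dist (f x) (f y) ≤ K * dist x y) :
    μH[1] (f '' Q) ≤ ENNReal.ofReal K * μH[1] Q := by
  have hL : LipschitzOnWith K.toNNReal f Q := LipschitzOnWith.of_dist_le_mul fun x hx y hy => by
    rw [Real.coe_toNNReal K hK]
    exact h x hx y hy
  have := hL.hausdorffMeasure_image_le zero_le_one
  rwa [ENNReal.rpow_one] at this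

lemma hausdorffMeasure_le_image_of_dist_le {f : X → Y} {Q : Set X} {K : ℝ} (hK : 0 ≤ K)
    (h : ∀ x ∈ Q, ∀ y ∈ Q, dist x y ≤ K * dist (f x) (f y)) :
    μH[1] Q ≤ ENNReal.ofReal K * μH[1] (f '' Q) := by
  rcases Q.eq_empty_or_nonempty with rfl | ⟨x₀, hx₀⟩
  · simp
  have : Nonempty X := ⟨x₀⟩
  have hinv := (injOn_of_dist_le h).leftInvOn_invFunOn
  have hg := hausdorffMeasure_image_le_of_dist_le (f := Function.invFunOn f Q) (Q := f '' Q) hK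
    (by
      rintro _ ⟨x, hx, rfl⟩ _ ⟨y, hy, rfl⟩
      rw [hinv hx, hinv hy]
      exact h x hx y hy)
  rwa [hinv.image_image] at hg

end Hausdorff

/-! ### Almost isometric pieces -/

/-- `Q` is bi-Lipschitz equivalent to a subset of the line with constant `κ`. -/
def NearLine {X : Type*} [MetricSpace X] (κ : ℝ) (Q : Set X) : Prop :=
  ∃ u : X → ℝ, ∀ x ∈ Q, ∀ y ∈ Q,
    dist x y ≤ κ * dist (u x) (u y) ∧ dist (u x) (u y) ≤ κ * dist x y

lemma NearLine.mono {X : Type*} [MetricSpace X] {κ : ℝ} {P Q : Set X} (h : P ⊆ Q)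
    (hQ : NearLine κ Q) : NearLine κ P :=
  hQ.imp fun _ hu x hx y hy => hu x (h hx) y (h hy)

/-- `A` is the union of the images of the compact sets `K k ⊆ ℝ` under maps `φ k`, each of them
bi-Lipschitz on `K k` with constant `L`. -/
structure IsArcUnion {X : Type*} [MetricSpace X] {n : ℕ} (A : Set X) (K : Fin n → Set ℝ)
    (φ : Fin n → ℝ → X) (L : ℝ) : Prop where
  one_le : 1 ≤ L
  isCompact : ∀ k, IsCompact (K k)
  dist_le : ∀ k, ∀ x ∈ K k, ∀ y ∈ K k, dist x y ≤ L * dist (φ k x) (φ k y)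
  dist_map_le : ∀ k, ∀ x ∈ K k, ∀ y ∈ K k, dist (φ k x) (φ k y) ≤ L * dist x y
  eq_iUnion : A = ⋃ k, φ k '' K k

namespace IsArcUnion

variable {X : Type*} [MetricSpace X] {n : ℕ} {A : Set X} {K : Fin n → Set ℝ} {φ : Fin n → ℝ → X}
  {L : ℝ}

lemma isCompact_set (h : IsArcUnion A K φ L) : IsCompact A := by
  rw [h.eq_iUnion]
  exact isCompact_iUnion fun k => (h.isCompact k).image_of_continuousOn
    (continuousOn_of_dist_le (zero_le_one.trans h.one_le) (h.dist_map_le k))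

lemma hausdorffMeasure_lt_top [MeasurableSpace X] [BorelSpace X]
    (h : IsArcUnion A K φ L) : μH[1] A < ⊤ := by
  rw [h.eq_iUnion]
  refine (measure_iUnion_le _).trans_lt ?_
  rw [tsum_fintype]
  refine ENNReal.sum_lt_top.2 fun k _ => ?_
  refine (hausdorffMeasure_image_le_of_dist_le (zero_le_one.trans h.one_le)
    (h.dist_map_le k)).trans_lt ?_
  rw [hausdorffMeasure_real]
  exact ENNReal.mul_lt_top ENNReal.ofReal_lt_top (h.isCompact k).measure_lt_top

end IsArcUnion

section Rectifiable

variable {E : Type*} [NormedAddCommGroup E] [NormedSpace ℝ E]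

lemma nearLine_image_of_approximatesLinearOn {φ : ℝ → E} {T : Set ℝ} {v : E} {κ : ℝ} (hκ : 1 < κ)
    (hv : v ≠ 0) (h : ∀ x ∈ T, ∀ y ∈ T,
      ‖φ x - φ y - (x - y) • v‖ ≤ (1 - κ⁻¹) * ‖v‖ * ‖x - y‖) : NearLine κ (φ '' T) := by
  have hκ0 : 0 < κ := zero_lt_one.trans hκ
  have hv0 : 0 < ‖v‖ := norm_pos_iff.2 hv
  have hlow : ∀ x ∈ T, ∀ y ∈ T, ‖v‖ * dist x y ≤ κ * dist (φ x) (φ y) := by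
    intro x hx y hy
    have h1 := norm_sub_norm_le ((x - y) • v) ((x - y) • v - (φ x - φ y))
    rw [sub_sub_cancel, norm_sub_rev _ (φ x - φ y), norm_smul] at h1
    have h2 := h x hx y hy
    rw [dist_eq_norm, dist_eq_norm, ← div_le_iff₀' hκ0, div_eq_inv_mul]
    linarith
  have hup : ∀ x ∈ T, ∀ y ∈ T, dist (φ x) (φ y) ≤ κ * (‖v‖ * dist x y) := by
    intro x hx y hy
    have h1 := norm_add_le (φ x - φ y - (x - y) • v) ((x - y) • v)
    rw [sub_add_cancel, norm_smul] at h1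
    have h2 := h x hx y hy
    have h3 : 2 - κ⁻¹ ≤ κ := by
      rw [sub_le_iff_le_add, ← sub_nonneg]
      have : κ + κ⁻¹ - 2 = (κ - 1) ^ 2 * κ⁻¹ := by
        field_simp
        ring
      rw [this]
      positivity
    rw [dist_eq_norm, dist_eq_norm]
    have h4 : (2 - κ⁻¹) * (‖v‖ * ‖x - y‖) ≤ κ * (‖v‖ * ‖x - y‖) := by gcongr
    linarith
  have hinj : Set.InjOn φ T := injOn_of_dist_le (K := κ / ‖v‖) fun x hx y hy => by
    rw [div_mul_eq_mul_div, le_div_iff₀ hv0, mul_comm]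
    exact hlow x hx y hy
  have hinv := hinj.leftInvOn_invFunOn
  refine ⟨fun z => ‖v‖ * Function.invFunOn φ T z, ?_⟩
  rintro _ ⟨x, hx, rfl⟩ _ ⟨y, hy, rfl⟩
  have hd : dist (‖v‖ * x) (‖v‖ * y) = ‖v‖ * dist x y := by
    rw [Real.dist_eq, Real.dist_eq, ← mul_sub, abs_mul, abs_of_pos hv0]
  simp only [hinv hx, hinv hy, hd]
  exact ⟨hup x hx y hy, hlow x hx y hy⟩

variable [FiniteDimensional ℝ E] [MeasurableSpace E] [BorelSpace E]

lemma exists_nearLine_cover_arc {K : Set ℝ} (hK : IsCompact K) {φ : ℝ → E} {L : ℝ} (hL : 1 ≤ L)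
    (h₁ : ∀ x ∈ K, ∀ y ∈ K, dist x y ≤ L * dist (φ x) (φ y))
    (h₂ : ∀ x ∈ K, ∀ y ∈ K, dist (φ x) (φ y) ≤ L * dist x y) {κ : ℝ} (hκ : 1 < κ) :
    ∃ P : ℕ → Set E, (∀ n, MeasurableSet (P n)) ∧ (∀ n, P n ⊆ φ '' K) ∧ (∀ n, NearLine κ (P n)) ∧
      μH[1] (φ '' K \ ⋃ n, P n) = 0 := by
  have hL0 : 0 < L := zero_lt_one.trans_le hL
  have hLip : LipschitzOnWith L.toNNReal φ K := LipschitzOnWith.of_dist_le_mul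
    fun x hx y hy => by
      rw [Real.coe_toNNReal L hL0.le]
      exact h₂ x hx y hy
  have hae := hLip.ae_differentiableWithinAt_of_mem (μ := volume)
  set bad := toMeasurable volume {x | ¬ (x ∈ K → DifferentiableWithinAt ℝ φ K x)}
  have hbad : volume bad = 0 := by
    rw [measure_toMeasurable]
    exact ae_iff.1 hae
  set S := K \ bad
  have hSK : S ⊆ K := Set.sdiff_subset
  have hS : MeasurableSet S := hK.measurableSet.diff (measurableSet_toMeasurable _ _)
  have hderiv : ∀ x ∈ S, HasFDerivWithinAt φ (fderivWithin ℝ φ K x) S x := by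
    intro x hx
    have hd : DifferentiableWithinAt ℝ φ K x := by
      by_contra hcon
      exact hx.2 (subset_toMeasurable _ _ fun h => hcon (h hx.1))
    exact hd.hasFDerivWithinAt.mono hSK
  have hκ0 : 0 < 1 - κ⁻¹ := sub_pos.2 (inv_lt_one_of_one_lt₀ hκ)
  set r : (ℝ →L[ℝ] E) → ℝ≥0 := fun T =>
    if T 1 = 0 then Real.toNNReal (1 / (2 * L)) else Real.toNNReal ((1 - κ⁻¹) * ‖T 1‖) with hr
  have hr0 : ∀ T, r T ≠ 0 := by
    intro T
    simp only [hr]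
    split_ifs with hT
    · exact (Real.toNNReal_pos.2 (by positivity)).ne'
    · exact (Real.toNNReal_pos.2 (mul_pos hκ0 (norm_pos_iff.2 hT))).ne'
  obtain ⟨t, T, -, htm, htS, happ, -⟩ :=
    exists_partition_approximatesLinearOn_of_hasFDerivWithinAt φ S _ hderiv r hr0
  have hinjK : Set.InjOn φ K := injOn_of_dist_le h₁
  refine ⟨fun n => φ '' (S ∩ t n), fun n => ?_, fun n => ?_, fun n => ?_, ?_⟩
  · exact (hS.inter (htm n)).image_of_continuousOn_injOn
      (hLip.continuousOn.mono (Set.inter_subset_left.trans hSK))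
      (hinjK.mono (Set.inter_subset_left.trans hSK))
  · exact Set.image_mono (Set.inter_subset_left.trans hSK)
  · have hsmul : ∀ z : ℝ, T n z = z • T n 1 := fun z => by
      rw [← map_smul, smul_eq_mul, mul_one]
    have hb := happ n
    by_cases hT : T n 1 = 0
    · have hz : ∀ x ∈ S ∩ t n, ∀ y ∈ S ∩ t n, x = y := by
        intro x hx y hy
        have e1 := hb x hx y hy
        simp only [hr, hT, if_true, hsmul, smul_zero, sub_zero] at e1
        rw [Real.coe_toNNReal _ (by positivity), ← dist_eq_norm, ← dist_eq_norm] at e1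
        have e2 := h₁ x hx.1.1 y hy.1.1
        have e3 : L * dist (φ x) (φ y) ≤ L * (1 / (2 * L) * dist x y) := by gcongr
        have e4 : L * (1 / (2 * L) * dist x y) = dist x y / 2 := by field_simp
        have e5 : 0 ≤ dist x y := dist_nonneg
        exact dist_le_zero.1 (by linarith)
      refine ⟨fun _ => 0, ?_⟩
      rintro _ ⟨x, hx, rfl⟩ _ ⟨y, hy, rfl⟩
      rw [hz x hx y hy]
      simp
    · refine nearLine_image_of_approximatesLinearOn hκ hT fun x hx y hy => ?_
      have e1 := hb x hx y hy
      simp only [hr, hT, if_false] at e1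
      rwa [Real.coe_toNNReal _ (by positivity), hsmul] at e1
  · have hsub : φ '' K \ ⋃ n, φ '' (S ∩ t n) ⊆ φ '' (K ∩ bad) := by
      rintro _ ⟨⟨x, hx, rfl⟩, hnot⟩
      refine ⟨x, ⟨hx, ?_⟩, rfl⟩
      by_contra hxb
      obtain ⟨n, hn⟩ := Set.mem_iUnion.1 (htS ⟨hx, hxb⟩)
      exact hnot (Set.mem_iUnion.2 ⟨n, x, ⟨⟨hx, hxb⟩, hn⟩, rfl⟩)
    refine measure_mono_null hsub (le_antisymm ?_ zero_le)
    refine (hausdorffMeasure_image_le_of_dist_le hL0.le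
      fun x hx y hy => h₂ x hx.1 y hy.1).trans ?_
    rw [hausdorffMeasure_real, measure_mono_null Set.inter_subset_right hbad, mul_zero]

namespace IsArcUnion

variable {n : ℕ} {A : Set E} {K : Fin n → Set ℝ} {φ : Fin n → ℝ → E} {L : ℝ}

lemma exists_nearLine_cover (h : IsArcUnion A K φ L) {κ : ℝ} (hκ : 1 < κ) :
    ∃ P : ℕ → Set E, (∀ i, MeasurableSet (P i)) ∧ (∀ i, P i ⊆ A) ∧ (∀ i, NearLine κ (P i)) ∧
      μH[1] (A \ ⋃ i, P i) = 0 := by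
  choose P hPm hPs hPl hP0 using fun k =>
    exists_nearLine_cover_arc (h.isCompact k) h.one_le (h.dist_le k) (h.dist_map_le k) hκ
  refine ⟨fun i => if hi : i.unpair.1 < n then P ⟨_, hi⟩ i.unpair.2 else ∅, fun i => ?_,
    fun i => ?_, fun i => ?_, ?_⟩
  · dsimp only
    split_ifs
    exacts [hPm _ _, MeasurableSet.empty]
  · dsimp only
    split_ifs
    · rw [h.eq_iUnion]
      exact (hPs _ _).trans (Set.subset_iUnion (fun k => φ k '' K k) _)
    · exact Set.empty_subset _
  · dsimp only
    split_ifs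
    exacts [hPl _ _, ⟨fun _ => 0, fun x hx => hx.elim⟩]
  · refine measure_mono_null (t := ⋃ k, (φ k '' K k \ ⋃ j, P k j)) ?_
      (measure_iUnion_null hP0)
    rintro x ⟨hxA, hx⟩
    rw [h.eq_iUnion] at hxA
    obtain ⟨k, hk⟩ := Set.mem_iUnion.1 hxA
    refine Set.mem_iUnion.2 ⟨k, hk, fun hxP => hx ?_⟩
    obtain ⟨j, hj⟩ := Set.mem_iUnion.1 hxP
    refine Set.mem_iUnion.2 ⟨Nat.pair k j, ?_⟩
    simpa [Nat.unpair_pair] using hj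

/-- Up to small measure, `A` is a finite disjoint union of almost isometric compact pieces. -/
lemma exists_nearLine_decomposition (h : IsArcUnion A K φ L) {κ : ℝ} (hκ : 1 < κ) {ε : ℝ≥0∞}
    (hε : ε ≠ 0) (hε' : ε ≠ ⊤) :
    ∃ (N : ℕ) (Q : ℕ → Set E), (∀ i, IsCompact (Q i)) ∧ (∀ i, Q i ⊆ A) ∧
      (∀ i j, i ≠ j → Disjoint (Q i) (Q j)) ∧ (∀ i, NearLine κ (Q i)) ∧
      μH[1] (A \ ⋃ i < N, Q i) < ε := by
  obtain ⟨P, hPm, hPA, hPl, hP0⟩ := h.exists_nearLine_cover hκ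
  have hAm := h.isCompact_set.measurableSet
  have hfin : IsFiniteMeasure ((μH[1] : Measure E).restrict A) :=
    ⟨by rw [Measure.restrict_apply_univ]; exact h.hausdorffMeasure_lt_top⟩
  set μ := (μH[1] : Measure E).restrict A with hμ
  have hμA : ∀ S : Set E, S ⊆ A → MeasurableSet S → μ S = μH[1] S := fun S hS hSm => by
    rw [hμ, Measure.restrict_apply hSm, Set.inter_eq_left.2 hS]
  have hε2 : ε / 2 ≠ 0 := (ENNReal.div_pos hε ENNReal.ofNat_ne_top).ne'
  have hDm : ∀ i, MeasurableSet (disjointed P i) := fun i => MeasurableSet.disjointed hPm i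
  have hlim : Tendsto (fun N => μ (A \ ⋃ i < N, disjointed P i)) atTop
      (𝓝 (μ (⋂ N, (A \ ⋃ i < N, disjointed P i)))) := by
    refine tendsto_measure_iInter_atTop (fun N => (hAm.diff
      (MeasurableSet.biUnion (Set.to_countable _) fun i _ => hDm i)).nullMeasurableSet) ?_
      ⟨0, measure_ne_top _ _⟩
    intro a b hab
    exact Set.sdiff_subset_sdiff_right (Set.biUnion_subset_biUnion_left fun i hi =>
      lt_of_lt_of_le hi hab)
  have hzero : μ (⋂ N, (A \ ⋃ i < N, disjointed P i)) = 0 := by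
    refine le_antisymm ((Measure.restrict_le_self _).trans (le_of_eq
      (measure_mono_null ?_ hP0))) zero_le
    intro x hx
    rw [Set.mem_iInter] at hx
    refine ⟨(hx 0).1, fun hxP => ?_⟩
    rw [← iUnion_disjointed] at hxP
    obtain ⟨i, hi⟩ := Set.mem_iUnion.1 hxP
    exact (hx (i + 1)).2 (Set.mem_iUnion₂.2 ⟨i, Nat.lt_succ_self i, hi⟩)
  rw [hzero] at hlim
  obtain ⟨N, hN⟩ := (hlim.eventually (gt_mem_nhds (pos_iff_ne_zero.2 hε2))).exists
  have hεN : ε / 2 / (N + 1) ≠ 0 := (ENNReal.div_pos hε2 (by finiteness)).ne'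
  choose Q hQD hQc hQμ using fun i =>
    (hDm i).exists_isCompact_sdiff_lt (measure_ne_top μ (disjointed P i)) hεN
  have hQP : ∀ i, Q i ⊆ P i := fun i => (hQD i).trans (disjointed_subset P i)
  refine ⟨N, Q, hQc, fun i => (hQP i).trans (hPA i), fun i j hij =>
    (disjoint_disjointed P hij).mono (hQD i) (hQD j), fun i => (hPl i).mono (hQP i), ?_⟩
  rw [← hμA (A \ ⋃ i < N, Q i) Set.sdiff_subset (hAm.diff
    (MeasurableSet.biUnion (Set.to_countable {i | i < N}) fun i _ => (hQc i).measurableSet))]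
  have hsub : A \ ⋃ i < N, Q i ⊆
      (A \ ⋃ i < N, disjointed P i) ∪ ⋃ i ∈ Finset.range N, (disjointed P i \ Q i) := by
    rintro x ⟨hxA, hx⟩
    by_cases hxD : x ∈ ⋃ i < N, disjointed P i
    · obtain ⟨i, hi, hxi⟩ := Set.mem_iUnion₂.1 hxD
      exact Or.inr (Set.mem_iUnion₂.2 ⟨i, Finset.mem_range.2 hi, hxi,
        fun hxQ => hx (Set.mem_iUnion₂.2 ⟨i, hi, hxQ⟩)⟩)
    · exact Or.inl ⟨hxA, hxD⟩
  calc μ (A \ ⋃ i < N, Q i) ≤ _ := measure_mono hsub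
    _ ≤ μ (A \ ⋃ i < N, disjointed P i) + ∑ i ∈ Finset.range N, μ (disjointed P i \ Q i) :=
        (measure_union_le _ _).trans (by gcongr; exact measure_biUnion_finset_le _ _)
    _ ≤ μ (A \ ⋃ i < N, disjointed P i) + ∑ i ∈ Finset.range N, ε / 2 / (N + 1) := by
        gcongr with i _
        exact (hQμ i).le
    _ ≤ μ (A \ ⋃ i < N, disjointed P i) + ε / 2 := by
        gcongr
        rw [Finset.sum_const, Finset.card_range, nsmul_eq_mul, ← mul_div_assoc]
        refine ENNReal.div_le_of_le_mul ?_
        rw [mul_comm]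
        gcongr
        exact le_self_add
    _ < ε := by
        calc _ < ε / 2 + ε / 2 := ENNReal.add_lt_add_right (by finiteness) hN
          _ = ε := ENNReal.add_halves ε

end IsArcUnion

end Rectifiable

/-! ### Packing estimate -/

section Packing

variable {X : Type*} [MetricSpace X] [MeasurableSpace X] [BorelSpace X]

lemma eventually_card_mul_le_arc {K : Set ℝ} (hK : IsCompact K) {φ : ℝ → X} {L : ℝ} (hL : 1 ≤ L)
    (h₁ : ∀ x ∈ K, ∀ y ∈ K, dist x y ≤ L * dist (φ x) (φ y))
    (h₂ : ∀ x ∈ K, ∀ y ∈ K, dist (φ x) (φ y) ≤ L * dist x y) {D : Set X} (hD : IsClosed D)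
    {ε : ℝ} (hε : 0 < ε) (hDε : μH[1] (φ '' K \ D) < ENNReal.ofReal ε) :
    ∀ᶠ r : ℝ in 𝓝[>] 0, ∀ ω : Finset X, ↑ω ⊆ φ '' K →
      (∀ x ∈ ω, ∀ y ∈ ω, x ≠ y → r ≤ dist x y) → (∀ x ∈ ω, ∀ y ∈ D, r ≤ dist x y) →
      ω.card * r ≤ L ^ 2 * ε := by
  have hL0 : 0 < L := zero_lt_one.trans_le hL
  set K' := K ∩ φ ⁻¹' D
  have hK' : IsClosed K' :=
    (continuousOn_of_dist_le hL0.le h₂).preimage_isClosed_of_isClosed hK.isClosed hD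
  have hK'fin : volume K' ≠ ⊤ := ((measure_mono Set.inter_subset_left).trans_lt
    hK.measure_lt_top).ne
  have hdiff : volume (K \ K') < ENNReal.ofReal (L * ε) := by
    rw [← hausdorffMeasure_real, ENNReal.ofReal_mul hL0.le]
    refine (hausdorffMeasure_le_image_of_dist_le hL0.le
      fun x hx y hy => h₁ x hx.1 y hy.1).trans_lt ?_
    refine (ENNReal.mul_lt_mul_iff_right (by simpa using hL0) ENNReal.ofReal_ne_top).2
      ((measure_mono ?_).trans_lt hDε)
    rintro _ ⟨x, ⟨hx, hx'⟩, rfl⟩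
    exact ⟨Set.mem_image_of_mem _ hx, fun h => hx' ⟨hx, h⟩⟩
  have hlt : volume K < volume K' + ENNReal.ofReal (L * ε) := by
    refine lt_of_le_of_lt ?_ (ENNReal.add_lt_add_left hK'fin hdiff)
    refine (measure_mono fun x hx => ?_).trans (measure_union_le K' (K \ K'))
    by_cases hx' : x ∈ K'
    exacts [Or.inl hx', Or.inr ⟨hx, hx'⟩]
  have hev := (tendsto_measure_cthickening_of_isCompact (μ := (volume : Measure ℝ)) hK).eventually
    (gt_mem_nhds hlt)
  have hscale : Tendsto (fun r : ℝ => r / (2 * L)) (𝓝[>] 0) (𝓝 0) := by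
    refine Tendsto.mono_left ?_ nhdsWithin_le_nhds
    have : Continuous fun r : ℝ => r / (2 * L) := by fun_prop
    simpa using this.tendsto 0
  filter_upwards [hscale.eventually hev, self_mem_nhdsWithin] with r hr hr0 ω hω hsep hfar
  rw [Set.mem_Ioi] at hr0
  have hρ : 0 < r / (2 * L) := by positivity
  have hpre : ∀ x, ∃ t, x ∈ ω → t ∈ K ∧ φ t = x := fun x => by
    by_cases hx : x ∈ ω
    · obtain ⟨t, ht, htx⟩ := hω hx
      exact ⟨t, fun _ => ⟨ht, htx⟩⟩
    · exact ⟨0, fun h => absurd h hx⟩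
  choose t ht using hpre
  have hLρ : L * (r / (2 * L)) = r / 2 := by field_simp
  have hdisj : Set.PairwiseDisjoint (ω : Set X) fun x => ball (t x) (r / (2 * L)) := by
    intro x hx y hy hxy
    refine ball_disjoint_ball ?_
    have e1 := h₂ _ (ht x hx).1 _ (ht y hy).1
    rw [(ht x hx).2, (ht y hy).2] at e1
    have e2 := (hsep x hx y hy hxy).trans e1
    have e3 : L * (r / (2 * L) + r / (2 * L)) = r := by rw [mul_add, hLρ]; ring
    rw [← e3] at e2
    exact le_of_mul_le_mul_left e2 hL0
  have hsub : (⋃ x ∈ ω, ball (t x) (r / (2 * L))) ⊆ cthickening (r / (2 * L)) K \ K' := by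
    refine Set.iUnion₂_subset fun x hx z hz => ⟨?_, fun hzK => ?_⟩
    · exact mem_cthickening_of_dist_le z (t x) _ K (ht x hx).1 (mem_ball.1 hz).le
    · have e1 := h₂ _ (ht x hx).1 _ hzK.1
      rw [(ht x hx).2] at e1
      have e2 := (hfar x hx _ hzK.2).trans e1
      have e3 : L * dist (t x) z ≤ L * (r / (2 * L)) := by
        gcongr
        rw [dist_comm]
        exact (mem_ball.1 hz).le
      linarith
  have hm := measure_mono (μ := volume) hsub
  rw [measure_biUnion_finset hdisj fun x _ => measurableSet_ball] at hm
  simp only [Real.volume_ball, Finset.sum_const, nsmul_eq_mul] at hm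
  have hKK : K' ⊆ cthickening (r / (2 * L)) K :=
    Set.inter_subset_left.trans (self_subset_cthickening K)
  rw [measure_sdiff hKK hK'.nullMeasurableSet hK'fin] at hm
  have hm2 : (ω.card : ℝ≥0∞) * ENNReal.ofReal (2 * (r / (2 * L))) ≤ ENNReal.ofReal (L * ε) :=
    hm.trans (tsub_le_iff_left.2 hr.le)
  rw [← ENNReal.ofReal_natCast, ← ENNReal.ofReal_mul (Nat.cast_nonneg _),
    ENNReal.ofReal_le_ofReal_iff (by positivity)] at hm2
  calc (ω.card : ℝ) * r = L * (ω.card * (2 * (r / (2 * L)))) := by field_simp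
    _ ≤ L * (L * ε) := by gcongr
    _ = L ^ 2 * ε := by ring

lemma IsArcUnion.eventually_card_mul_le {n : ℕ} {A : Set X} {K : Fin n → Set ℝ}
    {φ : Fin n → ℝ → X} {L : ℝ} (h : IsArcUnion A K φ L) {D : Set X} (hD : IsClosed D)
    {ε : ℝ} (hε : 0 < ε) (hDε : μH[1] (A \ D) < ENNReal.ofReal ε) :
    ∀ᶠ r : ℝ in 𝓝[>] 0, ∀ ω : Finset X, ↑ω ⊆ A →
      (∀ x ∈ ω, ∀ y ∈ ω, x ≠ y → r ≤ dist x y) → (∀ x ∈ ω, ∀ y ∈ D, r ≤ dist x y) →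
      ω.card * r ≤ n * (L ^ 2 * ε) := by
  have hk : ∀ k, φ k '' K k ⊆ A := fun k => by
    rw [h.eq_iUnion]
    exact Set.subset_iUnion (fun k => φ k '' K k) k
  have hev := eventually_all.2 fun k => eventually_card_mul_le_arc (h.isCompact k) h.one_le
    (h.dist_le k) (h.dist_map_le k) hD hε
    ((measure_mono (Set.sdiff_subset_sdiff_left (hk k))).trans_lt hDε)
  filter_upwards [hev, self_mem_nhdsWithin] with r hr hr0 ω hω hsep hfar
  have hcover : ω ⊆ (Finset.univ : Finset (Fin n)).biUnion
      fun k => ω.filter (· ∈ φ k '' K k) := fun x hx => by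
    have hxA := hω hx
    rw [h.eq_iUnion] at hxA
    obtain ⟨k, hxk⟩ := Set.mem_iUnion.1 hxA
    exact Finset.mem_biUnion.2 ⟨k, Finset.mem_univ k, Finset.mem_filter.2 ⟨hx, hxk⟩⟩
  have hcard : (ω.card : ℝ) ≤ ∑ k, ((ω.filter (· ∈ φ k '' K k)).card : ℝ) := by
    exact_mod_cast (Finset.card_le_card hcover).trans Finset.card_biUnion_le
  calc (ω.card : ℝ) * r ≤ (∑ k, ((ω.filter (· ∈ φ k '' K k)).card : ℝ)) * r :=
        mul_le_mul_of_nonneg_right hcard (le_of_lt hr0)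
    _ = ∑ k, ((ω.filter (· ∈ φ k '' K k)).card : ℝ) * r := Finset.sum_mul _ _ _
    _ ≤ ∑ k : Fin n, L ^ 2 * ε := by
        refine Finset.sum_le_sum fun k _ => hr k _ (fun x hx => (Finset.mem_filter.1 hx).2) ?_ ?_
        · exact fun x hx y hy => hsep x (Finset.mem_filter.1 hx).1 y (Finset.mem_filter.1 hy).1
        · exact fun x hx => hfar x (Finset.mem_filter.1 hx).1
    _ = _ := by simp

end Packing

/-! ### Energy bounds for almost isometric pieces -/

section NearLine

variable {X : Type*} [MetricSpace X] [MeasurableSpace X] [BorelSpace X] {s κ : ℝ} {Q : Set X}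

lemma NearLine.energyLowerBound (hQ : NearLine κ Q) (hc : IsCompact Q) (hfin : μH[1] Q ≠ ⊤)
    (hs : 0 < s) (hκ : 0 < κ) {θ : ℝ} (hθ : 0 < θ) :
    EnergyLowerBound s Q (κ * (κ * (μH[1] Q).toReal + θ)) := by
  obtain ⟨u, hu⟩ := hQ
  have huc : IsCompact (u '' Q) := hc.image_of_continuousOn
    (continuousOn_of_dist_le hκ.le fun x hx y hy => (hu x hx y hy).2)
  have hvol : (volume (u '' Q)).toReal ≤ κ * (μH[1] Q).toReal := by
    have := hausdorffMeasure_image_le_of_dist_le hκ.le fun x hx y hy => (hu x hx y hy).2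
    rw [hausdorffMeasure_real] at this
    have := ENNReal.toReal_mono (ENNReal.mul_ne_top ENNReal.ofReal_ne_top hfin) this
    rwa [ENNReal.toReal_mul, ENNReal.toReal_ofReal hκ.le] at this
  have h0 : 0 < (volume (u '' Q)).toReal + θ := add_pos_of_nonneg_of_pos ENNReal.toReal_nonneg hθ
  refine EnergyLowerBound.of_image hs hκ (h0.trans_le (by gcongr)) hu ?_
  exact (EnergyLowerBound.of_isCompact_real hs huc hθ).mono_length hs h0 (by gcongr)

lemma NearLine.exists_energyUpperBound (hQ : NearLine κ Q) (hc : IsCompact Q) (hs : 1 < s)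
    (hκ : 0 < κ) : ∃ c : ℝ, 0 ≤ c ∧ μH[1] Q ≤ ENNReal.ofReal (κ * c) ∧
      EnergyUpperBound s Q c (2 * (∑' n : ℕ, (n : ℝ) ^ (-s)) * κ ^ s) := by
  obtain ⟨u, hu⟩ := hQ
  have huc : IsCompact (u '' Q) := hc.image_of_continuousOn
    (continuousOn_of_dist_le hκ.le fun x hx y hy => (hu x hx y hy).2)
  refine ⟨(volume (u '' Q)).toReal, ENNReal.toReal_nonneg, ?_,
    EnergyUpperBound.of_image hs huc hκ fun x hx y hy => (hu x hx y hy).2⟩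
  have := hausdorffMeasure_le_image_of_dist_le hκ.le fun x hx y hy => (hu x hx y hy).1
  rwa [hausdorffMeasure_real, ← ENNReal.ofReal_toReal huc.measure_lt_top.ne,
    ← ENNReal.ofReal_mul hκ.le] at this

end NearLine

/-! ### Perturbation of configurations -/

section Perturbation

variable {X : Type*} [MetricSpace X] {s : ℝ}

lemma card_filter_dist_lt_le (hs : 0 ≤ s) (ω : Finset X) {r : ℝ} (hr : 0 < r) :
    ((ω.filter fun x => ∃ y ∈ ω, y ≠ x ∧ dist x y < r).card : ℝ) ≤ r ^ s * realEnergy s ω := by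
  have h1 : ∀ x ∈ ω.filter (fun x => ∃ y ∈ ω, y ≠ x ∧ dist x y < r),
      r ^ (-s) ≤ ∑ y ∈ ω, dist x y ^ (-s) := fun x hx => by
    obtain ⟨y, hy, hyx, hxy⟩ := (Finset.mem_filter.1 hx).2
    calc r ^ (-s) ≤ dist x y ^ (-s) :=
          Real.rpow_le_rpow_of_nonpos (dist_pos.2 hyx.symm) hxy.le (by linarith)
      _ ≤ _ := Finset.single_le_sum (f := fun y => dist x y ^ (-s))
          (fun y _ => dist_rpow_nonneg s x y) hy
  have h2 := Finset.card_nsmul_le_sum _ _ _ h1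
  have h3 : ∑ x ∈ ω.filter (fun x => ∃ y ∈ ω, y ≠ x ∧ dist x y < r), ∑ y ∈ ω, dist x y ^ (-s) ≤
      realEnergy s ω := Finset.sum_le_sum_of_subset_of_nonneg (Finset.filter_subset _ _)
    fun x _ _ => Finset.sum_nonneg fun y _ => dist_rpow_nonneg s x y
  have h4 := h2.trans h3
  rw [nsmul_eq_mul, Real.rpow_neg hr.le, ← div_eq_mul_inv,
    div_le_iff₀ (Real.rpow_pos_of_pos hr s), mul_comm] at h4
  exact h4

lemma exists_realEnergy_le_of_near (hs : 0 < s) {ω : Finset X} {D : Set X} {r δ θ : ℝ}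
    (hθ : θ < 1) (hθ0 : 0 ≤ θ) (hδ : 2 * δ ≤ θ * r)
    (hsep : ∀ x ∈ ω, ∀ y ∈ ω, x ≠ y → r ≤ dist x y) (hD : ∀ x ∈ ω, ∃ y ∈ D, dist x y < δ) :
    ∃ ω' : Finset X, ↑ω' ⊆ D ∧ ω'.card = ω.card ∧
      (1 - θ) ^ s * realEnergy s ω' ≤ realEnergy s ω := by
  have hD' : ∀ x, ∃ y, x ∈ ω → y ∈ D ∧ dist x y < δ := fun x => by
    by_cases hx : x ∈ ω
    · obtain ⟨y, hy⟩ := hD x hx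
      exact ⟨y, fun _ => hy⟩
    · exact ⟨x, fun h => absurd h hx⟩
  choose f hf using hD'
  have h1 : 0 < 1 - θ := by linarith
  have hdist : ∀ x ∈ ω, ∀ y ∈ ω, dist x y ≤ (1 - θ)⁻¹ * dist (f x) (f y) := fun x hx y hy => by
    rw [← div_eq_inv_mul, le_div_iff₀ h1]
    rcases eq_or_ne x y with rfl | hxy
    · simp
    · have e1 := dist_triangle4 x (f x) (f y) y
      have e2 := (hf x hx).2
      have e3 := (hf y hy).2
      rw [dist_comm] at e3
      have e4 : θ * r ≤ θ * dist x y := mul_le_mul_of_nonneg_left (hsep x hx y hy hxy) hθ0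
      linarith
  obtain ⟨hc, hE⟩ := realEnergy_image_le hs (inv_pos.2 h1) hdist
  refine ⟨ω.image f, fun y hy => ?_, hc, ?_⟩
  · obtain ⟨x, hx, rfl⟩ := Finset.mem_image.1 (Finset.mem_coe.1 hy)
    exact (hf x hx).1
  · rw [Real.inv_rpow h1.le, ← div_eq_inv_mul, le_div_iff₀ (Real.rpow_pos_of_pos h1 s),
      mul_comm] at hE
    exact hE

end Perturbation

/-! ### Asymptotics of the minimal energy -/

section Asymptotics

variable {E : Type*} [NormedAddCommGroup E] [NormedSpace ℝ E] [FiniteDimensional ℝ E]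
  [MeasurableSpace E] [BorelSpace E] {n : ℕ} {A : Set E} {K : Fin n → Set ℝ} {φ : Fin n → ℝ → E}
  {L s : ℝ}

namespace IsArcUnion

lemma exists_energyLowerBound (h : IsArcUnion A K φ L) (hs : 0 < s) {θ ε : ℝ} (hθ : 0 < θ)
    (hε : 0 < ε) : ∃ D, IsCompact D ∧ D ⊆ A ∧ μH[1] (A \ D) < ENNReal.ofReal ε ∧
      EnergyLowerBound s D ((μH[1] A).toReal + θ) := by
  have hfin := h.hausdorffMeasure_lt_top.ne
  obtain ⟨κ, hκθ, hκ⟩ : ∃ κ : ℝ, κ * (κ * (μH[1] A).toReal) < (μH[1] A).toReal + θ / 2 ∧ 1 < κ := by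
    have hc : Continuous fun κ : ℝ => κ * (κ * (μH[1] A).toReal) := by fun_prop
    have h1 : ∀ᶠ κ : ℝ in 𝓝[>] 1, κ * (κ * (μH[1] A).toReal) < (μH[1] A).toReal + θ / 2 :=
      (hc.tendsto 1).mono_left nhdsWithin_le_nhds |>.eventually (gt_mem_nhds (by linarith))
    exact (h1.and self_mem_nhdsWithin).exists
  have hκ0 : 0 < κ := zero_lt_one.trans hκ
  obtain ⟨N, Q, hQc, hQA, hQd, hQl, hQε⟩ := h.exists_nearLine_decomposition hκ
    (ENNReal.ofReal_pos.2 hε).ne' ENNReal.ofReal_ne_top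
  have hsum : ∑ i ∈ Finset.range N, (μH[1] (Q i)).toReal ≤ (μH[1] A).toReal := by
    rw [← ENNReal.toReal_sum fun i _ => measure_ne_top_of_subset (hQA i) hfin,
      ← measure_biUnion_finset (fun i _ j _ hij => hQd i j hij) fun i _ => (hQc i).measurableSet]
    exact ENNReal.toReal_mono hfin (measure_mono (Set.iUnion₂_subset fun i _ => hQA i))
  have hN : (0 : ℝ) < N + 1 := by positivity
  set θ₁ := θ / (4 * κ * (N + 1)) with hθ₁
  have hθ₁0 : 0 < θ₁ := by positivity
  have hpos : ∀ i, 0 < κ * (κ * (μH[1] (Q i)).toReal + θ₁) := fun i => by positivity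
  refine ⟨⋃ i < N, Q i, (Set.finite_lt_nat N).isCompact_biUnion fun i _ => hQc i,
    Set.iUnion₂_subset fun i _ => hQA i, hQε, ?_⟩
  have hb := EnergyLowerBound.biUnion (c := θ / 4) hs (fun i _ => hpos i) (fun i (_ : i < N) =>
    (hQl i).energyLowerBound (hQc i) (measure_ne_top_of_subset (hQA i) hfin) hs hκ0 hθ₁0)
    (by positivity)
  refine hb.mono_length hs (add_pos_of_pos_of_nonneg (by positivity)
    (Finset.sum_nonneg fun i _ => (hpos i).le)) ?_
  have e1 : ∑ i ∈ Finset.range N, κ * (κ * (μH[1] (Q i)).toReal + θ₁) =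
      κ * (κ * ∑ i ∈ Finset.range N, (μH[1] (Q i)).toReal) + N * (κ * θ₁) := by
    rw [← Finset.mul_sum, Finset.sum_add_distrib, ← Finset.mul_sum]
    simp
    ring
  have e2 : N * (κ * θ₁) ≤ θ / 4 := by
    have : (N + 1) * (κ * θ₁) = θ / 4 := by
      rw [hθ₁]
      field_simp
    nlinarith [mul_pos hκ0 hθ₁0]
  have e3 : κ * (κ * ∑ i ∈ Finset.range N, (μH[1] (Q i)).toReal) ≤
      κ * (κ * (μH[1] A).toReal) := by gcongr
  rw [e1]
  linarith

lemma eventually_le_realEnergy (h : IsArcUnion A K φ L) (hs : 1 < s) {τ : ℝ}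
    (hτZ : τ * (μH[1] A).toReal ^ s < 2 * ∑' n : ℕ, (n : ℝ) ^ (-s)) :
    ∀ᶠ N : ℕ in atTop, ∀ ω : Finset E, ↑ω ⊆ A → ω.card = N →
      τ * (N : ℝ) ^ (1 + s) ≤ realEnergy s ω := by
  have hs0 : 0 < s := zero_lt_one.trans hs
  set H := (μH[1] A).toReal
  have hH : 0 ≤ H := ENNReal.toReal_nonneg
  obtain ⟨M, hM⟩ := (((summable_rpow_neg hs).hasSum.tendsto_sum_nat.const_mul 2).eventually
    (lt_mem_nhds hτZ)).exists
  set Z := ∑ m ∈ Finset.range M, (m : ℝ) ^ (-s)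
  have hZ : 0 ≤ Z := sum_range_rpow_nonneg s M
  obtain ⟨θ, hθ, hθ0, hθ1⟩ : ∃ θ : ℝ, τ * (H + θ) ^ s <
      (1 - θ) ^ s * (2 * Z * (1 - 3 * θ) ^ (1 + s)) ∧ 0 < θ ∧ θ < 1 / 4 := by
    have hc₁ : Continuous fun θ : ℝ => τ * (H + θ) ^ s :=
      continuous_const.mul ((continuous_const.add continuous_id).rpow_const fun _ => Or.inr hs0.le)
    have hc₂ : Continuous fun θ : ℝ => (1 - θ) ^ s * (2 * Z * (1 - 3 * θ) ^ (1 + s)) :=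
      ((continuous_const.sub continuous_id).rpow_const fun _ => Or.inr hs0.le).mul
        (continuous_const.mul ((continuous_const.sub
          (continuous_const.mul continuous_id)).rpow_const fun _ => Or.inr (by linarith)))
    have h1 := (hc₁.tendsto 0).eventually_lt (hc₂.tendsto 0) (by simpa using hM)
    have h2 : ∀ᶠ θ : ℝ in 𝓝 0, θ < 1 / 4 := gt_mem_nhds (by norm_num)
    obtain ⟨θ, ⟨h3, h4⟩, h5⟩ :=
      (((h1.and h2).filter_mono nhdsWithin_le_nhds).and
        (self_mem_nhdsWithin (s := Set.Ioi 0))).exists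
    exact ⟨θ, h3, h5, h4⟩
  obtain ⟨η, hη, hη0⟩ : ∃ η : ℝ, τ * η ^ s < θ ∧ 0 < η := by
    have hc : Continuous fun η : ℝ => τ * η ^ s :=
      continuous_const.mul (continuous_id.rpow_const fun _ => Or.inr hs0.le)
    have h1 := (hc.tendsto 0).eventually_lt_const (u := θ) (by simpa [hs0.ne'] using hθ0)
    exact ((h1.filter_mono nhdsWithin_le_nhds).and
      (self_mem_nhdsWithin (s := Set.Ioi (0 : ℝ)))).exists
  set δ := θ * η / 2 with hδ
  have hδ0 : 0 < δ := by positivity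
  set ε := θ * δ / (n * L ^ 2 + 1) with hε
  have hnL : (0 : ℝ) < n * L ^ 2 + 1 := by positivity
  have hε0 : 0 < ε := by positivity
  have hεθ : n * (L ^ 2 * ε) ≤ θ * δ := by
    have : (n * L ^ 2 + 1) * ε = θ * δ := by
      rw [hε]
      field_simp
    linarith
  obtain ⟨D, hDc, -, hDε, hDE⟩ := h.exists_energyLowerBound hs0 hθ0 hε0
  obtain ⟨q, hq⟩ := hDE M
  have hpack := h.eventually_card_mul_le hDc.isClosed hε0 hDε
  have hlim : Tendsto (fun N : ℕ => δ / N) atTop (𝓝[>] 0) :=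
    tendsto_nhdsWithin_iff.2 ⟨tendsto_const_div_atTop_nhds_zero_nat δ,
      (eventually_gt_atTop 0).mono fun N hN => div_pos hδ0 (Nat.cast_pos.2 hN)⟩
  have hqN : ∀ᶠ N : ℕ in atTop, q ≤ θ * N :=
    (tendsto_natCast_atTop_atTop.const_mul_atTop hθ0).eventually_ge_atTop q
  filter_upwards [hlim.eventually hpack, hqN, eventually_gt_atTop 0] with N hN hqN hN0 ω hωA hωN
  by_contra! hE
  have hNpos : (0 : ℝ) < N := Nat.cast_pos.2 hN0
  have hNs : (0 : ℝ) < (N : ℝ) ^ (1 + s) := Real.rpow_pos_of_pos hNpos _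
  set bad := ω.filter fun x => ∃ y ∈ ω, y ≠ x ∧ dist x y < η / N
  have hbad : (bad.card : ℝ) ≤ θ * N := by
    calc (bad.card : ℝ) ≤ (η / N) ^ s * realEnergy s ω :=
          card_filter_dist_lt_le hs0.le ω (by positivity)
      _ ≤ (η / N) ^ s * (τ * (N : ℝ) ^ (1 + s)) := by gcongr
      _ = τ * η ^ s * N := by
          rw [Real.div_rpow hη0.le hNpos.le, Real.rpow_add hNpos, Real.rpow_one]
          have := (Real.rpow_pos_of_pos hNpos s).ne'
          field_simp
      _ ≤ θ * N := by gcongr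
  set ω₁ := ω \ bad
  have hω₁ : ω₁ ⊆ ω := Finset.sdiff_subset
  have hsep : ∀ x ∈ ω₁, ∀ y ∈ ω₁, x ≠ y → η / N ≤ dist x y := fun x hx y hy hxy => by
    by_contra! hlt
    exact (Finset.mem_sdiff.1 hx).2
      (Finset.mem_filter.2 ⟨hω₁ hx, y, hω₁ hy, hxy.symm, hlt⟩)
  set far := ω₁.filter fun x => ∀ y ∈ D, δ / N ≤ dist x y
  have hfar₁ : far ⊆ ω₁ := Finset.filter_subset _ _
  have hδη : δ / N ≤ η / N := by
    gcongr
    rw [hδ]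
    nlinarith
  have hfar : (far.card : ℝ) ≤ θ * N := by
    have h1 := (hN far (fun x hx => hωA (hω₁ (hfar₁ hx)))
      (fun x hx y hy hxy => hδη.trans (hsep x (hfar₁ hx) y (hfar₁ hy) hxy))
      fun x hx => (Finset.mem_filter.1 hx).2).trans hεθ
    rw [mul_div_assoc', div_le_iff₀ hNpos] at h1
    exact le_of_mul_le_mul_right (by linarith) hδ0
  have hω₂ : ω₁ \ far ⊆ ω₁ := Finset.sdiff_subset
  obtain ⟨ω', hω'D, hω'c, hω'E⟩ := exists_realEnergy_le_of_near (s := s) (ω := ω₁ \ far) (D := D)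
    (r := η / N) (δ := δ / N) hs0 (by linarith : θ < 1) hθ0.le (le_of_eq (by rw [hδ]; field_simp))
    (fun x hx y hy => hsep x (hω₂ hx) y (hω₂ hy)) (fun x hx => by
      by_contra! hcon
      exact (Finset.mem_sdiff.1 hx).2 (Finset.mem_filter.2 ⟨hω₂ hx, hcon⟩))
  have hcard : (1 - 2 * θ) * N ≤ ω'.card := by
    have c1 : (ω.card : ℝ) = ω₁.card + bad.card := by
      exact_mod_cast (Finset.card_sdiff_add_card_eq_card (Finset.filter_subset _ _)).symm
    have c2 : (ω₁.card : ℝ) = (ω₁ \ far).card + far.card := by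
      exact_mod_cast (Finset.card_sdiff_add_card_eq_card hfar₁).symm
    rw [hω'c]
    rw [hωN] at c1
    linarith
  have hlow := hq ω' hω'D
  have hmax : ((1 - 3 * θ) * N) ^ (1 + s) ≤ (max ((ω'.card : ℝ) - q) 0) ^ (1 + s) := by
    refine Real.rpow_le_rpow (mul_nonneg (by linarith) hNpos.le) (le_max_of_le_left ?_)
      (by linarith)
    linarith
  have hHθ : 0 < (H + θ) ^ s := Real.rpow_pos_of_pos (by linarith) s
  rw [div_le_iff₀ hHθ] at hlow
  have hθs : 0 < (1 - θ) ^ s := Real.rpow_pos_of_pos (by linarith) s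
  rw [Real.mul_rpow (by linarith) hNpos.le] at hmax
  have hchain : (1 - θ) ^ s * (2 * Z * (1 - 3 * θ) ^ (1 + s)) * (N : ℝ) ^ (1 + s) ≤
      τ * (H + θ) ^ s * (N : ℝ) ^ (1 + s) := by
    calc _ = (1 - θ) ^ s * (2 * Z * ((1 - 3 * θ) ^ (1 + s) * (N : ℝ) ^ (1 + s))) := by ring
      _ ≤ (1 - θ) ^ s * (2 * Z * (max ((ω'.card : ℝ) - q) 0) ^ (1 + s)) := by gcongr
      _ ≤ (1 - θ) ^ s * (realEnergy s ω' * (H + θ) ^ s) := by gcongr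
      _ = (1 - θ) ^ s * realEnergy s ω' * (H + θ) ^ s := by ring
      _ ≤ realEnergy s ω * (H + θ) ^ s := by
          gcongr
          exact hω'E.trans (realEnergy_mono (hω₂.trans hω₁))
      _ ≤ τ * (N : ℝ) ^ (1 + s) * (H + θ) ^ s := by gcongr
      _ = _ := by ring
  exact absurd (le_of_mul_le_mul_right hchain hNs) (not_le.2 hθ)

end IsArcUnion

namespace IsArcUnion

lemma eventually_exists_realEnergy_le (h : IsArcUnion A K φ L) (hs : 1 < s) {τ : ℝ}
    (hA : 0 < (μH[1] A).toReal)
    (hτ : 2 * (∑' n : ℕ, (n : ℝ) ^ (-s)) < τ * (μH[1] A).toReal ^ s) :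
    ∀ᶠ N : ℕ in atTop, ∃ ω : Finset E, ↑ω ⊆ A ∧ ω.card = N ∧
      realEnergy s ω ≤ τ * (N : ℝ) ^ (1 + s) := by
  have hs0 : 0 < s := zero_lt_one.trans hs
  have hfin := h.hausdorffMeasure_lt_top.ne
  set H := (μH[1] A).toReal
  set Z := ∑' n : ℕ, (n : ℝ) ^ (-s)
  have hZ : 0 ≤ Z := tsum_nonneg fun n => by positivity
  have hτ0 : 0 < τ := by
    by_contra! hcon
    have := mul_nonpos_of_nonpos_of_nonneg hcon (Real.rpow_nonneg hA.le s)
    linarith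
  obtain ⟨κ, ⟨hκτ, hκH⟩, hκ⟩ : ∃ κ : ℝ, (2 * Z * κ ^ s < τ * ((H - (κ - 1)) / κ) ^ s ∧
      κ - 1 < H) ∧ 1 < κ := by
    have hc₁ : ContinuousAt (fun κ : ℝ => 2 * Z * κ ^ s) 1 :=
      continuousAt_const.mul (continuousAt_id.rpow_const (Or.inr hs0.le))
    have hc₂ : ContinuousAt (fun κ : ℝ => τ * ((H - (κ - 1)) / κ) ^ s) 1 :=
      continuousAt_const.mul (((continuousAt_const.sub (continuousAt_id.sub
        continuousAt_const)).div continuousAt_id one_ne_zero).rpow_const (Or.inr hs0.le))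
    have hc₃ : ContinuousAt (fun κ : ℝ => κ - 1) 1 := continuousAt_id.sub continuousAt_const
    have h1 := hc₁.tendsto.eventually_lt hc₂.tendsto (by simpa using hτ)
    have h2 := hc₃.tendsto.eventually_lt_const (u := H) (by simpa using hA)
    exact (((h1.and h2).filter_mono nhdsWithin_le_nhds).and
      (self_mem_nhdsWithin (s := Set.Ioi (1 : ℝ)))).exists
  have hκ0 : 0 < κ := zero_lt_one.trans hκ
  obtain ⟨m, Q, hQc, hQA, hQd, hQl, hQε⟩ := h.exists_nearLine_decomposition hκ
    (ENNReal.ofReal_pos.2 (sub_pos.2 hκ)).ne' ENNReal.ofReal_ne_top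
  choose c hc0 hcQ hcE using fun i => (hQl i).exists_energyUpperBound (hQc i) hs hκ0
  set C := ∑ i ∈ Finset.range m, c i
  have hC0 : 0 ≤ C := Finset.sum_nonneg fun i _ => hc0 i
  have hC : (H - (κ - 1)) / κ ≤ C := by
    have h1 : μH[1] A ≤ ENNReal.ofReal (κ * C + (κ - 1)) := by
      rw [ENNReal.ofReal_add (by positivity) (by linarith), Finset.mul_sum,
        ENNReal.ofReal_sum_of_nonneg fun i _ => mul_nonneg hκ0.le (hc0 i)]
      calc μH[1] A ≤ μH[1] ((⋃ i ∈ Finset.range m, Q i) ∪ (A \ ⋃ i < m, Q i)) :=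
            measure_mono fun x hx => by
              by_cases hxQ : x ∈ ⋃ i < m, Q i
              · exact Or.inl (by simpa using hxQ)
              · exact Or.inr ⟨hx, hxQ⟩
        _ ≤ _ := (measure_union_le _ _).trans (add_le_add ((measure_biUnion_finset_le _ _).trans
            (Finset.sum_le_sum fun i _ => hcQ i)) hQε.le)
    have h2 := ENNReal.toReal_le_of_le_ofReal (by nlinarith) h1
    rw [div_le_iff₀ hκ0]
    linarith
  have hCpos : 0 < C := lt_of_lt_of_le (div_pos (by linarith) hκ0) hC
  set a := 2 * Z * κ ^ s
  have ha0 : 0 ≤ a := by positivity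
  obtain ⟨B, hB0, hB⟩ := EnergyUpperBound.biUnion hs0 (fun i (_ : i < m) => hQc i)
    (fun i _ j _ hij => hQd i j hij) fun i _ => hcE i
  have hCs : 0 < C ^ s := Real.rpow_pos_of_pos hCpos s
  have hb : a / C ^ s < τ := by
    rw [div_lt_iff₀ hCs]
    refine hκτ.trans_le ?_
    gcongr
  have hlim : Tendsto (fun N : ℕ => (1 + B / N) * (a / C ^ s) +
      B * (1 + B / N) ^ 2 * (N : ℝ) ^ (-(s - 1))) atTop (𝓝 (a / C ^ s)) := by
    have h1 : Tendsto (fun N : ℕ => 1 + B / (N : ℝ)) atTop (𝓝 1) := by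
      simpa using (tendsto_const_div_atTop_nhds_zero_nat B).const_add 1
    have h2 : Tendsto (fun N : ℕ => (N : ℝ) ^ (-(s - 1))) atTop (𝓝 0) :=
      (tendsto_rpow_neg_atTop (sub_pos.2 hs)).comp tendsto_natCast_atTop_atTop
    simpa using (h1.mul_const (a / C ^ s)).add (((h1.pow 2).const_mul B).mul h2)
  filter_upwards [hlim.eventually_lt_const hb, eventually_gt_atTop 0] with N hN hN0
  have hNpos : (0 : ℝ) < N := Nat.cast_pos.2 hN0
  obtain ⟨ω, hωQ, hωN, hωB, hωE⟩ := hB (C / N) (div_pos hCpos hNpos)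
  rw [div_div_cancel₀ hCpos.ne'] at hωN hωB
  obtain ⟨ω', hω', hω'N⟩ := Finset.exists_subset_card_eq (Nat.cast_le.1 hωN)
  refine ⟨ω', ?_, hω'N, (realEnergy_mono hω').trans (hωE.trans ?_)⟩
  · exact (Finset.coe_subset.2 hω').trans (hωQ.trans (Set.iUnion₂_subset fun i _ => hQA i))
  have hNs : 0 < (N : ℝ) ^ s := Real.rpow_pos_of_pos hNpos s
  calc _ ≤ (N + B) * (a / (C / N) ^ s) + B * (N + B) ^ 2 := by gcongr
    _ = ((1 + B / N) * (a / C ^ s) + B * (1 + B / N) ^ 2 * (N : ℝ) ^ (-(s - 1))) *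
          (N : ℝ) ^ (1 + s) := by
        have e : (N : ℝ) ^ (-(s - 1)) = N / (N : ℝ) ^ s := by
          rw [neg_sub, Real.rpow_sub hNpos, Real.rpow_one]
        rw [e, Real.div_rpow hCpos.le hNpos.le, Real.rpow_add hNpos, Real.rpow_one]
        field_simp
    _ ≤ τ * (N : ℝ) ^ (1 + s) := by gcongr

/-- The asymptotics of the minimal energy over a finite union of bi-Lipschitz arcs. -/
lemma tendsto_minRieszEnergy_div (h : IsArcUnion A K φ L) (hs : 1 < s) :
    Tendsto (fun N : ℕ => minRieszEnergy s A N / ENNReal.ofReal ((N : ℝ) ^ (1 + s))) atTop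
      (𝓝 (ENNReal.ofReal (2 * ∑' n : ℕ, (n : ℝ) ^ (-s)) / (μH[1] A) ^ s)) := by
  have hs0 : 0 < s := zero_lt_one.trans hs
  have hfin := h.hausdorffMeasure_lt_top.ne
  have hZ : 0 < ∑' n : ℕ, (n : ℝ) ^ (-s) :=
    (summable_rpow_neg hs).tsum_pos (fun n => by positivity) 1 (by simp)
  have hHs : (μH[1] A) ^ s = ENNReal.ofReal ((μH[1] A).toReal ^ s) := by
    rw [← ENNReal.ofReal_rpow_of_nonneg ENNReal.toReal_nonneg hs0.le, ENNReal.ofReal_toReal hfin]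
  have hH : 0 ≤ (μH[1] A).toReal := ENNReal.toReal_nonneg
  have hpos : ∀ N : ℕ, 0 < N → ENNReal.ofReal ((N : ℝ) ^ (1 + s)) ≠ 0 := fun N hN =>
    (ENNReal.ofReal_pos.2 (Real.rpow_pos_of_pos (Nat.cast_pos.2 hN) _)).ne'
  rw [hHs]
  refine tendsto_order.2 ⟨fun a ha => ?_, fun a ha => ?_⟩
  · obtain ⟨τ, hτ0, haτ, hτ⟩ := ENNReal.lt_iff_exists_real_btwn.1 ha
    rw [ENNReal.lt_div_iff_mul_lt (Or.inr ENNReal.ofReal_ne_top) (Or.inl ENNReal.ofReal_ne_top),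
      ← ENNReal.ofReal_mul hτ0, ENNReal.ofReal_lt_ofReal_iff (by positivity)] at hτ
    filter_upwards [h.eventually_le_realEnergy hs hτ, eventually_gt_atTop 0] with N hN hN0
    refine haτ.trans_le ?_
    rw [ENNReal.le_div_iff_mul_le (Or.inl (hpos N hN0)) (Or.inl ENNReal.ofReal_ne_top),
      ← ENNReal.ofReal_mul hτ0]
    refine le_iInf fun ω => le_iInf fun hω => le_iInf fun hωN => ?_
    rw [rieszEnergy_eq_ofReal hs0.ne']
    exact ENNReal.ofReal_le_ofReal (hN ω hω hωN)
  · obtain ⟨τ, hτ0, hτ, hτa⟩ := ENNReal.lt_iff_exists_real_btwn.1 ha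
    have hA : 0 < (μH[1] A).toReal := by
      refine hH.lt_of_ne' fun h0 => ?_
      rw [h0, Real.zero_rpow hs0.ne', ENNReal.ofReal_zero, ENNReal.div_zero
        (ENNReal.ofReal_pos.2 (by positivity)).ne'] at hτ
      exact not_top_lt hτ
    have hAs : 0 < (μH[1] A).toReal ^ s := Real.rpow_pos_of_pos hA s
    rw [← ENNReal.ofReal_div_of_pos hAs, ENNReal.ofReal_lt_ofReal_iff', div_lt_iff₀ hAs] at hτ
    filter_upwards [h.eventually_exists_realEnergy_le hs hA hτ.1, eventually_gt_atTop 0]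
      with N ⟨ω, hωA, hωN, hωE⟩ hN0
    refine lt_of_le_of_lt ?_ hτa
    rw [ENNReal.div_le_iff (hpos N hN0) ENNReal.ofReal_ne_top, ← ENNReal.ofReal_mul hτ0]
    refine (iInf_le_of_le ω (iInf_le_of_le hωA (iInf_le _ hωN))).trans ?_
    rw [rieszEnergy_eq_ofReal hs0.ne']
    exact ENNReal.ofReal_le_ofReal hωE

end IsArcUnion

end Asymptotics

/-! ### Rectifiable manifolds of dimension one -/

lemma hausdorffMeasure_unitCube_one : μH[1] (unitCube 1) = 1 := by
  have hiso : Isometry fun t : ℝ => EuclideanSpace.single (0 : Fin 1) t :=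
    Isometry.of_dist_eq fun x y => by simp
  have himg : unitCube 1 = (fun t : ℝ => EuclideanSpace.single (0 : Fin 1) t) '' Set.Icc 0 1 := by
    ext x
    constructor
    · intro hx
      refine ⟨x 0, hx 0, ?_⟩
      ext i
      fin_cases i
      simp
    · rintro ⟨t, ht, rfl⟩ i
      fin_cases i
      simpa using ht
  rw [himg, hiso.hausdorffMeasure_image (Or.inl zero_le_one), hausdorffMeasure_real]
  simp

lemma normHausdorff_one (d' : ℕ) : normHausdorff 1 d' = μH[1] := by
  rw [normHausdorff, Nat.cast_one, hausdorffMeasure_unitCube_one, inv_one, one_smul]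

lemma IsRectifiableManifold.exists_isArcUnion {d' : ℕ} {A M : Set (EuclideanSpace ℝ (Fin d'))}
    (hM : IsRectifiableManifold 1 d' M) (hA : IsCompact A) (hAM : A ⊆ M) :
    ∃ (n : ℕ) (K : Fin n → Set ℝ) (φ : Fin n → ℝ → EuclideanSpace ℝ (Fin d')) (L : ℝ),
      IsArcUnion A K φ L := by
  obtain ⟨n, K, φ, hK, hφ, rfl⟩ := hM
  choose G ℓ _ hKG hℓ hbi using hφ
  set e : ℝ → EuclideanSpace ℝ (Fin 1) := fun t => EuclideanSpace.single 0 t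
  have he : ∀ x y, dist (e x) (e y) = dist x y := fun x y => by simp [e]
  have hesurj : ∀ x : EuclideanSpace ℝ (Fin 1), e (x 0) = x := fun x => by
    ext i
    fin_cases i
    simp [e]
  have hℓL : ∀ k, ℓ k ≤ 1 + ∑ k, ℓ k := fun k => by
    have := Finset.single_le_sum (f := ℓ) (fun i _ => zero_le_one.trans (hℓ i)) (Finset.mem_univ k)
    linarith
  have hbi₁ : ∀ k, ∀ x ∈ K k, ∀ y ∈ K k, dist x y ≤ ℓ k * dist (φ k x) (φ k y) :=
    fun k x hx y hy => by
      have := (hbi k x (hKG k hx) y (hKG k hy)).1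
      rwa [one_div, ← div_eq_inv_mul, div_le_iff₀' (zero_lt_one.trans_le (hℓ k))] at this
  have hbi₂ : ∀ k, ∀ x ∈ K k, ∀ y ∈ K k, dist (φ k x) (φ k y) ≤ ℓ k * dist x y :=
    fun k x hx y hy => (hbi k x (hKG k hx) y (hKG k hy)).2
  refine ⟨n, fun k => e ⁻¹' (K k ∩ φ k ⁻¹' A), fun k t => φ k (e t), 1 + ∑ k, ℓ k, ?_, ?_, ?_, ?_,
    ?_⟩
  · linarith [Finset.sum_nonneg fun (k : Fin n) (_ : k ∈ Finset.univ) =>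
      zero_le_one.trans (hℓ k)]
  · intro k
    have hcont : ContinuousOn (φ k) (K k) :=
      continuousOn_of_dist_le (zero_le_one.trans (hℓ k)) (hbi₂ k)
    have hcl := hcont.preimage_isClosed_of_isClosed (hK k).isClosed hA.isClosed
    exact (Isometry.of_dist_eq he).isClosedEmbedding.isCompact_preimage
      ((hK k).of_isClosed_subset hcl Set.inter_subset_left)
  · intro k x hx y hy
    rw [← he]
    exact (hbi₁ k _ hx.1 _ hy.1).trans (by gcongr; exact hℓL k)
  · intro k x hx y hy
    rw [← he x y]
    exact (hbi₂ k _ hx.1 _ hy.1).trans (by gcongr; exact hℓL k)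
  · ext z
    constructor
    · intro hz
      obtain ⟨k, x, hx, rfl⟩ := Set.mem_iUnion.1 (hAM hz)
      refine Set.mem_iUnion.2 ⟨k, x 0, ?_, ?_⟩
      · simp only [Set.mem_preimage, hesurj]
        exact ⟨hx, hz⟩
      · simp only [hesurj]
    · intro hz
      obtain ⟨k, t, ht, rfl⟩ := Set.mem_iUnion.1 hz
      exact ht.2

/-- for `A` a compact subset of a `1`-rectifiable manifold in `ℝ^{d'}` and
`s > 1`, `ℰ_s(A,N)/N^{1+s} → 2ζ(s)/H_1(A)^s` in `[0,∞]`. -/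
theorem minRieszEnergy_div_tendsto_of_oneRectifiable (d' : ℕ) (hd' : 1 ≤ d') (s : ℝ)
    (hs : 1 < s)
    (A M : Set (EuclideanSpace ℝ (Fin d'))) (hA : IsCompact A)
    (hM : IsRectifiableManifold 1 d' M) (hAM : A ⊆ M) :
    Tendsto
      (fun N : ℕ => minRieszEnergy s A N / ENNReal.ofReal ((N : ℝ) ^ (1 + s)))
      atTop
      (𝓝 (ENNReal.ofReal (2 * ∑' n : ℕ, (n : ℝ) ^ (-s)) / (normHausdorff 1 d' A) ^ s)) := by
  obtain ⟨n, K, φ, L, h⟩ := hM.exists_isArcUnion hA hAM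
  rw [normHausdorff_one]
  exact h.tendsto_minRieszEnergy_div hs
end

section
/- Fix an integer d ≥ 1. Let A ⊆ ℝ^d be a bounded set with nonempty interior. Then there exist positive finite constants C_0 and C_1 (depending on A and d but not on N) such that C_0 · N² log N ≤ ℰ_d(A,N) ≤ C_1 · N² log N for all integers N ≥ 2. -/
open scoped ENNReal NNReal BigOperators Classical
open MeasureTheory Filter Metric Set Topology

lemma rieszEnergy_natCast_eq_ofReal {E : Type*} [MetricSpace E] {d : ℕ} (hd : 1 ≤ d)
    (ω : Finset E) :
    rieszEnergy (d : ℝ) ω = ENNReal.ofReal (∑ x ∈ ω, ∑ y ∈ ω, (dist x y ^ d)⁻¹) := by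
  unfold rieszEnergy
  rw [ENNReal.ofReal_sum_of_nonneg fun x _ => Finset.sum_nonneg fun y _ => by positivity]
  refine Finset.sum_congr rfl fun x _ => ?_
  rw [ENNReal.ofReal_sum_of_nonneg fun y _ => by positivity]
  refine Finset.sum_congr rfl fun y _ => ?_
  split_ifs with h
  · subst h
    simp [show d ≠ 0 by omega]
  · have hpos : 0 < dist x y := dist_pos.2 h
    rw [edist_dist, ENNReal.rpow_neg, ENNReal.rpow_natCast,
      ENNReal.ofReal_inv_of_pos (by positivity), ENNReal.ofReal_pow hpos.le]

lemma EuclideanSpace.dist_le_card_mul {d : ℕ} {x y : EuclideanSpace ℝ (Fin d)} {c : ℝ}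
    (hc : 0 ≤ c) (h : ∀ i, |x i - y i| ≤ c) : dist x y ≤ d * c := by
  rw [EuclideanSpace.dist_eq]
  refine Real.sqrt_le_iff.2 ⟨by positivity, ?_⟩
  calc ∑ i, dist (x i) (y i) ^ 2 ≤ ∑ _i : Fin d, c ^ 2 := by
        gcongr with i
        exact h i
    _ = d * c ^ 2 := by simp
    _ ≤ (d : ℝ) ^ 2 * c ^ 2 := by
        gcongr
        exact_mod_cast Nat.le_self_pow two_ne_zero d
    _ = (d * c) ^ 2 := by ring

lemma EuclideanSpace.abs_sub_apply_le_dist {d : ℕ} (x y : EuclideanSpace ℝ (Fin d)) (i : Fin d) :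
    |x i - y i| ≤ dist x y := by
  rw [dist_eq_norm]
  exact PiLp.norm_apply_le (x - y) i

lemma sum_pow_le_two_mul_of_forall_le {q T : ℝ} (hq : 2 ≤ q) (hT : 0 ≤ T) (S : Finset ℕ)
    (hS : ∀ k ∈ S, q ^ k ≤ T) : ∑ k ∈ S, q ^ k ≤ 2 * T := by
  have geom (n : ℕ) : ∑ k ∈ Finset.range (n + 1), q ^ k ≤ 2 * q ^ n := by
    induction n with
    | zero => simp
    | succ n ih =>
      rw [Finset.sum_range_succ, pow_succ]
      nlinarith [pow_nonneg (by linarith : (0 : ℝ) ≤ q) n]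
  rcases S.eq_empty_or_nonempty with rfl | hne
  · simpa using hT
  calc ∑ k ∈ S, q ^ k ≤ ∑ k ∈ Finset.range (S.max' hne + 1), q ^ k := by
        refine Finset.sum_le_sum_of_subset_of_nonneg (fun k hk => ?_) fun k _ _ => by positivity
        exact Finset.mem_range.2 (Nat.lt_succ_of_le (S.le_max' k hk))
    _ ≤ 2 * q ^ S.max' hne := geom _
    _ ≤ 2 * T := by
        gcongr
        exact hS _ (S.max'_mem hne)

lemma Finset.card_sq_le_card_mul_sum_collisions {α β : Type*} [DecidableEq β]
    (ω : Finset α) (t : Finset β) (f : α → β) (hf : ∀ x ∈ ω, f x ∈ t) :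
    (ω.card : ℝ) ^ 2 ≤ t.card * ∑ x ∈ ω, ∑ y ∈ ω, if f x = f y then (1 : ℝ) else 0 := by
  have hcollisions : (∑ x ∈ ω, ∑ y ∈ ω, if f x = f y then (1 : ℝ) else 0) =
      ∑ c ∈ t, ((ω.filter fun x => f x = c).card : ℝ) ^ 2 := by
    rw [← Finset.sum_fiberwise_of_maps_to hf]
    refine Finset.sum_congr rfl fun c _ => ?_
    rw [sq, ← nsmul_eq_mul, ← Finset.sum_const]
    refine Finset.sum_congr rfl fun x hx => ?_
    rw [Finset.sum_boole, (Finset.mem_filter.1 hx).2]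
    simp only [eq_comm]
  rw [hcollisions, Finset.card_eq_sum_card_fiberwise hf]
  push_cast
  exact sq_sum_le_card_mul_sum_sq

lemma sq_le_sum_floor_collisions {d R : ℕ} (hR : 1 ≤ R)
    (ω : Finset (EuclideanSpace ℝ (Fin d))) (hω : ∀ x ∈ ω, ∀ i, |x i| ≤ R) (k : ℕ) :
    (ω.card : ℝ) ^ 2 ≤ (3 * R : ℝ) ^ d * ∑ x ∈ ω, ∑ y ∈ ω,
      if (fun i => ⌊2 ^ k * x i⌋) = (fun i => ⌊2 ^ k * y i⌋) then ((2 : ℝ) ^ d) ^ k else 0 := by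
  have hcells := Finset.card_sq_le_card_mul_sum_collisions ω
    (Fintype.piFinset fun _ : Fin d => Finset.Icc (-(2 ^ k * R : ℤ)) (2 ^ k * R))
    (fun x i => ⌊2 ^ k * x i⌋) (fun x hx => by
      simp only [Fintype.mem_piFinset, Finset.mem_Icc]
      intro i
      have hi := abs_le.1 (hω x hx i)
      have h2 : (0 : ℝ) < 2 ^ k := by positivity
      constructor
      · rw [Int.le_floor]
        push_cast
        nlinarith
      · rw [← Int.cast_le (R := ℝ)]
        push_cast
        exact (Int.floor_le _).trans (by nlinarith))
  refine hcells.trans ?_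
  have hfactor : (∑ x ∈ ω, ∑ y ∈ ω,
      if (fun i => ⌊2 ^ k * x i⌋) = (fun i => ⌊2 ^ k * y i⌋) then ((2 : ℝ) ^ d) ^ k else 0) =
      ((2 : ℝ) ^ d) ^ k * ∑ x ∈ ω, ∑ y ∈ ω,
        if (fun i => ⌊2 ^ k * x i⌋) = (fun i => ⌊2 ^ k * y i⌋) then (1 : ℝ) else 0 := by
    simp only [Finset.mul_sum, mul_ite, mul_one, mul_zero]
  rw [hfactor, ← mul_assoc]
  refine mul_le_mul_of_nonneg_right ?_ ?_
  swap
  · exact Finset.sum_nonneg fun x _ => Finset.sum_nonneg fun y _ => by positivity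
  have hcard : (Finset.Icc (-(2 ^ k * R : ℤ)) (2 ^ k * R)).card = 2 * (2 ^ k * R) + 1 := by
    rw [Int.card_Icc]
    have hcast : (2 ^ k * R : ℤ) = (2 ^ k * R : ℕ) := by push_cast; rfl
    omega
  rw [Fintype.card_piFinset_const, hcard, pow_right_comm, ← mul_pow]
  push_cast
  gcongr
  have h1 : (1 : ℝ) ≤ 2 ^ k * R := by
    exact_mod_cast Nat.mul_pos (Nat.two_pow_pos k) hR
  linarith

lemma Finset.sum_sum_ite_eq_const {α : Type*} (ω : Finset α) (c : ℝ) :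
    (∑ x ∈ ω, ∑ y ∈ ω, if x = y then c else 0) = ω.card * c := by
  rw [Finset.sum_congr rfl fun x hx => Finset.sum_ite_eq_of_mem ω x (fun _ => c) hx,
    Finset.sum_const, nsmul_eq_mul]

lemma sum_floor_collisions_le {d : ℕ} (hd : 1 ≤ d) {x y : EuclideanSpace ℝ (Fin d)} (hxy : x ≠ y)
    (L : ℕ) :
    (∑ k ∈ Finset.range L,
      if (fun i => ⌊2 ^ k * x i⌋) = (fun i => ⌊2 ^ k * y i⌋) then ((2 : ℝ) ^ d) ^ k else 0) ≤
      2 * (d : ℝ) ^ d * (dist x y ^ d)⁻¹ := by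
  have hpos : 0 < dist x y := dist_pos.2 hxy
  rw [← Finset.sum_filter, mul_assoc]
  refine sum_pow_le_two_mul_of_forall_le ?_ (by positivity) _ fun k hk => ?_
  · simpa using pow_le_pow_right₀ (one_le_two : (1 : ℝ) ≤ 2) hd
  · have hcell := (Finset.mem_filter.1 hk).2
    have h2 : (0 : ℝ) < 2 ^ k := by positivity
    have hdist : dist x y ≤ d * (1 / 2 ^ k) := by
      refine EuclideanSpace.dist_le_card_mul (by positivity) fun i => ?_
      have hi := Int.abs_sub_lt_one_of_floor_eq_floor (congrFun hcell i)
      rw [← mul_sub, abs_mul, abs_of_pos h2] at hi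
      rw [le_div_iff₀ h2]
      linarith
    rw [pow_right_comm, ← div_eq_mul_inv, ← div_pow]
    gcongr
    rw [le_div_iff₀ hpos]
    calc 2 ^ k * dist x y ≤ 2 ^ k * (d * (1 / 2 ^ k)) := by gcongr
      _ = d := by field_simp

lemma sq_mul_le_sum_inv_dist_pow {d R : ℕ} (hd : 1 ≤ d) (hR : 1 ≤ R)
    (ω : Finset (EuclideanSpace ℝ (Fin d))) (hω : ∀ x ∈ ω, ∀ i, |x i| ≤ R) (L : ℕ)
    (hL : ∀ k < L, 2 * (3 * R : ℝ) ^ d * ((2 : ℝ) ^ d) ^ k ≤ ω.card) :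
    L * (ω.card : ℝ) ^ 2 ≤
      4 * (3 * R : ℝ) ^ d * (d : ℝ) ^ d * ∑ x ∈ ω, ∑ y ∈ ω, (dist x y ^ d)⁻¹ := by
  set K : ℝ := (3 * R : ℝ) ^ d
  set N : ℝ := (ω.card : ℝ)
  have hK : 0 < K := by positivity
  have hpairs : ∑ k ∈ Finset.range L, (∑ x ∈ ω, ∑ y ∈ ω,
      if (fun i => ⌊2 ^ k * x i⌋) = (fun i => ⌊2 ^ k * y i⌋) then ((2 : ℝ) ^ d) ^ k else 0) ≤
      2 * (d : ℝ) ^ d * (∑ x ∈ ω, ∑ y ∈ ω, (dist x y ^ d)⁻¹) +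
        N * ∑ k ∈ Finset.range L, ((2 : ℝ) ^ d) ^ k := by
    rw [Finset.sum_comm, Finset.mul_sum, ← Finset.sum_sum_ite_eq_const, ← Finset.sum_add_distrib]
    refine Finset.sum_le_sum fun x hx => ?_
    rw [Finset.sum_comm, Finset.mul_sum, ← Finset.sum_add_distrib]
    refine Finset.sum_le_sum fun y _ => ?_
    split_ifs with hxy
    · subst hxy
      simp [show d ≠ 0 by omega]
    · simpa using sum_floor_collisions_le hd hxy L
  have hscale : ∑ k ∈ Finset.range L, (N ^ 2 / (2 * K)) ≤ ∑ k ∈ Finset.range L, ((∑ x ∈ ω, ∑ y ∈ ω,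
      if (fun i => ⌊2 ^ k * x i⌋) = (fun i => ⌊2 ^ k * y i⌋) then ((2 : ℝ) ^ d) ^ k else 0) -
        N * ((2 : ℝ) ^ d) ^ k) := by
    refine Finset.sum_le_sum fun k hk => ?_
    have h1 := sq_le_sum_floor_collisions hR ω hω k
    have h2 := mul_le_mul_of_nonneg_left (hL k (Finset.mem_range.1 hk)) (Nat.cast_nonneg ω.card)
    rw [div_le_iff₀ (by positivity)]
    change N ^ 2 ≤ K * _ at h1
    change N * _ ≤ N * N at h2
    linarith
  rw [Finset.sum_sub_distrib, ← Finset.mul_sum, Finset.sum_const, Finset.card_range,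
    nsmul_eq_mul] at hscale
  have hdiv : L * (N ^ 2 / (2 * K)) ≤
      2 * (d : ℝ) ^ d * (∑ x ∈ ω, ∑ y ∈ ω, (dist x y ^ d)⁻¹) := by linarith
  rw [← mul_div_assoc, div_le_iff₀ (by positivity)] at hdiv
  linarith

lemma sq_le_sum_inv_dist_pow {E : Type*} [MetricSpace E] (d : ℕ) {D : ℝ}
    (ω : Finset E) (hD : ∀ x ∈ ω, ∀ y ∈ ω, dist x y ≤ D) (hN : 2 ≤ ω.card) :
    (ω.card : ℝ) ^ 2 ≤ 2 * D ^ d * ∑ x ∈ ω, ∑ y ∈ ω, (dist x y ^ d)⁻¹ := by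
  have hpairs : (∑ x ∈ ω, ∑ y ∈ ω, (1 : ℝ)) ≤
      D ^ d * (∑ x ∈ ω, ∑ y ∈ ω, (dist x y ^ d)⁻¹) + ω.card * (1 : ℝ) := by
    rw [Finset.mul_sum, ← Finset.sum_sum_ite_eq_const, ← Finset.sum_add_distrib]
    refine Finset.sum_le_sum fun x hx => ?_
    have hD0 : 0 ≤ D := dist_nonneg.trans (hD x hx x hx)
    rw [Finset.mul_sum, ← Finset.sum_add_distrib]
    refine Finset.sum_le_sum fun y hy => ?_
    split_ifs with hxy
    · have : 0 ≤ D ^ d * (dist x y ^ d)⁻¹ := by positivity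
      linarith
    · have hpos : 0 < dist x y := dist_pos.2 hxy
      rw [add_zero, ← div_eq_mul_inv, one_le_div (by positivity)]
      gcongr
      exact hD x hx y hy
  simp only [Finset.sum_const, nsmul_eq_mul, mul_one] at hpairs
  have hN' : (2 : ℝ) ≤ ω.card := by exact_mod_cast hN
  nlinarith

lemma exists_pos_mul_sq_mul_log_le_sum {d : ℕ} (hd : 1 ≤ d)
    {A : Set (EuclideanSpace ℝ (Fin d))} (hA : Bornology.IsBounded A) :
    ∃ C : ℝ, 0 < C ∧ ∀ ω : Finset (EuclideanSpace ℝ (Fin d)), ↑ω ⊆ A → 2 ≤ ω.card →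
      C * (ω.card : ℝ) ^ 2 * Real.log ω.card ≤ ∑ x ∈ ω, ∑ y ∈ ω, (dist x y ^ d)⁻¹ := by
  obtain ⟨r, hr⟩ := hA.exists_norm_le
  obtain ⟨R, hRr⟩ := exists_nat_ge (max r 1)
  have hR : 1 ≤ R := by exact_mod_cast (le_max_right r 1).trans hRr
  have hRA : ∀ x ∈ A, ‖x‖ ≤ R := fun x hx => (hr x hx).trans ((le_max_left r 1).trans hRr)
  set K : ℝ := (3 * R : ℝ) ^ d with hKdef
  have hRpos : (1 : ℝ) ≤ R := by exact_mod_cast hR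
  have hK : 1 ≤ K := one_le_pow₀ (by linarith)
  have hlogK : 0 < Real.log (2 * K) := Real.log_pos (by linarith)
  have hlog2 : 0 < Real.log 2 := Real.log_pos one_lt_two
  set M : ℝ := Real.log (2 * K) * (2 * (2 * R : ℝ) ^ d) +
    d * Real.log 2 * (4 * K * (d : ℝ) ^ d) with hMdef
  have hM : 0 < M := by positivity
  refine ⟨M⁻¹, by positivity, fun ω hω hN => ?_⟩
  have hex : ∃ k : ℕ, (ω.card : ℝ) < 2 * K * ((2 : ℝ) ^ d) ^ k := by
    obtain ⟨k, hk⟩ := pow_unbounded_of_one_lt (ω.card : ℝ)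
      (one_lt_pow₀ one_lt_two (by omega) : (1 : ℝ) < 2 ^ d)
    have : 0 ≤ ((2 : ℝ) ^ d) ^ k := by positivity
    exact ⟨k, by nlinarith⟩
  set S := ∑ x ∈ ω, ∑ y ∈ ω, (dist x y ^ d)⁻¹ with hS
  set L := Nat.find hex
  have hscales : L * (ω.card : ℝ) ^ 2 ≤ 4 * K * (d : ℝ) ^ d * S :=
    sq_mul_le_sum_inv_dist_pow hd hR ω
      (fun x hx i => (PiLp.norm_apply_le x i).trans (hRA x (hω hx))) L
      fun k hk => not_lt.1 (Nat.find_min hex hk)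
  have hdiam : (ω.card : ℝ) ^ 2 ≤ 2 * (2 * R : ℝ) ^ d * S :=
    sq_le_sum_inv_dist_pow d ω (fun x hx y hy => (dist_le_norm_add_norm x y).trans (by
      linarith [hRA x (hω hx), hRA y (hω hy)])) hN
  have hlog : Real.log ω.card ≤ Real.log (2 * K) + L * (d * Real.log 2) := by
    have h := Real.log_le_log (by positivity) (Nat.find_spec hex).le
    rwa [Real.log_mul (by positivity) (by positivity), Real.log_pow, Real.log_pow] at h
  rw [mul_assoc, inv_mul_le_iff₀ hM]
  calc (ω.card : ℝ) ^ 2 * Real.log ω.card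
      ≤ (ω.card : ℝ) ^ 2 * (Real.log (2 * K) + L * (d * Real.log 2)) := by gcongr
    _ = Real.log (2 * K) * (ω.card : ℝ) ^ 2 +
        d * Real.log 2 * (L * (ω.card : ℝ) ^ 2) := by ring
    _ ≤ Real.log (2 * K) * (2 * (2 * R : ℝ) ^ d * S) +
        d * Real.log 2 * (4 * K * (d : ℝ) ^ d * S) := by gcongr
    _ = M * S := by rw [hMdef]; ring

lemma card_filter_forall_abs_sub_lt_le {d : ℕ} (B : Finset (Fin d → ℤ)) (u : Fin d → ℤ) (n : ℕ) :
    (B.filter fun v => ∀ i, |u i - v i| < n).card ≤ (2 * n) ^ d := by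
  calc (B.filter fun v => ∀ i, |u i - v i| < n).card
      ≤ (Fintype.piFinset fun i => Finset.Ioo (u i - n) (u i + n)).card := by
        refine Finset.card_le_card fun v hv => ?_
        simp only [Fintype.mem_piFinset, Finset.mem_Ioo]
        intro i
        have hi := abs_lt.1 ((Finset.mem_filter.1 hv).2 i)
        constructor <;> linarith
    _ ≤ (2 * n) ^ d := by
        rw [Fintype.card_piFinset]
        refine (Finset.prod_le_pow_card _ _ (2 * n) fun i _ => ?_).trans (by simp)
        rw [Int.card_Ioo]
        omega

lemma sum_inv_dist_pow_le_of_separated {d m : ℕ} {h : ℝ} (hd : 1 ≤ d) (hh : 0 < h)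
    {E : Type*} [MetricSpace E] (g : (Fin d → ℤ) → E)
    (hg : ∀ u v i, h * |((u i - v i : ℤ) : ℝ)| ≤ dist (g u) (g v)) {u : Fin d → ℤ}
    (hu : u ∈ Fintype.piFinset fun _ : Fin d => Finset.Ico (0 : ℤ) (2 ^ m)) :
    ∑ v ∈ Fintype.piFinset (fun _ : Fin d => Finset.Ico (0 : ℤ) (2 ^ m)),
      (dist (g u) (g v) ^ d)⁻¹ ≤ m * (4 / h) ^ d := by
  set B := Fintype.piFinset fun _ : Fin d => Finset.Ico (0 : ℤ) (2 ^ m)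
  have hpoint : ∀ v ∈ B, (dist (g u) (g v) ^ d)⁻¹ ≤ ∑ j ∈ Finset.range m,
      if ∀ i, |u i - v i| < (2 ^ (j + 1) : ℕ) then ((2 ^ j * h) ^ d)⁻¹ else 0 := by
    intro v hv
    by_cases huv : u = v
    · subst huv
      rw [dist_self, zero_pow (by omega), inv_zero]
      exact Finset.sum_nonneg fun j _ => by positivity
    have hm : ∀ i, |u i - v i| < (2 ^ m : ℕ) := by
      intro i
      have h1 := Finset.mem_Ico.1 (Fintype.mem_piFinset.1 hu i)
      have h2 := Finset.mem_Ico.1 (Fintype.mem_piFinset.1 hv i)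
      push_cast
      rw [abs_lt]
      constructor <;> linarith
    have hex : ∃ j : ℕ, ∀ i, |u i - v i| < (2 ^ j : ℕ) := ⟨m, hm⟩
    have hle : Nat.find hex ≤ m := Nat.find_min' hex hm
    have hspec := Nat.find_spec hex
    have hmin := fun {j} => Nat.find_min hex (m := j)
    rcases hj : Nat.find hex with _ | j
    · refine absurd (funext fun i => ?_) huv
      have hi := hspec i
      rw [hj] at hi
      have := abs_lt.1 hi
      simp at this
      omega
    rw [hj] at hle hspec
    have hfail := hmin (j := j) (by omega)
    push Not at hfail
    obtain ⟨i, hi⟩ := hfail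
    have hterm : (dist (g u) (g v) ^ d)⁻¹ ≤
        if ∀ i, |u i - v i| < (2 ^ (j + 1) : ℕ) then ((2 ^ j * h) ^ d)⁻¹ else 0 := by
      rw [if_pos hspec]
      gcongr
      refine le_trans ?_ (hg u v i)
      have : (2 : ℝ) ^ j ≤ |((u i - v i : ℤ) : ℝ)| := by exact_mod_cast hi
      nlinarith
    refine hterm.trans (Finset.single_le_sum (f := fun j =>
      if ∀ i, |u i - v i| < (2 ^ (j + 1) : ℕ) then ((2 ^ j * h) ^ d)⁻¹ else 0)
      (fun j _ => ?_) (Finset.mem_range.2 (by omega)))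
    positivity
  refine (Finset.sum_le_sum hpoint).trans ?_
  rw [Finset.sum_comm]
  refine (Finset.sum_le_card_nsmul _ _ ((4 / h) ^ d) fun j _ => ?_).trans (by simp)
  rw [← Finset.sum_filter, Finset.sum_const, nsmul_eq_mul]
  calc ((B.filter fun v => ∀ i, |u i - v i| < (2 ^ (j + 1) : ℕ)).card : ℝ) * ((2 ^ j * h) ^ d)⁻¹
      ≤ ((2 * 2 ^ (j + 1)) ^ d : ℕ) * ((2 ^ j * h) ^ d)⁻¹ := by
        gcongr
        exact card_filter_forall_abs_sub_lt_le B u _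
    _ = (4 / h) ^ d := by
        push_cast
        rw [← div_eq_mul_inv, ← div_pow]
        congr 1
        field_simp
        ring

lemma exists_finset_closedBall_sum_le {d : ℕ} (hd : 1 ≤ d) (p : EuclideanSpace ℝ (Fin d)) {r : ℝ}
    (hr : 0 < r) (m N : ℕ) (hN : N ≤ (2 ^ m) ^ d) :
    ∃ ω : Finset (EuclideanSpace ℝ (Fin d)), ↑ω ⊆ closedBall p r ∧ ω.card = N ∧
      ∑ x ∈ ω, ∑ y ∈ ω, (dist x y ^ d)⁻¹ ≤ N * (m * (4 * d * 2 ^ m / r) ^ d) := by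
  have hd0 : (0 : ℝ) < d := by exact_mod_cast hd
  set h : ℝ := r / (d * 2 ^ m) with hh
  have hpos : 0 < h := by positivity
  let g : (Fin d → ℤ) → EuclideanSpace ℝ (Fin d) := fun u => p + WithLp.toLp 2 fun i => h * u i
  have hcoord (u v : Fin d → ℤ) (i : Fin d) : g u i - g v i = h * ((u i - v i : ℤ) : ℝ) := by
    simp [g]
    ring
  have hg (u v : Fin d → ℤ) (i : Fin d) : h * |((u i - v i : ℤ) : ℝ)| ≤ dist (g u) (g v) := by
    have := EuclideanSpace.abs_sub_apply_le_dist (g u) (g v) i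
    rwa [hcoord, abs_mul, abs_of_pos hpos] at this
  have hinj : Function.Injective g := by
    intro u v huv
    funext i
    have hi := hg u v i
    rw [huv, dist_self] at hi
    have : |((u i - v i : ℤ) : ℝ)| = 0 := by
      nlinarith [abs_nonneg ((u i - v i : ℤ) : ℝ)]
    have h0 := abs_eq_zero.1 this
    norm_cast at h0
    omega
  set B := Fintype.piFinset fun _ : Fin d => Finset.Ico (0 : ℤ) (2 ^ m)
  have hB : B.card = (2 ^ m) ^ d := by
    rw [Fintype.card_piFinset_const, Int.card_Ico, sub_zero]
    congr 1
  obtain ⟨U, hUB, hU⟩ := Finset.exists_subset_card_eq (hN.trans hB.ge)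
  refine ⟨U.map ⟨g, hinj⟩, ?_, by rw [Finset.card_map, hU], ?_⟩
  · intro x hx
    obtain ⟨u, hu, rfl⟩ := Finset.mem_map.1 (Finset.mem_coe.1 hx)
    rw [mem_closedBall]
    calc dist (g u) p ≤ d * (h * 2 ^ m) := by
          refine EuclideanSpace.dist_le_card_mul (by positivity) fun i => ?_
          have hi := Finset.mem_Ico.1 (Fintype.mem_piFinset.1 (hUB hu) i)
          have h0 : (0 : ℝ) ≤ u i := by exact_mod_cast hi.1
          have h1 : (u i : ℝ) ≤ 2 ^ m := by exact_mod_cast hi.2.le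
          simp only [g, PiLp.add_apply, add_sub_cancel_left]
          rw [abs_of_nonneg (by positivity)]
          gcongr
      _ = r := by
          rw [hh]
          field_simp
  · simp only [Finset.sum_map, Function.Embedding.coeFn_mk]
    rw [← hU, ← nsmul_eq_mul]
    refine Finset.sum_le_card_nsmul _ _ _ fun u hu => ?_
    calc ∑ v ∈ U, (dist (g u) (g v) ^ d)⁻¹ ≤ ∑ v ∈ B, (dist (g u) (g v) ^ d)⁻¹ :=
          Finset.sum_le_sum_of_subset_of_nonneg hUB fun v _ _ => by positivity
      _ ≤ m * (4 / h) ^ d := sum_inv_dist_pow_le_of_separated hd hpos g hg (hUB hu)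
      _ = m * (4 * d * 2 ^ m / r) ^ d := by
          congr 2
          rw [hh]
          field_simp

lemma exists_pos_forall_exists_sum_le_mul_sq_mul_log {d : ℕ} (hd : 1 ≤ d)
    {A : Set (EuclideanSpace ℝ (Fin d))} (hint : (interior A).Nonempty) :
    ∃ C : ℝ, 0 < C ∧ ∀ N : ℕ, 2 ≤ N → ∃ ω : Finset (EuclideanSpace ℝ (Fin d)), ↑ω ⊆ A ∧
      ω.card = N ∧
      ∑ x ∈ ω, ∑ y ∈ ω, (dist x y ^ d)⁻¹ ≤ C * (N : ℝ) ^ 2 * Real.log N := by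
  obtain ⟨p, hp⟩ := hint
  obtain ⟨r, hr, hball⟩ := Metric.nhds_basis_closedBall.mem_iff.1 (mem_interior_iff_mem_nhds.1 hp)
  have hd0 : (0 : ℝ) < d := by exact_mod_cast hd
  have hlog2 : 0 < Real.log 2 := Real.log_pos one_lt_two
  refine ⟨2 / Real.log 2 * (8 * d / r) ^ d, by positivity, fun N hN => ?_⟩
  have hex : ∃ m : ℕ, N ≤ (2 ^ m) ^ d :=
    ⟨N, Nat.lt_two_pow_self.le.trans (Nat.le_self_pow (by omega) _)⟩
  obtain ⟨m, hm⟩ : ∃ m, Nat.find hex = m + 1 := by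
    refine Nat.exists_eq_succ_of_ne_zero fun h0 => ?_
    have := Nat.find_spec hex
    rw [h0] at this
    simp at this
    omega
  have hlt : (2 ^ m) ^ d < N := not_le.1 (Nat.find_min hex (by omega))
  obtain ⟨ω, hω, hcard, hsum⟩ := exists_finset_closedBall_sum_le hd p hr (m + 1) N
    (hm ▸ Nat.find_spec hex)
  refine ⟨ω, hω.trans hball, hcard, hsum.trans ?_⟩
  have hNpos : (0 : ℝ) < N := by positivity
  have hltR : ((2 : ℝ) ^ m) ^ d ≤ N := by exact_mod_cast hlt.le
  have hlog : ((m + 1 : ℕ) : ℝ) ≤ 2 / Real.log 2 * Real.log N := by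
    have h2m : (2 : ℝ) ^ m ≤ N :=
      (le_self_pow₀ (one_le_pow₀ one_le_two) (by omega)).trans hltR
    have h1 := Real.log_le_log (by positivity) h2m
    have h2 := Real.log_le_log two_pos (by exact_mod_cast hN : (2 : ℝ) ≤ N)
    rw [Real.log_pow] at h1
    rw [div_mul_eq_mul_div, le_div_iff₀ hlog2]
    push_cast
    linarith
  calc (N : ℝ) * ((m + 1 : ℕ) * (4 * d * 2 ^ (m + 1) / r) ^ d)
      = N * ((m + 1 : ℕ) * ((8 * d / r) ^ d * ((2 : ℝ) ^ m) ^ d)) := by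
        rw [← mul_pow]
        congr 3
        ring
    _ ≤ N * (2 / Real.log 2 * Real.log N * ((8 * d / r) ^ d * N)) := by gcongr
    _ = 2 / Real.log 2 * (8 * d / r) ^ d * (N : ℝ) ^ 2 * Real.log N := by ring

/-- for bounded `A ⊆ ℝ^d` with nonempty interior, the minimal `d`-energy grows
like `N² log N`. -/
theorem minRieszEnergy_growth_crit (d : ℕ) (hd : 1 ≤ d)
    (A : Set (EuclideanSpace ℝ (Fin d))) (hA : Bornology.IsBounded A)
    (hint : (interior A).Nonempty) :
    ∃ C₀ C₁ : ℝ, 0 < C₀ ∧ 0 < C₁ ∧ ∀ N : ℕ, 2 ≤ N →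
      ENNReal.ofReal (C₀ * (N : ℝ) ^ 2 * Real.log N) ≤ minRieszEnergy (d : ℝ) A N ∧
      minRieszEnergy (d : ℝ) A N ≤ ENNReal.ofReal (C₁ * (N : ℝ) ^ 2 * Real.log N) := by
  obtain ⟨C₀, hC₀, hlower⟩ := exists_pos_mul_sq_mul_log_le_sum hd hA
  obtain ⟨C₁, hC₁, hupper⟩ := exists_pos_forall_exists_sum_le_mul_sq_mul_log hd hint
  refine ⟨C₀, C₁, hC₀, hC₁, fun N hN => ⟨?_, ?_⟩⟩
  · refine le_iInf fun ω => le_iInf fun hω => le_iInf fun hcard => ?_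
    rw [rieszEnergy_natCast_eq_ofReal hd, ← hcard]
    exact ENNReal.ofReal_le_ofReal (hlower ω hω (hcard ▸ hN))
  · obtain ⟨ω, hω, hcard, hsum⟩ := hupper N hN
    refine (iInf_le_of_le ω (iInf_le_of_le hω (iInf_le _ hcard))).trans ?_
    rw [rieszEnergy_natCast_eq_ofReal hd]
    exact ENNReal.ofReal_le_ofReal hsum
end

section
/- Fix an integer d ≥ 1 and let U^d = [0,1]^d be the unit cube in ℝ^d. Then lim_{N→∞} ℰ_d(U^d,N)/(N² log N) = H_d(B^d) = 2π^{d/2}/(d·Γ(d/2)), where B^d is the closed unit ball of ℝ^d and Γ is the Gamma function. -/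
open scoped ENNReal NNReal BigOperators Classical
open MeasureTheory Filter Metric Set Topology

lemma exp_neg_mul_norm_sub_sq_mul {V : Type*} [NormedAddCommGroup V]
    [InnerProductSpace ℝ V] (t : ℝ) (x y z : V) :
    Real.exp (-(2 * t) * ‖z - x‖ ^ 2) * Real.exp (-(2 * t) * ‖z - y‖ ^ 2) =
      Real.exp (-t * ‖x - y‖ ^ 2) * Real.exp (-(4 * t) * ‖z - (2⁻¹ : ℝ) • (x + y)‖ ^ 2) := by
  rw [← Real.exp_add, ← Real.exp_add]
  congr 1
  have h := parallelogram_law_with_norm ℝ (z - x) (z - y)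
  have h1 : (z - x) + (z - y) = (2 : ℝ) • (z - (2⁻¹ : ℝ) • (x + y)) := by
    module
  have h2 : (z - x) - (z - y) = -(x - y) := by abel
  rw [h1, h2, norm_neg, norm_smul] at h
  rw [mul_pow, Real.norm_ofNat] at h
  linear_combination t * h

section GaussianKernel

variable {V : Type*} [NormedAddCommGroup V] [InnerProductSpace ℝ V] [FiniteDimensional ℝ V]
  [MeasurableSpace V] [BorelSpace V]

lemma integral_exp_neg_mul_norm_sub_sq {b : ℝ} (hb : 0 < b) (x : V) :
    ∫ z : V, Real.exp (-b * ‖z - x‖ ^ 2) = (Real.pi / b) ^ ((Module.finrank ℝ V : ℝ) / 2) := by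
  rw [integral_sub_right_eq_self (fun z : V => Real.exp (-b * ‖z‖ ^ 2)) x]
  exact GaussianFourier.integral_rexp_neg_mul_sq_norm hb

lemma integrable_exp_neg_mul_norm_sub_sq {b : ℝ} (hb : 0 < b) (x : V) :
    Integrable fun z : V => Real.exp (-b * ‖z - x‖ ^ 2) := by
  apply Integrable.of_integral_ne_zero
  rw [integral_exp_neg_mul_norm_sub_sq hb x]
  have := Real.pi_pos
  positivity

/-- A Gaussian centred at a point well inside `W` has almost all of its mass in `W`. -/
lemma le_setIntegral_exp_neg_mul_norm_sub_sq {t δ : ℝ} (ht : 0 < t) (hδ : 0 ≤ δ) {W : Set V}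
    (hW : MeasurableSet W) {x : V} (hx : Metric.closedBall x δ ⊆ W) :
    (1 - 2 ^ ((Module.finrank ℝ V : ℝ) / 2) * Real.exp (-t * δ ^ 2)) *
        (Real.pi / (2 * t)) ^ ((Module.finrank ℝ V : ℝ) / 2) ≤
      ∫ z in W, Real.exp (-(2 * t) * ‖z - x‖ ^ 2) := by
  set a := (Module.finrank ℝ V : ℝ) / 2
  have hi := integrable_exp_neg_mul_norm_sub_sq (V := V) (b := 2 * t) (by positivity) x
  have hi' := integrable_exp_neg_mul_norm_sub_sq (V := V) ht x
  have h1 := integral_add_compl hW hi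
  rw [integral_exp_neg_mul_norm_sub_sq (by positivity)] at h1
  change _ = (Real.pi / (2 * t)) ^ a at h1
  have h2 : ∫ z in Wᶜ, Real.exp (-(2 * t) * ‖z - x‖ ^ 2) ≤
      ∫ z in Wᶜ, Real.exp (-t * δ ^ 2) * Real.exp (-t * ‖z - x‖ ^ 2) := by
    refine setIntegral_mono_on hi.integrableOn (hi'.const_mul _).integrableOn hW.compl ?_
    intro z hz
    rw [← Real.exp_add]
    apply Real.exp_le_exp.2
    have hz' : δ < ‖z - x‖ := by
      by_contra! hcon
      exact hz (hx (by rwa [Metric.mem_closedBall, dist_eq_norm]))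
    have : δ ^ 2 ≤ ‖z - x‖ ^ 2 := by gcongr
    nlinarith
  have h3 : ∫ z in Wᶜ, Real.exp (-t * δ ^ 2) * Real.exp (-t * ‖z - x‖ ^ 2) ≤
      Real.exp (-t * δ ^ 2) * (Real.pi / t) ^ a := by
    rw [← integral_exp_neg_mul_norm_sub_sq ht x, ← integral_const_mul]
    exact setIntegral_le_integral (hi'.const_mul _) (Eventually.of_forall fun z => by positivity)
  have h4 : (Real.pi / t) ^ a = 2 ^ a * (Real.pi / (2 * t)) ^ a := by
    rw [← Real.mul_rpow (by positivity) (by have := Real.pi_pos; positivity)]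
    congr 1
    field_simp
  rw [h4] at h3
  linarith

/-- Positive definiteness of the Gaussian, in quantitative form. -/
lemma card_sq_mul_le_sum_exp_neg_mul_norm_sub_sq {t κ : ℝ} (ht : 0 < t) {W : Set V}
    (hWf : volume W ≠ ⊤) (ω : Finset V)
    (hκ : ∀ x ∈ ω, κ * (Real.pi / (2 * t)) ^ ((Module.finrank ℝ V : ℝ) / 2) ≤
      ∫ z in W, Real.exp (-(2 * t) * ‖z - x‖ ^ 2)) :
    (ω.card : ℝ) ^ 2 * (Real.pi / t) ^ ((Module.finrank ℝ V : ℝ) / 2) *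
        (2 * κ - volume.real W) ≤
      ∑ x ∈ ω, ∑ y ∈ ω, Real.exp (-t * ‖x - y‖ ^ 2) := by
  set a := (Module.finrank ℝ V : ℝ) / 2 with ha
  have hpi := Real.pi_pos
  set q := (Real.pi / (2 * t)) ^ a with hq
  set c : ℝ := ω.card * q with hc
  have hq0 : 0 < q := by positivity
  have hc0 : 0 ≤ c := by positivity
  have hi (x : V) := integrable_exp_neg_mul_norm_sub_sq (V := V) (b := 2 * t) (by positivity) x
  set φ : V → ℝ := fun z => ∑ x ∈ ω, Real.exp (-(2 * t) * ‖z - x‖ ^ 2) with hφ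
  have hφi : Integrable φ := integrable_finsetSum _ fun x _ => hi x
  have hsq : ∀ z, φ z ^ 2 = ∑ x ∈ ω, ∑ y ∈ ω, Real.exp (-t * ‖x - y‖ ^ 2) *
      Real.exp (-(4 * t) * ‖z - (2⁻¹ : ℝ) • (x + y)‖ ^ 2) := by
    intro z
    simp only [hφ, sq (∑ x ∈ ω, _), Finset.sum_mul_sum, exp_neg_mul_norm_sub_sq_mul]
  have hi4 (x y : V) : Integrable fun z => Real.exp (-t * ‖x - y‖ ^ 2) *
      Real.exp (-(4 * t) * ‖z - (2⁻¹ : ℝ) • (x + y)‖ ^ 2) :=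
    (integrable_exp_neg_mul_norm_sub_sq (by positivity) _).const_mul _
  have hφ2i : Integrable fun z => φ z ^ 2 := by
    simp only [hsq]
    exact integrable_finsetSum _ fun x _ => integrable_finsetSum _ fun y _ => hi4 x y
  have hint : ∫ z, φ z ^ 2 =
      (∑ x ∈ ω, ∑ y ∈ ω, Real.exp (-t * ‖x - y‖ ^ 2)) * (Real.pi / (4 * t)) ^ a := by
    simp only [hsq]
    rw [integral_finsetSum _ fun x _ => integrable_finsetSum _ fun y _ => hi4 x y,
      Finset.sum_mul]
    refine Finset.sum_congr rfl fun x _ => ?_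
    rw [integral_finsetSum _ fun y _ => hi4 x y, Finset.sum_mul]
    refine Finset.sum_congr rfl fun y _ => ?_
    rw [integral_const_mul, integral_exp_neg_mul_norm_sub_sq (by positivity)]
  have hconst : IntegrableOn (fun _ : V => c ^ 2) W := integrableOn_const hWf
  have hlow : ∫ z in W, (2 * c * φ z - c ^ 2) ≤ ∫ z, φ z ^ 2 := by
    refine le_trans (b := ∫ z in W, φ z ^ 2) ?_
      (setIntegral_le_integral (s := W) hφ2i (Eventually.of_forall fun z => sq_nonneg _))
    refine integral_mono ((hφi.integrableOn.const_mul _).sub hconst) hφ2i.integrableOn ?_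
    intro z
    have := sq_nonneg (φ z - c)
    simp only
    nlinarith
  rw [integral_sub (hφi.integrableOn.const_mul _) hconst, integral_const_mul, setIntegral_const,
    integral_finsetSum _ fun x _ => (hi x).integrableOn, smul_eq_mul] at hlow
  have hsum : c * κ ≤ ∑ x ∈ ω, ∫ z in W, Real.exp (-(2 * t) * ‖z - x‖ ^ 2) := by
    have := Finset.card_nsmul_le_sum ω _ _ hκ
    rw [nsmul_eq_mul] at this
    rw [hc]; linarith
  have hq2 : q * q = (Real.pi / t) ^ a * (Real.pi / (4 * t)) ^ a := by
    rw [hq, ← Real.mul_rpow (by positivity) (by positivity),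
      ← Real.mul_rpow (by positivity) (by positivity)]
    congr 1
    field_simp
    norm_num
  have hp : 0 < (Real.pi / (4 * t)) ^ a := by positivity
  refine le_of_mul_le_mul_right ?_ hp
  rw [← hint]
  refine le_trans ?_ hlow
  have h5 := mul_le_mul_of_nonneg_left hsum (show 0 ≤ 2 * c by positivity)
  have h6 : c ^ 2 = (ω.card : ℝ) ^ 2 * ((Real.pi / t) ^ a * (Real.pi / (4 * t)) ^ a) := by
    rw [← hq2, hc]; ring
  calc _ = c ^ 2 * (2 * κ - volume.real W) := by rw [h6]; ring
    _ ≤ _ := by linarith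

end GaussianKernel

lemma integral_rpow_mul_exp_neg_mul_sq {a r : ℝ} (ha : 0 < a) (hr : 0 < r) :
    ∫ t in Ioi (0 : ℝ), t ^ (a - 1) * Real.exp (-t * r ^ 2) =
      Real.Gamma a * r ^ (-(2 * a)) := by
  have h := Real.integral_rpow_mul_exp_neg_mul_Ioi ha (pow_pos hr 2)
  have h1 : (1 / r ^ 2) ^ a = r ^ (-(2 * a)) := by
    rw [one_div, Real.inv_rpow (by positivity), Real.rpow_neg hr.le, Real.rpow_mul hr.le,
      Real.rpow_two]
  rw [h1, mul_comm] at h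
  rw [← h]
  congr 1
  ext t
  ring_nf

lemma integrableOn_rpow_sub_one_mul_exp_neg_mul_sq {a r : ℝ} (ha : 0 < a) (hr : 0 < r) :
    IntegrableOn (fun t : ℝ => t ^ (a - 1) * Real.exp (-t * r ^ 2)) (Ioi 0) := by
  apply Integrable.of_integral_ne_zero
  rw [integral_rpow_mul_exp_neg_mul_sq ha hr]
  have := Real.Gamma_pos_of_pos ha
  positivity

lemma rieszEnergy_eq_ofReal_s17 {E : Type*} [MetricSpace E] (s : ℝ) (ω : Finset E) :
    rieszEnergy s ω =
      ENNReal.ofReal (∑ x ∈ ω, ∑ y ∈ ω, if x = y then 0 else dist x y ^ (-s)) := by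
  have h0 (x y : E) : 0 ≤ (if x = y then 0 else dist x y ^ (-s) : ℝ) := by
    split_ifs <;> positivity
  rw [rieszEnergy, ENNReal.ofReal_sum_of_nonneg fun x _ => Finset.sum_nonneg fun y _ => h0 x y]
  refine Finset.sum_congr rfl fun x _ => ?_
  rw [ENNReal.ofReal_sum_of_nonneg fun y _ => h0 x y]
  refine Finset.sum_congr rfl fun y _ => ?_
  split_ifs with h
  · simp
  · rw [edist_dist, ENNReal.ofReal_rpow_of_pos (dist_pos.2 h)]

/-- A lower bound for the Riesz energy, obtained by writing the Riesz kernel as a mixture of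
Gaussians. -/
lemma le_Gamma_mul_sum_dist_rpow {E : Type*} [MetricSpace E] {a t₀ T A : ℝ} (ha : 0 < a)
    (ht₀ : 0 < t₀) (hT : t₀ ≤ T) (ω : Finset E)
    (hA : ∀ t, t₀ ≤ t →
      A * (Real.pi / t) ^ a ≤ ∑ x ∈ ω, ∑ y ∈ ω, Real.exp (-t * dist x y ^ 2)) :
    A * Real.pi ^ a * (Real.log T - Real.log t₀) - ω.card * (T ^ a / a) ≤
      Real.Gamma a * ∑ x ∈ ω, ∑ y ∈ ω, if x = y then 0 else dist x y ^ (-(2 * a)) := by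
  have hTpos : 0 < T := ht₀.trans_le hT
  set f : E → E → ℝ → ℝ := fun x y t =>
    if x = y then 0 else t ^ (a - 1) * Real.exp (-t * dist x y ^ 2) with hf
  have hfi (x y : E) : IntegrableOn (f x y) (Ioi 0) := by
    by_cases h : x = y
    · simp [hf, h]
    · simpa [hf, h] using integrableOn_rpow_sub_one_mul_exp_neg_mul_sq ha (dist_pos.2 h)
  have hfint (x y : E) : ∫ t in Ioi 0, f x y t =
      Real.Gamma a * (if x = y then 0 else dist x y ^ (-(2 * a))) := by
    by_cases h : x = y
    · simp [hf, h]
    · simpa [hf, h] using integral_rpow_mul_exp_neg_mul_sq ha (dist_pos.2 h)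
  have hFi : IntegrableOn (fun t => ∑ x ∈ ω, ∑ y ∈ ω, f x y t) (Ioi 0) :=
    integrable_finsetSum _ fun x _ => integrable_finsetSum _ fun y _ => hfi x y
  have hFint : Real.Gamma a * ∑ x ∈ ω, ∑ y ∈ ω, (if x = y then 0 else dist x y ^ (-(2 * a))) =
      ∫ t in Ioi 0, ∑ x ∈ ω, ∑ y ∈ ω, f x y t := by
    rw [integral_finsetSum _ fun x _ => integrable_finsetSum _ fun y _ => hfi x y, Finset.mul_sum]
    refine Finset.sum_congr rfl fun x _ => ?_
    rw [integral_finsetSum _ fun y _ => hfi x y, Finset.mul_sum]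
    exact Finset.sum_congr rfl fun y _ => (hfint x y).symm
  have hsub : Ioc t₀ T ⊆ Ioi 0 := fun t ht => ht₀.trans ht.1
  have hi1 : IntervalIntegrable (fun t : ℝ => A * Real.pi ^ a * t⁻¹) volume t₀ T := by
    refine (intervalIntegral.intervalIntegrable_inv (fun t ht => ?_) continuousOn_id).const_mul _
    rw [uIcc_of_le hT] at ht
    exact (ht₀.trans_le ht.1).ne'
  have hi2 : IntervalIntegrable (fun t : ℝ => (ω.card : ℝ) * t ^ (a - 1)) volume t₀ T :=
    (intervalIntegral.intervalIntegrable_rpow' (by linarith)).const_mul _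
  have hlow : ∫ t in t₀..T, (A * Real.pi ^ a * t⁻¹ - ω.card * t ^ (a - 1)) ≤
      ∫ t in Ioi 0, ∑ x ∈ ω, ∑ y ∈ ω, f x y t := by
    rw [intervalIntegral.integral_of_le hT]
    refine le_trans (b := ∫ t in Ioc t₀ T, ∑ x ∈ ω, ∑ y ∈ ω, f x y t) ?_ ?_
    · refine setIntegral_mono_on ((intervalIntegrable_iff_integrableOn_Ioc_of_le hT).1
        (hi1.sub hi2)) (hFi.mono_set hsub) measurableSet_Ioc ?_
      intro t ht
      have htpos : 0 < t := hsub ht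
      have h1 : ∑ x ∈ ω, ∑ y ∈ ω, f x y t =
          t ^ (a - 1) * (∑ x ∈ ω, ∑ y ∈ ω, Real.exp (-t * dist x y ^ 2) - ω.card) := by
        have h2 : ∀ x ∈ ω, ∑ y ∈ ω, f x y t =
            t ^ (a - 1) * (∑ y ∈ ω, Real.exp (-t * dist x y ^ 2) - 1) := by
          intro x hx
          rw [← Finset.add_sum_erase ω _ hx, ← Finset.add_sum_erase ω
            (fun y => Real.exp (-t * dist x y ^ 2)) hx]
          simp only [hf, if_true, dist_self, zero_add]
          norm_num
          rw [Finset.mul_sum]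
          refine Finset.sum_congr rfl fun y hy => ?_
          rw [if_neg (Finset.ne_of_mem_erase hy).symm]
        rw [Finset.sum_congr rfl h2, ← Finset.mul_sum, Finset.sum_sub_distrib]
        simp
      rw [h1]
      have h3 := hA t ht.1.le
      have h4 : A * Real.pi ^ a * t⁻¹ = t ^ (a - 1) * (A * (Real.pi / t) ^ a) := by
        rw [Real.div_rpow Real.pi_pos.le htpos.le, Real.rpow_sub_one htpos.ne']
        have : 0 < t ^ a := by positivity
        field_simp
      have h5 : 0 < t ^ (a - 1) := by positivity
      rw [h4]
      nlinarith
    · refine setIntegral_mono_set hFi ?_ (Eventually.of_forall hsub)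
      refine (ae_restrict_iff' measurableSet_Ioi).2 (Eventually.of_forall fun t ht => ?_)
      have ht' : (0 : ℝ) < t := ht
      refine Finset.sum_nonneg fun x _ => Finset.sum_nonneg fun y _ => ?_
      simp only [hf]
      split_ifs <;> positivity
  rw [hFint]
  refine le_trans ?_ hlow
  rw [intervalIntegral.integral_sub hi1 hi2, intervalIntegral.integral_const_mul,
    intervalIntegral.integral_const_mul, integral_inv_of_pos ht₀ hTpos,
    integral_rpow (Or.inl (by linarith)), Real.log_div hTpos.ne' ht₀.ne']
  have h6 : (T ^ (a - 1 + 1) - t₀ ^ (a - 1 + 1)) / (a - 1 + 1) ≤ T ^ a / a := by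
    simp only [sub_add_cancel]
    gcongr
    have : 0 < t₀ ^ a := by positivity
    linarith
  gcongr

/-- An upper bound for the integral of `t ^ (a - 1)` against a function controlled separately
near zero, in an intermediate range, and near infinity. -/
lemma integral_rpow_mul_le {a ε τ M B C : ℝ} {g : ℝ → ℝ} (ha : 0 < a) (hε : 0 < ε) (hτ : ε ≤ τ)
    (hg : IntegrableOn (fun t => t ^ (a - 1) * g t) (Ioi 0))
    (h₁ : ∀ t, 0 < t → g t ≤ M) (h₂ : ∀ t, 0 < t → t ≤ τ → g t ≤ B * (Real.pi / t) ^ a)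
    (h₃ : ∀ t, τ ≤ t → g t ≤ C * Real.exp (-t * (√2⁻¹) ^ 2)) (hC : 0 ≤ C) :
    ∫ t in Ioi 0, t ^ (a - 1) * g t ≤
      M * (ε ^ a / a) + B * Real.pi ^ a * (Real.log τ - Real.log ε) +
        C * (Real.Gamma a * (√2⁻¹) ^ (-(2 * a))) := by
  have hτ0 : 0 < τ := hε.trans_le hτ
  have hs1 : Ioi (0 : ℝ) = Ioc 0 τ ∪ Ioi τ := (Ioc_union_Ioi_eq_Ioi hτ0.le).symm
  have hs2 : Ioc (0 : ℝ) τ = Ioc 0 ε ∪ Ioc ε τ := (Ioc_union_Ioc_eq_Ioc hε.le hτ).symm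
  have hgτ : IntegrableOn (fun t => t ^ (a - 1) * g t) (Ioc 0 τ) :=
    hg.mono_set Ioc_subset_Ioi_self
  have hg1 : IntegrableOn (fun t => t ^ (a - 1) * g t) (Ioc 0 ε) :=
    hg.mono_set Ioc_subset_Ioi_self
  have hg2 : IntegrableOn (fun t => t ^ (a - 1) * g t) (Ioc ε τ) :=
    hgτ.mono_set (Ioc_subset_Ioc_left hε.le)
  have hg3 : IntegrableOn (fun t => t ^ (a - 1) * g t) (Ioi τ) :=
    hg.mono_set (Ioi_subset_Ioi hτ0.le)
  have hi1 : IntervalIntegrable (fun t : ℝ => M * t ^ (a - 1)) volume 0 ε :=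
    (intervalIntegral.intervalIntegrable_rpow' (by linarith)).const_mul _
  have hi2 : IntervalIntegrable (fun t : ℝ => B * Real.pi ^ a * t⁻¹) volume ε τ := by
    refine (intervalIntegral.intervalIntegrable_inv (fun t ht => ?_) continuousOn_id).const_mul _
    rw [uIcc_of_le hτ] at ht
    exact (hε.trans_le ht.1).ne'
  have hr : (0 : ℝ) < √2⁻¹ := by positivity
  have hi3 := integrableOn_rpow_sub_one_mul_exp_neg_mul_sq ha hr
  rw [hs1, setIntegral_union (Ioc_disjoint_Ioi le_rfl) measurableSet_Ioi hgτ hg3, hs2,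
    setIntegral_union (Ioc_disjoint_Ioc_of_le le_rfl) measurableSet_Ioc hg1 hg2]
  refine add_le_add (add_le_add ?_ ?_) ?_
  · have h : M * (ε ^ a / a) = ∫ t in (0)..ε, M * t ^ (a - 1) := by
      rw [intervalIntegral.integral_const_mul, integral_rpow (Or.inl (by linarith))]
      simp [Real.zero_rpow ha.ne']
    rw [h, intervalIntegral.integral_of_le hε.le]
    refine setIntegral_mono_on hg1
      ((intervalIntegrable_iff_integrableOn_Ioc_of_le hε.le).1 hi1) measurableSet_Ioc ?_
    intro t ht
    rw [mul_comm]
    have := ht.1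
    gcongr
    exact h₁ t ht.1
  · have h : B * Real.pi ^ a * (Real.log τ - Real.log ε) =
        ∫ t in ε..τ, B * Real.pi ^ a * t⁻¹ := by
      rw [intervalIntegral.integral_const_mul, integral_inv_of_pos hε hτ0,
        Real.log_div hτ0.ne' hε.ne']
    rw [h, intervalIntegral.integral_of_le hτ]
    refine setIntegral_mono_on hg2
      ((intervalIntegrable_iff_integrableOn_Ioc_of_le hτ).1 hi2) measurableSet_Ioc ?_
    intro t ht
    have htpos : 0 < t := hε.trans ht.1
    have h4 : B * Real.pi ^ a * t⁻¹ = t ^ (a - 1) * (B * (Real.pi / t) ^ a) := by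
      rw [Real.div_rpow Real.pi_pos.le htpos.le, Real.rpow_sub_one htpos.ne']
      have : 0 < t ^ a := by positivity
      field_simp
    rw [h4]
    gcongr
    exact h₂ t htpos ht.2
  · rw [← integral_rpow_mul_exp_neg_mul_sq ha hr, ← integral_const_mul]
    refine le_trans (b := ∫ t in Ioi τ, C * (t ^ (a - 1) * Real.exp (-t * (√2⁻¹) ^ 2))) ?_ ?_
    · refine setIntegral_mono_on hg3
        (IntegrableOn.mono_set (hi3.const_mul C) (Ioi_subset_Ioi hτ0.le)) measurableSet_Ioi ?_
      intro t ht
      have htpos : 0 < t := hτ0.trans ht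
      have := mul_le_mul_of_nonneg_left (h₃ t (le_of_lt ht))
        (show 0 ≤ t ^ (a - 1) by positivity)
      linarith
    · refine setIntegral_mono_set (hi3.const_mul C) ?_
        (Eventually.of_forall (Ioi_subset_Ioi hτ0.le))
      refine (ae_restrict_iff' measurableSet_Ioi).2 (Eventually.of_forall fun t ht => ?_)
      have ht' : (0 : ℝ) < t := ht
      simp only [Pi.zero_apply]
      positivity

lemma sum_range_exp_neg_mul_succ_sq_le {t : ℝ} (ht : 0 < t) (n : ℕ) :
    ∑ i ∈ Finset.range n, Real.exp (-t * ((i : ℝ) + 1) ^ 2) ≤ √(Real.pi / t) / 2 := by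
  have hanti : AntitoneOn (fun x : ℝ => Real.exp (-t * x ^ 2)) (Icc 0 (0 + (n : ℝ))) := by
    intro x hx y _ hxy
    apply Real.exp_le_exp.2
    have : x ^ 2 ≤ y ^ 2 := by have := hx.1; gcongr
    nlinarith
  have h := hanti.sum_le_integral
  rw [intervalIntegral.integral_of_le (by positivity)] at h
  have h2 : ∫ x in Ioc 0 (0 + (n : ℝ)), Real.exp (-t * x ^ 2) ≤
      ∫ x in Ioi 0, Real.exp (-t * x ^ 2) :=
    setIntegral_mono_set (integrable_exp_neg_mul_sq ht).integrableOn
      (Eventually.of_forall fun x => by simp only [Pi.zero_apply]; positivity)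
      (Eventually.of_forall Ioc_subset_Ioi_self)
  rw [integral_gaussian_Ioi] at h2
  refine le_trans (le_of_eq ?_) (h.trans h2)
  simp

lemma sum_range_exp_neg_mul_sub_sq_le {t : ℝ} (ht : 0 < t) {n p : ℕ} (hp : p < n) :
    ∑ j ∈ Finset.range n, Real.exp (-t * ((p : ℝ) - j) ^ 2) ≤ 1 + √(Real.pi / t) := by
  obtain ⟨m, rfl⟩ : ∃ m, n = p + 1 + m := ⟨n - (p + 1), by omega⟩
  have h1 := sum_range_exp_neg_mul_succ_sq_le ht p
  have h2 := sum_range_exp_neg_mul_succ_sq_le ht m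
  rw [Finset.sum_range_add, Finset.sum_range_succ]
  have h3 : ∑ j ∈ Finset.range p, Real.exp (-t * ((p : ℝ) - j) ^ 2) =
      ∑ i ∈ Finset.range p, Real.exp (-t * ((i : ℝ) + 1) ^ 2) := by
    rw [← Finset.sum_range_reflect]
    refine Finset.sum_congr rfl fun j hj => ?_
    have hj' := Finset.mem_range.1 hj
    rw [Nat.sub_sub, Nat.cast_sub (by omega)]
    push_cast
    ring_nf
  have h4 : ∑ j ∈ Finset.range m, Real.exp (-t * ((p : ℝ) - ((p + 1 + j : ℕ) : ℝ)) ^ 2) =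
      ∑ i ∈ Finset.range m, Real.exp (-t * ((i : ℝ) + 1) ^ 2) := by
    refine Finset.sum_congr rfl fun j _ => ?_
    push_cast
    ring_nf
  have h5 : Real.exp (-t * ((p : ℝ) - p) ^ 2) = 1 := by simp
  rw [h3, h4, h5]
  linarith

/-- The squared Euclidean distance between two multi-indices. -/
noncomputable def indexSqDist {d n : ℕ} (p q : Fin d → Fin n) : ℝ :=
  ∑ i, ((p i : ℝ) - (q i : ℝ)) ^ 2

lemma one_le_indexSqDist {d n : ℕ} {p q : Fin d → Fin n} (h : p ≠ q) : 1 ≤ indexSqDist p q := by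
  obtain ⟨i, hi⟩ := Function.ne_iff.1 h
  refine le_trans ?_ (Finset.single_le_sum (f := fun i => ((p i : ℝ) - (q i : ℝ)) ^ 2)
    (fun i _ => sq_nonneg _) (Finset.mem_univ i))
  have h1 : ((p i : ℕ) : ℤ) - ((q i : ℕ) : ℤ) ≠ 0 := by
    have := Fin.val_ne_of_ne hi
    omega
  have h2 : (1 : ℤ) ≤ (((p i : ℕ) : ℤ) - ((q i : ℕ) : ℤ)) ^ 2 := by
    have := sq_nonneg (((p i : ℕ) : ℤ) - ((q i : ℕ) : ℤ))
    have := pow_ne_zero 2 h1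
    omega
  exact_mod_cast h2

lemma sum_exp_neg_mul_indexSqDist_le {d n : ℕ} {t : ℝ} (ht : 0 < t) (p : Fin d → Fin n) :
    ∑ q, Real.exp (-t * indexSqDist p q) ≤ (1 + √(Real.pi / t)) ^ d := by
  have h1 : ∑ q, Real.exp (-t * indexSqDist p q) =
      ∏ i, ∑ j : Fin n, Real.exp (-t * ((p i : ℝ) - (j : ℝ)) ^ 2) := by
    rw [Finset.prod_univ_sum, Fintype.piFinset_univ]
    refine Finset.sum_congr rfl fun q _ => ?_
    rw [indexSqDist, Finset.mul_sum, Real.exp_sum]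
  rw [h1]
  calc _ ≤ ∏ _i : Fin d, (1 + √(Real.pi / t)) := by
        refine Finset.prod_le_prod (fun i _ => by positivity) fun i _ => ?_
        rw [Fin.sum_univ_eq_sum_range (fun j => Real.exp (-t * ((p i : ℝ) - (j : ℝ)) ^ 2))]
        exact sum_range_exp_neg_mul_sub_sq_le ht (p i).2
    _ = _ := by simp

lemma exists_Gamma_mul_sum_indexSqDist_le (d : ℕ) (hd : 1 ≤ d) {η : ℝ} (hη : 1 < η) :
    ∃ C : ℝ, ∀ᶠ n : ℕ in atTop, ∀ p : Fin d → Fin n,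
      Real.Gamma ((d : ℝ) / 2) * ∑ q, (if p = q then 0 else √(indexSqDist p q) ^ (-(d : ℝ))) ≤
        η * Real.pi ^ ((d : ℝ) / 2) * (2 * Real.log n) + C := by
  have hd0 : (0 : ℝ) < d := by exact_mod_cast hd
  set a : ℝ := (d : ℝ) / 2 with ha_def
  have ha : 0 < a := by positivity
  have hpi := Real.pi_pos
  have hpow : ∀ u : ℝ, 0 ≤ u → u ^ a = √u ^ d := by
    intro u hu
    rw [Real.sqrt_eq_rpow, ← Real.rpow_natCast, ← Real.rpow_mul hu]
    congr 1
    rw [ha_def]; ring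
  obtain ⟨τ, hτ, hτη⟩ : ∃ τ : ℝ, 0 < τ ∧ (√(τ / Real.pi) + 1) ^ d ≤ η := by
    have hc : Tendsto (fun τ : ℝ => (√(τ / Real.pi) + 1) ^ d) (𝓝[>] 0) (𝓝 1) := by
      have : Continuous (fun τ : ℝ => (√(τ / Real.pi) + 1) ^ d) := by fun_prop
      have h := this.tendsto 0
      simp only [zero_div, Real.sqrt_zero, zero_add, one_pow] at h
      exact h.mono_left nhdsWithin_le_nhds
    obtain ⟨τ, h1, h2⟩ := ((hc.eventually_le_const hη).and self_mem_nhdsWithin).exists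
    exact ⟨τ, h2, h1⟩
  set C₁ : ℝ := (1 + √(Real.pi / (τ / 2))) ^ d with hC₁
  refine ⟨1 / a + η * Real.pi ^ a * Real.log τ +
    C₁ * (Real.Gamma a * (√2⁻¹) ^ (-(2 * a))), ?_⟩
  have hlim : Tendsto (fun n : ℕ => ((n : ℝ) ^ 2)⁻¹) atTop (𝓝 0) :=
    ((tendsto_pow_atTop two_ne_zero).comp tendsto_natCast_atTop_atTop).inv_tendsto_atTop
  filter_upwards [hlim.eventually_le_const hτ, eventually_ge_atTop 1] with n hn hn1 p
  have hn0 : (0 : ℝ) < n := by exact_mod_cast hn1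
  have hsq (q : Fin d → Fin n) : √(indexSqDist p q) ^ 2 = indexSqDist p q :=
    Real.sq_sqrt (Finset.sum_nonneg fun i _ => sq_nonneg _)
  have hpos {q : Fin d → Fin n} (h : p ≠ q) : 0 < √(indexSqDist p q) :=
    Real.sqrt_pos.2 (zero_lt_one.trans_le (one_le_indexSqDist h))
  set g : ℝ → ℝ := fun t => ∑ q, if p = q then 0 else Real.exp (-t * indexSqDist p q) with hg
  have hgle (t : ℝ) : g t ≤ ∑ q, Real.exp (-t * indexSqDist p q) := by
    refine Finset.sum_le_sum fun q _ => ?_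
    split_ifs
    · positivity
    · rfl
  have hi (q : Fin d → Fin n) : IntegrableOn (fun t : ℝ =>
      if p = q then 0 else t ^ (a - 1) * Real.exp (-t * indexSqDist p q)) (Ioi 0) := by
    by_cases h : p = q
    · simp [h]
    · simpa only [h, if_false, hsq] using
        integrableOn_rpow_sub_one_mul_exp_neg_mul_sq ha (hpos h)
  have hgeq : (fun t : ℝ => t ^ (a - 1) * g t) = fun t => ∑ q,
      if p = q then 0 else t ^ (a - 1) * Real.exp (-t * indexSqDist p q) := by
    ext t
    simp only [hg, Finset.mul_sum, mul_ite, mul_zero]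
  have hint : Real.Gamma a * ∑ q, (if p = q then 0 else √(indexSqDist p q) ^ (-(d : ℝ))) =
      ∫ t in Ioi 0, t ^ (a - 1) * g t := by
    rw [hgeq, integral_finsetSum _ fun q _ => hi q, Finset.mul_sum]
    refine Finset.sum_congr rfl fun q _ => ?_
    by_cases h : p = q
    · simp [h]
    · have := integral_rpow_mul_exp_neg_mul_sq ha (hpos h)
      rw [hsq, show 2 * a = d by rw [ha_def]; ring] at this
      simp only [h, if_false, this]
  rw [hint]
  have key := integral_rpow_mul_le (ε := ((n : ℝ) ^ 2)⁻¹) (τ := τ) (M := (n : ℝ) ^ d) (B := η)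
    (C := C₁) (g := g) ha (by positivity) hn
    (by rw [hgeq]; exact integrable_finsetSum _ fun q _ => hi q) ?_ ?_ ?_ (by positivity)
  · have h1 : (((n : ℝ) ^ 2)⁻¹) ^ a = ((n : ℝ) ^ d)⁻¹ := by
      rw [hpow _ (by positivity), Real.sqrt_inv, Real.sqrt_sq hn0.le, inv_pow]
    rw [h1, Real.log_inv, Real.log_pow] at key
    have h2 : (n : ℝ) ^ d * (((n : ℝ) ^ d)⁻¹ / a) = 1 / a := by
      field_simp
    rw [h2] at key
    push_cast at key
    linarith
  · intro t ht
    refine (hgle t).trans ?_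
    calc _ ≤ ∑ _q : Fin d → Fin n, (1 : ℝ) := by
          refine Finset.sum_le_sum fun q _ => Real.exp_le_one_iff.2 ?_
          have : 0 ≤ indexSqDist p q := Finset.sum_nonneg fun i _ => sq_nonneg _
          nlinarith
      _ = _ := by simp
  · intro t ht htτ
    refine ((hgle t).trans (sum_exp_neg_mul_indexSqDist_le ht p)).trans ?_
    rw [hpow _ (by positivity)]
    have h1 : 1 + √(Real.pi / t) = (√(t / Real.pi) + 1) * √(Real.pi / t) := by
      rw [add_mul, ← Real.sqrt_mul (by positivity)]
      have : t / Real.pi * (Real.pi / t) = 1 := by field_simp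
      rw [this, Real.sqrt_one, one_mul]
    rw [h1, mul_pow]
    gcongr
    refine le_trans ?_ hτη
    gcongr
  · intro t ht
    have h1 : (√2⁻¹ : ℝ) ^ 2 = 1 / 2 := by rw [Real.sq_sqrt] <;> norm_num
    rw [h1]
    have ht0 : 0 < t := hτ.trans_le ht
    calc g t ≤ ∑ q, Real.exp (-(τ / 2) * indexSqDist p q) * Real.exp (-t * (1 / 2)) := by
          refine Finset.sum_le_sum fun q _ => ?_
          split_ifs with h
          · positivity
          · rw [← Real.exp_add]
            apply Real.exp_le_exp.2
            have := one_le_indexSqDist h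
            nlinarith
      _ ≤ _ := by
          rw [← Finset.sum_mul]
          gcongr
          exact sum_exp_neg_mul_indexSqDist_le (by positivity) p

lemma minRieszEnergy_unitCube_le_of_grid {d n N : ℕ} (hn : 1 ≤ n) (hN : N ≤ n ^ d) {B : ℝ}
    (hB : ∀ p : Fin d → Fin n,
      ∑ q, (if p = q then 0 else √(indexSqDist p q) ^ (-(d : ℝ))) ≤ B) :
    minRieszEnergy (d : ℝ) (unitCube d) N ≤ ENNReal.ofReal (N * ((n : ℝ) ^ d * B)) := by
  have hn0 : (0 : ℝ) < n := by exact_mod_cast hn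
  set G : (Fin d → Fin n) → EuclideanSpace ℝ (Fin d) :=
    fun p => WithLp.toLp 2 fun i => (p i : ℝ) / n with hG
  have hdist (p q : Fin d → Fin n) : dist (G p) (G q) = √(indexSqDist p q) / n := by
    rw [EuclideanSpace.dist_eq]
    have h1 : ∑ i, dist ((G p).ofLp i) ((G q).ofLp i) ^ 2 = indexSqDist p q / (n : ℝ) ^ 2 := by
      rw [indexSqDist, Finset.sum_div]
      refine Finset.sum_congr rfl fun i _ => ?_
      simp only [hG, Real.dist_eq, sq_abs]
      rw [← sub_div, div_pow]
    rw [h1, Real.sqrt_div' _ (by positivity), Real.sqrt_sq hn0.le]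
  have hinj : Function.Injective G := by
    intro p q h
    by_contra hne
    have h1 := hdist p q
    rw [h, dist_self] at h1
    have : 0 < √(indexSqDist p q) :=
      Real.sqrt_pos.2 (zero_lt_one.trans_le (one_le_indexSqDist hne))
    have : 0 < √(indexSqDist p q) / n := by positivity
    linarith
  obtain ⟨s, -, hs⟩ := Finset.exists_subset_card_eq
    (s := (Finset.univ : Finset (Fin d → Fin n))) (n := N) (by simpa using hN)
  have hcube : (↑(s.map ⟨G, hinj⟩) : Set (EuclideanSpace ℝ (Fin d))) ⊆ unitCube d := by
    intro x hx
    simp only [Finset.coe_map, Function.Embedding.coeFn_mk, Set.mem_image] at hx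
    obtain ⟨p, -, rfl⟩ := hx
    intro i
    have h1 : ((p i : ℕ) : ℝ) ≤ n := by exact_mod_cast (p i).2.le
    exact ⟨by simp only [hG]; positivity, by simp only [hG]; rwa [div_le_one hn0]⟩
  have hcard : (s.map ⟨G, hinj⟩).card = N := by rw [Finset.card_map, hs]
  have hle : minRieszEnergy (d : ℝ) (unitCube d) N ≤ rieszEnergy (d : ℝ) (s.map ⟨G, hinj⟩) :=
    (iInf₂_le (s.map ⟨G, hinj⟩) hcube).trans (iInf_le _ hcard)
  refine hle.trans ?_
  rw [rieszEnergy_eq_ofReal_s17]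
  apply ENNReal.ofReal_le_ofReal
  rw [Finset.sum_map, ← hs, ← nsmul_eq_mul]
  refine Finset.sum_le_card_nsmul _ _ _ fun p _ => ?_
  rw [Finset.sum_map]
  refine le_trans ?_ (mul_le_mul_of_nonneg_left (hB p) (by positivity))
  rw [Finset.mul_sum]
  refine le_trans (Finset.sum_le_sum fun q _ => le_of_eq ?_)
    (Finset.sum_le_sum_of_subset_of_nonneg (Finset.subset_univ s) fun q _ _ => ?_)
  · simp only [Function.Embedding.coeFn_mk, hinj.eq_iff, hdist]
    split_ifs
    · simp
    · rw [Real.div_rpow (by positivity) hn0.le, Real.rpow_neg hn0.le, Real.rpow_natCast,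
        div_inv_eq_mul, mul_comm]
  · split_ifs <;> positivity

lemma exists_le_Gamma_mul_sum_dist_rpow_unitCube (d : ℕ) (hd : 1 ≤ d) {η : ℝ} (hη : η < 1) :
    ∃ L : ℝ, ∀ᶠ N : ℕ in atTop, ∀ ω : Finset (EuclideanSpace ℝ (Fin d)),
      ↑ω ⊆ unitCube d → ω.card = N →
        (N : ℝ) ^ 2 * (η * Real.pi ^ ((d : ℝ) / 2) * (Real.log N / ((d : ℝ) / 2) - L) -
            1 / ((d : ℝ) / 2)) ≤
          Real.Gamma ((d : ℝ) / 2) *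
            ∑ x ∈ ω, ∑ y ∈ ω, if x = y then 0 else dist x y ^ (-(d : ℝ)) := by
  have hd0 : (0 : ℝ) < d := by exact_mod_cast hd
  set a : ℝ := (d : ℝ) / 2 with ha_def
  have ha : 0 < a := by positivity
  have hfin : ((Module.finrank ℝ (EuclideanSpace ℝ (Fin d)) : ℕ) : ℝ) / 2 = a := by simp [ha_def]
  obtain ⟨δ, hδ, hδη⟩ : ∃ δ : ℝ, 0 < δ ∧ (1 + 2 * δ) ^ d ≤ 1 + (1 - η) / 2 := by
    have hc : Tendsto (fun δ : ℝ => (1 + 2 * δ) ^ d) (𝓝[>] 0) (𝓝 1) := by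
      have : Continuous (fun δ : ℝ => (1 + 2 * δ) ^ d) := by fun_prop
      have h := this.tendsto 0
      simp only [mul_zero, add_zero, one_pow] at h
      exact h.mono_left nhdsWithin_le_nhds
    obtain ⟨δ, h1, h2⟩ := ((hc.eventually_le_const
      (show 1 < 1 + (1 - η) / 2 by linarith)).and self_mem_nhdsWithin).exists
    exact ⟨δ, h2, h1⟩
  obtain ⟨t₀, ht₀, ht₀η⟩ : ∃ t₀ : ℝ, 0 < t₀ ∧
      2 * (2 ^ a * Real.exp (-t₀ * δ ^ 2)) ≤ (1 - η) / 2 := by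
    have hc : Tendsto (fun t : ℝ => 2 * (2 ^ a * Real.exp (-t * δ ^ 2))) atTop (𝓝 0) := by
      have h1 : Tendsto (fun t : ℝ => -t * δ ^ 2) atTop atBot :=
        tendsto_neg_atTop_atBot.atBot_mul_const (by positivity)
      have := ((Real.tendsto_exp_atBot.comp h1).const_mul (2 ^ a : ℝ)).const_mul 2
      simpa using this
    obtain ⟨t, h1, h2⟩ :=
      ((hc.eventually_le_const (show 0 < (1 - η) / 2 by linarith)).and
        (eventually_gt_atTop 0)).exists
    exact ⟨t, h2, h1⟩
  set W : Set (EuclideanSpace ℝ (Fin d)) := {z | ∀ i, z i ∈ Icc (-δ) (1 + δ)} with hW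
  have hWpre : W = (MeasurableEquiv.toLp 2 (Fin d → ℝ)).symm ⁻¹'
      Icc (fun _ => -δ) (fun _ => 1 + δ) := by
    ext z
    simp only [hW, Set.mem_ofPred_eq, Set.mem_preimage, Set.mem_Icc, Pi.le_def, forall_and]
    rfl
  have hWm : MeasurableSet W := by
    rw [hWpre]
    exact (MeasurableEquiv.measurable _) measurableSet_Icc
  have hWvol : volume W = ENNReal.ofReal ((1 + 2 * δ) ^ d) := by
    rw [hWpre, (EuclideanSpace.volume_preserving_symm_measurableEquiv_toLp (Fin d)).measure_preimage
      measurableSet_Icc.nullMeasurableSet, Real.volume_Icc_pi]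
    simp only [Finset.prod_const, Finset.card_univ, Fintype.card_fin]
    rw [← ENNReal.ofReal_pow (by linarith)]
    congr 2
    ring
  have hWreal : volume.real W = (1 + 2 * δ) ^ d := by
    rw [Measure.real, hWvol, ENNReal.toReal_ofReal (by positivity)]
  refine ⟨Real.log t₀, ?_⟩
  have hlim : Tendsto (fun N : ℕ => (N : ℝ) ^ (1 / a)) atTop atTop :=
    (tendsto_rpow_atTop (by positivity)).comp tendsto_natCast_atTop_atTop
  filter_upwards [hlim.eventually_ge_atTop t₀, eventually_ge_atTop 1] with N hNT hN1 ω hω hcard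
  have hN0 : (0 : ℝ) < N := by exact_mod_cast hN1
  have hpd : ∀ t, t₀ ≤ t → ((N : ℝ) ^ 2 * η) * (Real.pi / t) ^ a ≤
      ∑ x ∈ ω, ∑ y ∈ ω, Real.exp (-t * dist x y ^ 2) := by
    intro t ht
    have htpos := ht₀.trans_le ht
    have h1 := card_sq_mul_le_sum_exp_neg_mul_norm_sub_sq
      (κ := 1 - 2 ^ a * Real.exp (-t * δ ^ 2)) htpos (W := W) (by rw [hWvol]; simp) ω ?_
    · simp only [← dist_eq_norm] at h1
      refine le_trans ?_ h1
      rw [hfin, hcard, hWreal]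
      have h2 : Real.exp (-t * δ ^ 2) ≤ Real.exp (-t₀ * δ ^ 2) := by
        gcongr
      have h3 : (2 : ℝ) ^ a * Real.exp (-t * δ ^ 2) ≤ 2 ^ a * Real.exp (-t₀ * δ ^ 2) := by
        gcongr
      have h4 : η ≤ 2 * (1 - 2 ^ a * Real.exp (-t * δ ^ 2)) - (1 + 2 * δ) ^ d := by linarith
      have h5 : 0 ≤ (N : ℝ) ^ 2 * (Real.pi / t) ^ a := by
        have := Real.pi_pos
        positivity
      nlinarith
    · intro x hx
      have h1 := le_setIntegral_exp_neg_mul_norm_sub_sq htpos hδ.le hWm (x := x) ?_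
      · rwa [hfin] at h1 ⊢
      · intro z hz i
        have hx1 := hω hx i
        have h2 : |z i - x i| ≤ δ := by
          have h3 := PiLp.norm_apply_le (z - x) i
          rw [Metric.mem_closedBall, dist_eq_norm] at hz
          exact le_trans (by simpa using h3) hz
        rw [abs_le] at h2
        exact ⟨by linarith [hx1.1], by linarith [hx1.2]⟩
  have key := le_Gamma_mul_sum_dist_rpow ha ht₀ hNT ω hpd
  rw [Real.log_rpow hN0, ← Real.rpow_mul hN0.le, one_div_mul_cancel ha.ne', Real.rpow_one, hcard,
    show 2 * a = d by rw [ha_def]; ring] at key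
  refine le_trans (le_of_eq ?_) (key.trans (le_of_eq ?_))
  · ring
  · congr!

lemma volume_closedBall_euclideanSpace_eq (d : ℕ) (hd : 1 ≤ d) :
    volume (Metric.closedBall (0 : EuclideanSpace ℝ (Fin d)) 1) =
      ENNReal.ofReal (2 * Real.pi ^ ((d : ℝ) / 2) / ((d : ℝ) * Real.Gamma ((d : ℝ) / 2))) := by
  have : Nonempty (Fin d) := ⟨⟨0, hd⟩⟩
  have hd0 : (0 : ℝ) < d := by exact_mod_cast hd
  rw [EuclideanSpace.volume_closedBall, ENNReal.ofReal_one, one_pow, one_mul, Fintype.card_fin,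
    Real.Gamma_add_one (by positivity), Real.sqrt_eq_rpow, ← Real.rpow_natCast,
    ← Real.rpow_mul Real.pi_pos.le]
  congr 1
  have := Real.Gamma_pos_of_pos (show 0 < (d : ℝ) / 2 by positivity)
  rw [one_div_mul_eq_div]
  field_simp

lemma tendsto_floor_rpow_add_one_div {d : ℕ} (hd : 1 ≤ d) :
    Tendsto (fun N : ℕ => ((⌊(N : ℝ) ^ (1 / (d : ℝ))⌋₊ + 1 : ℕ) : ℝ) / (N : ℝ) ^ (1 / (d : ℝ)))
      atTop (𝓝 1) := by
  have hd0 : (0 : ℝ) < d := by exact_mod_cast hd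
  have hx : Tendsto (fun N : ℕ => (N : ℝ) ^ (1 / (d : ℝ))) atTop atTop :=
    (tendsto_rpow_atTop (by positivity)).comp tendsto_natCast_atTop_atTop
  have h := ((tendsto_nat_floor_div_atTop (R := ℝ)).add tendsto_inv_atTop_zero).comp hx
  rw [add_zero] at h
  refine h.congr fun N => ?_
  simp only [Function.comp_apply]
  push_cast
  rw [add_div, one_div ((N : ℝ) ^ _)]

lemma eventually_minRieszEnergy_unitCube_div_le (d : ℕ) (hd : 1 ≤ d) {b : ℝ}
    (hb : 2 * Real.pi ^ ((d : ℝ) / 2) / ((d : ℝ) * Real.Gamma ((d : ℝ) / 2)) < b) :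
    ∀ᶠ N : ℕ in atTop, minRieszEnergy (d : ℝ) (unitCube d) N /
      ENNReal.ofReal ((N : ℝ) ^ 2 * Real.log N) ≤ ENNReal.ofReal b := by
  have hd0 : (0 : ℝ) < d := by exact_mod_cast hd
  have hΓ := Real.Gamma_pos_of_pos (show 0 < (d : ℝ) / 2 by positivity)
  set Γ := Real.Gamma ((d : ℝ) / 2)
  have hpi := Real.pi_pos
  set β := 2 * Real.pi ^ ((d : ℝ) / 2) / ((d : ℝ) * Γ) with hβ
  have hβ0 : 0 < β := by positivity
  obtain ⟨η, hη1, hηb⟩ : ∃ η : ℝ, 1 < η ∧ η * β < b := by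
    obtain ⟨η, h1, h2⟩ := exists_between ((one_lt_div hβ0).2 hb)
    exact ⟨η, h1, (lt_div_iff₀ hβ0).1 h2⟩
  obtain ⟨C, hC⟩ := exists_Gamma_mul_sum_indexSqDist_le d hd hη1
  set x : ℕ → ℝ := fun N => (N : ℝ) ^ (1 / (d : ℝ)) with hx
  set m : ℕ → ℕ := fun N => ⌊x N⌋₊ + 1 with hm
  have hxt : Tendsto x atTop atTop :=
    (tendsto_rpow_atTop (by positivity)).comp tendsto_natCast_atTop_atTop
  have hmt : Tendsto m atTop atTop :=
    tendsto_atTop_mono (fun N => Nat.le_succ _) (tendsto_nat_floor_atTop.comp hxt)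
  have hu : Tendsto (fun N => (m N : ℝ) / x N) atTop (𝓝 1) := tendsto_floor_rpow_add_one_div hd
  have hlog : Tendsto (fun N : ℕ => Real.log N) atTop atTop :=
    Real.tendsto_log_atTop.comp tendsto_natCast_atTop_atTop
  have hlim : Tendsto (fun N : ℕ => ((m N : ℝ) / x N) ^ d *
      ((η * Real.pi ^ ((d : ℝ) / 2) * (2 * (Real.log ((m N : ℝ) / x N) * (Real.log N)⁻¹ + 1 / d)) +
        C * (Real.log N)⁻¹) / Γ)) atTop (𝓝 (η * β)) := by
    have hli := hlog.inv_tendsto_atTop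
    have h1 := (hu.log one_ne_zero).mul hli
    have h2 := (hu.pow d).mul (((((h1.add_const (1 / (d : ℝ))).const_mul 2).const_mul
      (η * Real.pi ^ ((d : ℝ) / 2))).add (hli.const_mul C)).div_const Γ)
    convert h2 using 2
    · rfl
    · rw [hβ, Real.log_one]
      field_simp
      ring
  filter_upwards [hlim.eventually_le_const hηb, hmt.eventually hC, eventually_ge_atTop 2] with
    N h1 h2 hN2
  have hN0 : (0 : ℝ) < N := by positivity
  have hlogpos : 0 < Real.log N := Real.log_pos (by exact_mod_cast hN2)
  have hx0 : 0 < x N := by positivity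
  have hxd : x N ^ d = N := by
    rw [hx, ← Real.rpow_natCast, ← Real.rpow_mul hN0.le, one_div_mul_cancel hd0.ne', Real.rpow_one]
  have hm1 : 1 ≤ m N := Nat.le_add_left _ _
  have hm0 : (0 : ℝ) < m N := by exact_mod_cast hm1
  have hNm : N ≤ m N ^ d := by
    have h3 : x N ≤ m N := by
      have := (Nat.lt_floor_add_one (x N)).le
      simpa [hm] using this
    have h4 : (N : ℝ) ≤ (m N : ℝ) ^ d := by
      rw [← hxd]
      gcongr
    exact_mod_cast h4
  have h3 := minRieszEnergy_unitCube_le_of_grid hm1 hNm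
    (B := (η * Real.pi ^ ((d : ℝ) / 2) * (2 * Real.log (m N)) + C) / Γ)
    (fun p => by rw [le_div_iff₀ hΓ, mul_comm]; exact h2 p)
  refine (ENNReal.div_le_div_right h3 _).trans ?_
  rw [← ENNReal.ofReal_div_of_pos (by positivity)]
  apply ENNReal.ofReal_le_ofReal
  refine le_trans (le_of_eq ?_) h1
  have h4 : Real.log ((m N : ℝ) / x N) = Real.log (m N) - Real.log N / d := by
    rw [Real.log_div hm0.ne' hx0.ne', hx, Real.log_rpow hN0]
    ring
  rw [h4, div_pow, hxd]
  field_simp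
  ring

lemma eventually_le_minRieszEnergy_unitCube_div (d : ℕ) (hd : 1 ≤ d) {b : ℝ}
    (hb : b < 2 * Real.pi ^ ((d : ℝ) / 2) / ((d : ℝ) * Real.Gamma ((d : ℝ) / 2))) :
    ∀ᶠ N : ℕ in atTop, ENNReal.ofReal b ≤ minRieszEnergy (d : ℝ) (unitCube d) N /
      ENNReal.ofReal ((N : ℝ) ^ 2 * Real.log N) := by
  have hd0 : (0 : ℝ) < d := by exact_mod_cast hd
  have hΓ := Real.Gamma_pos_of_pos (show 0 < (d : ℝ) / 2 by positivity)
  set Γ := Real.Gamma ((d : ℝ) / 2)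
  have hpi := Real.pi_pos
  set β := 2 * Real.pi ^ ((d : ℝ) / 2) / ((d : ℝ) * Γ) with hβ
  have hβ0 : 0 < β := by positivity
  obtain ⟨η, hηb, hη1⟩ : ∃ η : ℝ, b < η * β ∧ η < 1 := by
    obtain ⟨η, h1, h2⟩ := exists_between ((div_lt_one hβ0).2 hb)
    exact ⟨η, (div_lt_iff₀ hβ0).1 h1, h2⟩
  obtain ⟨L, hL⟩ := exists_le_Gamma_mul_sum_dist_rpow_unitCube d hd hη1
  have hlog : Tendsto (fun N : ℕ => Real.log N) atTop atTop :=
    Real.tendsto_log_atTop.comp tendsto_natCast_atTop_atTop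
  have hlim : Tendsto (fun N : ℕ => (η * Real.pi ^ ((d : ℝ) / 2) *
      (1 / ((d : ℝ) / 2) - L * (Real.log N)⁻¹) - 1 / ((d : ℝ) / 2) * (Real.log N)⁻¹) / Γ)
      atTop (𝓝 (η * β)) := by
    have hli := hlog.inv_tendsto_atTop
    have h2 := ((((hli.const_mul L).const_sub (1 / ((d : ℝ) / 2))).const_mul
      (η * Real.pi ^ ((d : ℝ) / 2))).sub (hli.const_mul (1 / ((d : ℝ) / 2)))).div_const Γ
    convert h2 using 2
    · rfl
    · rw [hβ]
      field_simp
      ring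
  filter_upwards [hlim.eventually_const_le hηb, hL, eventually_ge_atTop 2] with N h1 h2 hN2
  have hN0 : (0 : ℝ) < N := by positivity
  have hlogpos : 0 < Real.log N := Real.log_pos (by exact_mod_cast hN2)
  have hpos : 0 < (N : ℝ) ^ 2 * Real.log N := by positivity
  rw [ENNReal.le_div_iff_mul_le (Or.inl (ENNReal.ofReal_pos.2 hpos).ne')
    (Or.inl ENNReal.ofReal_ne_top), ← ENNReal.ofReal_mul' hpos.le]
  refine le_iInf fun ω => le_iInf fun hω => le_iInf fun hcard => ?_
  rw [rieszEnergy_eq_ofReal_s17]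
  apply ENNReal.ofReal_le_ofReal
  refine le_of_mul_le_mul_left (le_trans ?_ ((h2 ω hω hcard).trans (le_of_eq (by congr!)))) hΓ
  have h3 := mul_le_mul_of_nonneg_right h1 (show 0 ≤ Γ * ((N : ℝ) ^ 2 * Real.log N) by positivity)
  refine le_trans (le_of_eq ?_) (h3.trans (le_of_eq ?_))
  · ring
  · field_simp

/-- `ℰ_d(U^d,N)/(N² log N) → H_d(B^d) = 2 π^{d/2} / (d Γ(d/2))`. -/
theorem tendsto_minRieszEnergy_unitCube_crit (d : ℕ) (hd : 1 ≤ d) :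
    Tendsto
      (fun N : ℕ =>
        minRieszEnergy (d : ℝ) (unitCube d) N / ENNReal.ofReal ((N : ℝ) ^ 2 * Real.log N))
      atTop (𝓝 (volume (Metric.closedBall (0 : EuclideanSpace ℝ (Fin d)) 1))) ∧
    volume (Metric.closedBall (0 : EuclideanSpace ℝ (Fin d)) 1) =
      ENNReal.ofReal (2 * Real.pi ^ ((d : ℝ) / 2) / ((d : ℝ) * Real.Gamma ((d : ℝ) / 2))) := by
  have hvol := volume_closedBall_euclideanSpace_eq d hd
  refine ⟨?_, hvol⟩
  rw [hvol]
  refine tendsto_order.2 ⟨fun a ha => ?_, fun a ha => ?_⟩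
  · obtain ⟨r, h1, h2⟩ := ENNReal.lt_iff_exists_nnreal_btwn.1 ha
    rw [← ENNReal.ofReal_coe_nnreal] at h1 h2
    filter_upwards [eventually_le_minRieszEnergy_unitCube_div d hd
      ((ENNReal.ofReal_lt_ofReal_iff_of_nonneg r.2).1 h2)] with N hN
    exact h1.trans_le hN
  · obtain ⟨r, h1, h2⟩ := ENNReal.lt_iff_exists_nnreal_btwn.1 ha
    rw [← ENNReal.ofReal_coe_nnreal] at h1 h2
    filter_upwards [eventually_minRieszEnergy_unitCube_div_le d hd
      (ENNReal.ofReal_lt_ofReal_iff'.1 h1).1] with N hN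
    exact hN.trans_lt h2
end
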